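/- arXiv:1106.4972 — 2 statements merged into one kernel-verified Lean document; each statement's English description precedes it below -/
import Mathlib

section
/- Let R be a Gorenstein local ring and M a nonzero finitely generated R-module. Then M is G–Gorenstein if and only if M is Gorenstein projective. -/
universe u

namespace GG

open RingTheory.Sequence

variable (R : Type u) [CommRing R]

/-- A module `N` is Gorenstein injective if it is a kernel in a `Hom(Inj,−)`-exact exact
doubly infinite complex of injective modules. -/
def IsGorensteinInjective (N : Type u) [AddCommGroup N] [Module R N] : Prop :=
  ∃ (X : ℤ → ModuleCat.{u} R) (d : ∀ n : ℤ, X n →ₗ[R] X (n + 1)),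
    (∀ n, Module.Injective R (X n)) ∧
    (∀ n, LinearMap.range (d n) = LinearMap.ker (d (n + 1))) ∧
    (∀ (I : ModuleCat.{u} R), Module.Injective R I →
      ∀ (n : ℤ) (φ : I →ₗ[R] X (n + 1)), (d (n + 1)).comp φ = 0 →
        ∃ ψ : I →ₗ[R] X n, (d n).comp ψ = φ) ∧
    Nonempty (N ≃ₗ[R] LinearMap.ker (d 0))

/-- A module `N` is Gorenstein projective if it is a kernel in a `Hom(−,Proj)`-exact exact
doubly infinite complex of projective modules. -/
def IsGorensteinProjective (N : Type u) [AddCommGroup N] [Module R N] : Prop :=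
  ∃ (X : ℤ → ModuleCat.{u} R) (d : ∀ n : ℤ, X n →ₗ[R] X (n + 1)),
    (∀ n, Module.Projective R (X n)) ∧
    (∀ n, LinearMap.range (d n) = LinearMap.ker (d (n + 1))) ∧
    (∀ (P : ModuleCat.{u} R), Module.Projective R P →
      ∀ (n : ℤ) (φ : X (n + 1) →ₗ[R] P), φ.comp (d n) = 0 →
        ∃ ψ : X (n + 1 + 1) →ₗ[R] P, ψ.comp (d (n + 1)) = φ) ∧
    Nonempty (N ≃ₗ[R] LinearMap.ker (d 0))

/-- A module `N` is Gorenstein flat if it is a kernel in an `(Inj ⊗ −)`-exact exact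
doubly infinite complex of flat modules. -/
def IsGorensteinFlat (N : Type u) [AddCommGroup N] [Module R N] : Prop :=
  ∃ (X : ℤ → ModuleCat.{u} R) (d : ∀ n : ℤ, X n →ₗ[R] X (n + 1)),
    (∀ n, Module.Flat R (X n)) ∧
    (∀ n, LinearMap.range (d n) = LinearMap.ker (d (n + 1))) ∧
    (∀ (I : ModuleCat.{u} R), Module.Injective R I →
      ∀ n : ℤ, LinearMap.range (LinearMap.lTensor (R := R) I (d n)) =
        LinearMap.ker (LinearMap.lTensor (R := R) I (d (n + 1)))) ∧
    Nonempty (N ≃ₗ[R] LinearMap.ker (d 0))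

/-- Existence of a right resolution of length `≤ n` by modules satisfying `P`. -/
def CoresolutionLE (P : ModuleCat.{u} R → Prop) (M : Type u) [AddCommGroup M] [Module R M]
    (n : ℕ) : Prop :=
  ∃ (G : ℕ → ModuleCat.{u} R) (d : ∀ i : ℕ, G i →ₗ[R] G (i + 1)) (ε : M →ₗ[R] G 0),
    (∀ i, P (G i)) ∧ Function.Injective ε ∧
    LinearMap.range ε = LinearMap.ker (d 0) ∧
    (∀ i, LinearMap.range (d i) = LinearMap.ker (d (i + 1))) ∧
    (∀ i, n < i → ∀ x : G i, x = 0)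

/-- Existence of a left resolution of length `≤ n` by modules satisfying `P`. -/
def ResolutionLE (P : ModuleCat.{u} R → Prop) (M : Type u) [AddCommGroup M] [Module R M]
    (n : ℕ) : Prop :=
  ∃ (G : ℕ → ModuleCat.{u} R) (d : ∀ i : ℕ, G (i + 1) →ₗ[R] G i) (ε : G 0 →ₗ[R] M),
    (∀ i, P (G i)) ∧ Function.Surjective ε ∧
    LinearMap.ker ε = LinearMap.range (d 0) ∧
    (∀ i, LinearMap.ker (d i) = LinearMap.range (d (i + 1))) ∧
    (∀ i, n < i → ∀ x : G i, x = 0)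

/-- `Gid_R M ≤ n`. -/
def gidLE (M : Type u) [AddCommGroup M] [Module R M] (n : ℕ) : Prop :=
  CoresolutionLE R (fun N => IsGorensteinInjective R N) M n

/-- `id_R M ≤ n`. -/
def idLE (M : Type u) [AddCommGroup M] [Module R M] (n : ℕ) : Prop :=
  CoresolutionLE R (fun N => Module.Injective R N) M n

/-- `pd_R M ≤ n`. -/
def pdLE (M : Type u) [AddCommGroup M] [Module R M] (n : ℕ) : Prop :=
  ResolutionLE R (fun N => Module.Projective R N) M n

/-- `fd_R M ≤ n`. -/
def fdLE (M : Type u) [AddCommGroup M] [Module R M] (n : ℕ) : Prop :=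
  ResolutionLE R (fun N => Module.Flat R N) M n

/-- `Gfd_R M ≤ n`. -/
def gfdLE (M : Type u) [AddCommGroup M] [Module R M] (n : ℕ) : Prop :=
  ResolutionLE R (fun N => IsGorensteinFlat R N) M n

/-- Gorenstein injective dimension, as an extended natural number. -/
noncomputable def gid (M : Type u) [AddCommGroup M] [Module R M] : ℕ∞ :=
  sInf {c : ℕ∞ | ∃ n : ℕ, c = n ∧ gidLE R M n}

/-- The depth of a module over a local ring: the supremum of the lengths of regular
sequences contained in the maximal ideal. -/
noncomputable def mdepth [IsLocalRing R] (M : Type u) [AddCommGroup M] [Module R M] : ℕ∞ :=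
  sSup {c : ℕ∞ | ∃ rs : List R, c = rs.length ∧
    (∀ r ∈ rs, r ∈ IsLocalRing.maximalIdeal R) ∧ RingTheory.Sequence.IsRegular M rs}

/-- The Krull dimension of a module: the Krull dimension of its support. -/
noncomputable def mdim (M : Type u) [AddCommGroup M] [Module R M] : WithBot ℕ∞ :=
  Order.krullDim ↥(Module.support R M)

/-- The height of a prime in the support of `M`. -/
noncomputable def htM (M : Type u) [AddCommGroup M] [Module R M] (p : PrimeSpectrum R) : ℕ∞ :=
  ⨆ h : p ∈ Module.support R M, Order.height (⟨p, h⟩ : ↥(Module.support R M))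

/-- A Cohen–Macaulay module over a local ring: depth equals Krull dimension. -/
def IsCMModule [IsLocalRing R] (M : Type u) [AddCommGroup M] [Module R M] : Prop :=
  (mdepth R M : WithBot ℕ∞) = mdim R M

/-- A maximal Cohen–Macaulay module over a local ring. -/
def IsMaximalCM [IsLocalRing R] (M : Type u) [AddCommGroup M] [Module R M] : Prop :=
  IsCMModule R M ∧ mdim R M = ringKrullDim R

/-- A Cohen–Macaulay local ring. -/
def IsCMLocalRing [IsLocalRing R] : Prop :=
  (mdepth R R : WithBot ℕ∞) = ringKrullDim R

/-- A Gorenstein local ring: a Noetherian local ring of finite self-injective dimension. -/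
def IsGorensteinLocalRing [IsLocalRing R] : Prop :=
  IsNoetherianRing R ∧ ∃ n : ℕ, idLE R R n

/-- A regular local ring: Noetherian, and the maximal ideal is generated by `dim R` elements. -/
def IsRegularLocal [IsLocalRing R] : Prop :=
  IsNoetherianRing R ∧ ∃ s : Finset R, Ideal.span (s : Set R) = IsLocalRing.maximalIdeal R ∧
    (s.card : WithBot ℕ∞) = ringKrullDim R

/-- A (not necessarily local) Gorenstein ring: all localizations at primes are Gorenstein. -/
def IsGorensteinRing : Prop :=
  ∀ p : PrimeSpectrum R, ∃ n : ℕ,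
    idLE (Localization.AtPrime p.asIdeal) (Localization.AtPrime p.asIdeal) n

/-- `R` admits a dualizing complex; by Kawasaki's theorem this is equivalent to being a
homomorphic image of a finite-dimensional Gorenstein ring. -/
def HasDualizingComplex : Prop :=
  ∃ Q : CommRingCat.{u}, IsNoetherianRing Q ∧ ringKrullDim Q < ⊤ ∧ IsGorensteinRing Q ∧
    ∃ f : Q →+* R, Function.Surjective f

section Cousin

/-- The product of the localizations of `N` at the primes in `S`. -/
noncomputable abbrev locProd (S : Set (PrimeSpectrum R)) (N : Type u) [AddCommGroup N]
    [Module R N] : Type u :=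
  Π p : S, LocalizedModule p.1.asIdeal.primeCompl N

/-- The submodule of the product of localizations consisting of finitely supported families;
this is the direct sum `⊕_{p ∈ S} N_p`. -/
noncomputable def finSupp (S : Set (PrimeSpectrum R)) (N : Type u) [AddCommGroup N]
    [Module R N] : Submodule R (locProd R S N) where
  carrier := {f | {p : S | f p ≠ 0}.Finite}
  add_mem' := by
    intro f g hf hg
    refine (hf.union hg).subset ?_
    intro p hp
    by_contra h
    simp only [Set.mem_union, Set.mem_setOf_eq, not_or, not_not] at h
    exact hp (by simp [Pi.add_apply, h.1, h.2])
  zero_mem' := by simp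
  smul_mem' := by
    intro c f hf
    refine hf.subset ?_
    intro p hp
    by_contra h
    simp only [Set.mem_setOf_eq, not_not] at h
    exact hp (by simp [Pi.smul_apply, h])

/-- The canonical map `N → ∏_{p ∈ S} N_p`. -/
noncomputable def thetaFull (S : Set (PrimeSpectrum R)) (N : Type u) [AddCommGroup N]
    [Module R N] : N →ₗ[R] locProd R S N :=
  LinearMap.pi fun p => LocalizedModule.mkLinearMap p.1.asIdeal.primeCompl N

/-- The cokernel of `N → ⊕_{p ∈ S} N_p` (computed inside the direct sum). -/
noncomputable abbrev nextKType (S : Set (PrimeSpectrum R)) (N : Type u) [AddCommGroup N]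
    [Module R N] : Type u :=
  ↥(finSupp R S N) ⧸
    (Submodule.comap (finSupp R S N).subtype (LinearMap.range (thetaFull R S N)))

/-- The sequence of "kernel/cokernel" modules in the inductive construction
of the Cousin complex of `M` with respect to the filtration `F`. -/
noncomputable def cousinK (F : ℕ → Set (PrimeSpectrum R)) (M : ModuleCat.{u} R) :
    ℕ → ModuleCat.{u} R
  | 0 => M
  | n + 1 => ModuleCat.of R (nextKType R (F n \ F (n + 1)) (cousinK F M n))

/-- The `n`-th term `M^n = ⊕_{p ∈ ∂F_n} (coker d^{n-2})_p` of the Cousin complex. -/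
noncomputable abbrev cousinC (F : ℕ → Set (PrimeSpectrum R)) (M : ModuleCat.{u} R) (n : ℕ) :
    Type u :=
  ↥(finSupp R (F n \ F (n + 1)) (cousinK R F M n))

/-- The canonical map from the `n`-th cokernel into the product of its localizations. -/
noncomputable def cousinTheta (F : ℕ → Set (PrimeSpectrum R)) (M : ModuleCat.{u} R) (n : ℕ) :
    (cousinK R F M n) →ₗ[R] locProd R (F n \ F (n + 1)) (cousinK R F M n) :=
  thetaFull R _ _

/-- The (full) `n`-th differential of the Cousin complex, from `M^n` to the product at
level `n+1` (it lands inside the direct sum `M^{n+1}`). -/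
noncomputable def cousinD (F : ℕ → Set (PrimeSpectrum R)) (M : ModuleCat.{u} R) (n : ℕ) :
    (cousinC R F M n) →ₗ[R] locProd R (F (n + 1) \ F (n + 2)) (cousinK R F M (n + 1)) :=
  (cousinTheta R F M (n + 1)).comp
    (Submodule.mkQ (Submodule.comap (finSupp R (F n \ F (n + 1)) (cousinK R F M n)).subtype
      (LinearMap.range (thetaFull R (F n \ F (n + 1)) (cousinK R F M n)))))

/-- `F` is a filtration of `Spec R`: descending, and every element of `∂F_n = F_n \ F_{n+1}`
is a minimal member of `F_n`. -/
def IsFiltration (F : ℕ → Set (PrimeSpectrum R)) : Prop :=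
  (∀ n, F (n + 1) ⊆ F n) ∧
    ∀ n, ∀ p ∈ F n \ F (n + 1), ∀ q ∈ F n, q ≤ p → q = p

/-- The filtration `F` admits `M`. -/
def Admits (F : ℕ → Set (PrimeSpectrum R)) (M : Type u) [AddCommGroup M] [Module R M] : Prop :=
  Module.support R M ⊆ F 0

/-- The `M`-height filtration `K_i = {p ∈ Supp M | ht_M p ≥ i}`. -/
noncomputable def heightFiltration (M : Type u) [AddCommGroup M] [Module R M] :
    ℕ → Set (PrimeSpectrum R) :=
  fun i => {p | p ∈ Module.support R M ∧ (i : ℕ∞) ≤ htM R M p}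

/-- The Cousin complex `C(F, M)` is exact at `M, M⁰, …, M^t`
(together with the well-definedness of the differentials into the direct sums). -/
def CousinPartiallyExact (F : ℕ → Set (PrimeSpectrum R)) (M : ModuleCat.{u} R) (t : ℕ) : Prop :=
  (∀ n, LinearMap.range (cousinTheta R F M n) ≤ finSupp R (F n \ F (n + 1)) (cousinK R F M n)) ∧
  Function.Injective (cousinTheta R F M 0) ∧
  (∀ n ≤ t, LinearMap.ker (cousinD R F M n) =
    Submodule.comap (finSupp R (F n \ F (n + 1)) (cousinK R F M n)).subtype
      (LinearMap.range (cousinTheta R F M n)))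

/-- The Cousin complex `C(F, M)` is exact and all of its terms satisfy `P`, i.e. it provides
a `P`-resolution of `M`. -/
def CousinResolves (F : ℕ → Set (PrimeSpectrum R)) (M : ModuleCat.{u} R)
    (P : ModuleCat.{u} R → Prop) : Prop :=
  (∀ n, LinearMap.range (cousinTheta R F M n) ≤ finSupp R (F n \ F (n + 1)) (cousinK R F M n)) ∧
  Function.Injective (cousinTheta R F M 0) ∧
  (∀ n, LinearMap.ker (cousinD R F M n) =
    Submodule.comap (finSupp R (F n \ F (n + 1)) (cousinK R F M n)).subtype
      (LinearMap.range (cousinTheta R F M n))) ∧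
  (∀ n, P (ModuleCat.of R (cousinC R F M n)))

/-- A G–Gorenstein module: a nonzero finitely generated module whose Cousin complex with
respect to the `M`-height filtration is a Gorenstein injective resolution. -/
def IsGGorenstein (M : ModuleCat.{u} R) : Prop :=
  (∃ x : M, x ≠ 0) ∧ Module.Finite R M ∧
    CousinResolves R (heightFiltration R M) M (fun N => IsGorensteinInjective R N)

/-- A Gorenstein module: a nonzero finitely generated module whose Cousin complex with
respect to the `M`-height filtration is an injective resolution. -/
def IsGorensteinModule (M : ModuleCat.{u} R) : Prop :=
  (∃ x : M, x ≠ 0) ∧ Module.Finite R M ∧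
    CousinResolves R (heightFiltration R M) M (fun N => Module.Injective R N)

end Cousin

/-- A system of parameters of a local ring. -/
def IsSOP [IsLocalRing R] (rs : List R) : Prop :=
  (rs.length : WithBot ℕ∞) = ringKrullDim R ∧
    (∀ r ∈ rs, r ∈ IsLocalRing.maximalIdeal R) ∧
    IsLocalRing.maximalIdeal R ≤ (Ideal.span {r | r ∈ rs}).radical

/-- A balanced big Cohen–Macaulay module: every system of parameters of `R` is a regular
sequence on `M`. -/
def IsBalancedBigCM [IsLocalRing R] (M : Type u) [AddCommGroup M] [Module R M] : Prop :=
  ∀ rs : List R, IsSOP R rs → RingTheory.Sequence.IsRegular M rs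

end GG

namespace GGP
open CategoryTheory CategoryTheory.Abelian

section toolbox
variable {R : Type u} [CommRing R]

/-- `Ext` of unbundled modules. -/
abbrev EX (R : Type u) [CommRing R] (N T : Type u) [AddCommGroup N] [Module R N]
    [AddCommGroup T] [Module R T] (i : ℕ) : Type u :=
  Ext (ModuleCat.of R N) (ModuleCat.of R T) i

/-- every element of `Ext^i(N,T)` is killed by an element of `S`. -/
def LV (S : Submonoid R) (N T : Type u) [AddCommGroup N] [Module R N]
    [AddCommGroup T] [Module R T] (i : ℕ) : Prop :=
  ∀ ξ : EX R N T i, ∃ s ∈ S, s • ξ = 0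

/-- vanishing of Ext. -/
abbrev V (R : Type u) [CommRing R] (N T : Type u) [AddCommGroup N] [Module R N]
    [AddCommGroup T] [Module R T] (i : ℕ) : Prop := LV (⊥ : Submonoid R) N T i

variable {A B C N T T' : Type u} [AddCommGroup A] [Module R A] [AddCommGroup B] [Module R B]
  [AddCommGroup C] [Module R C] [AddCommGroup N] [Module R N] [AddCommGroup T] [Module R T]
  [AddCommGroup T'] [Module R T']

lemma V_iff {i : ℕ} : V R N T i ↔ ∀ ξ : EX R N T i, ξ = 0 := by
  constructor
  · intro h ξ
    obtain ⟨s, hs, h⟩ := h ξ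
    rw [Submonoid.mem_bot] at hs
    simpa [hs] using h
  · intro h ξ
    exact ⟨1, Submonoid.one_mem _, by rw [h ξ, smul_zero]⟩

lemma V_iff_sub {i : ℕ} : V R N T i ↔ Subsingleton (EX R N T i) := by
  rw [V_iff]
  exact ⟨fun h => subsingleton_of_forall_eq 0 h, fun h ξ => Subsingleton.elim _ _⟩

lemma V.lv {i : ℕ} (h : V R N T i) (S : Submonoid R) : LV S N T i := fun ξ =>
  ⟨1, S.one_mem, by rw [V_iff.1 h ξ, smul_zero]⟩

/-- the short complex from an exact pair -/
abbrev scOf (f : A →ₗ[R] B) (g : B →ₗ[R] C) (h : Function.Exact f g) :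
    ShortComplex (ModuleCat.{u} R) :=
  ShortComplex.mk (ModuleCat.ofHom f) (ModuleCat.ofHom g)
    (by ext x; exact h.apply_apply_eq_zero x)

lemma scOf_se (f : A →ₗ[R] B) (g : B →ₗ[R] C) (hf : Function.Injective f)
    (hg : Function.Surjective g) (h : Function.Exact f g) : (scOf f g h).ShortExact where
  exact := (ShortComplex.ShortExact.moduleCat_exact_iff_function_exact _).2 h
  mono_f := (ModuleCat.mono_iff_injective _).2 hf
  epi_g := (ModuleCat.epi_iff_surjective _).2 hg

section LES
variable {S : Submonoid R} {f : A →ₗ[R] B} {g : B →ₗ[R] C} (hf : Function.Injective f)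
  (hg : Function.Surjective g) (h : Function.Exact f g)
include hf hg h

lemma cov2 {i : ℕ} (h1 : LV S N A i) (h3 : LV S N C i) : LV S N B i := by
  intro ξ
  have se := scOf_se f g hf hg h
  obtain ⟨s, hs, e⟩ := h3 (ξ.comp (Ext.mk₀ (scOf f g h).g) (add_zero i))
  obtain ⟨η, hη⟩ := Ext.covariant_sequence_exact₂ (ModuleCat.of R N) se (s • ξ)
    (by rw [Ext.smul_comp]; exact e)
  obtain ⟨t, ht, e'⟩ := h1 η
  refine ⟨t * s, S.mul_mem ht hs, ?_⟩
  rw [mul_smul, ← hη, ← Ext.smul_comp, e', Ext.zero_comp]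

lemma cov3 {i : ℕ} (h2 : LV S N B i) (h1 : LV S N A (i + 1)) : LV S N C i := by
  intro ξ
  have se := scOf_se f g hf hg h
  obtain ⟨s, hs, e⟩ := h1 (ξ.comp se.extClass rfl)
  obtain ⟨η, hη⟩ := Ext.covariant_sequence_exact₃ (ModuleCat.of R N) se (s • ξ) rfl
    (by rw [Ext.smul_comp]; exact e)
  obtain ⟨t, ht, e'⟩ := h2 η
  refine ⟨t * s, S.mul_mem ht hs, ?_⟩
  rw [mul_smul, ← hη, ← Ext.smul_comp, e', Ext.zero_comp]

lemma cov1 {i : ℕ} (h3 : LV S N C i) (h2 : LV S N B (i + 1)) : LV S N A (i + 1) := by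
  intro ξ
  have se := scOf_se f g hf hg h
  obtain ⟨s, hs, e⟩ := h2 (ξ.comp (Ext.mk₀ (scOf f g h).f) (add_zero _))
  obtain ⟨η, hη⟩ := Ext.covariant_sequence_exact₁ (ModuleCat.of R N) se (s • ξ)
    (by rw [Ext.smul_comp]; exact e) rfl
  obtain ⟨t, ht, e'⟩ := h3 η
  refine ⟨t * s, S.mul_mem ht hs, ?_⟩
  rw [mul_smul, ← hη, ← Ext.smul_comp, e', Ext.zero_comp]

lemma con2 {i : ℕ} (h1 : LV S A N i) (h3 : LV S C N i) : LV S B N i := by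
  intro ξ
  have se := scOf_se f g hf hg h
  obtain ⟨s, hs, e⟩ := h1 ((Ext.mk₀ (scOf f g h).f).comp ξ (zero_add i))
  obtain ⟨η, hη⟩ := Ext.contravariant_sequence_exact₂ se (ModuleCat.of R N) (s • ξ)
    (by rw [Ext.comp_smul]; exact e)
  obtain ⟨t, ht, e'⟩ := h3 η
  refine ⟨t * s, S.mul_mem ht hs, ?_⟩
  rw [mul_smul, ← hη, ← Ext.comp_smul, e', Ext.comp_zero]

lemma con1 {i : ℕ} (h2 : LV S B N i) (h3 : LV S C N (i + 1)) : LV S A N i := by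
  intro ξ
  have se := scOf_se f g hf hg h
  obtain ⟨s, hs, e⟩ := h3 (se.extClass.comp ξ (add_comm _ _))
  obtain ⟨η, hη⟩ := Ext.contravariant_sequence_exact₁ se (ModuleCat.of R N) (s • ξ)
    (add_comm _ _) (by rw [Ext.comp_smul]; exact e)
  obtain ⟨t, ht, e'⟩ := h2 η
  refine ⟨t * s, S.mul_mem ht hs, ?_⟩
  rw [mul_smul, ← hη, ← Ext.comp_smul, e', Ext.comp_zero]

lemma con3 {i : ℕ} (h1 : LV S A N i) (h2 : LV S B N (i + 1)) : LV S C N (i + 1) := by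
  intro ξ
  have se := scOf_se f g hf hg h
  obtain ⟨s, hs, e⟩ := h2 ((Ext.mk₀ (scOf f g h).g).comp ξ (zero_add _))
  obtain ⟨η, hη⟩ := Ext.contravariant_sequence_exact₃ se (ModuleCat.of R N) (s • ξ)
    (by rw [Ext.comp_smul]; exact e) (add_comm _ _)
  obtain ⟨t, ht, e'⟩ := h1 η
  refine ⟨t * s, S.mul_mem ht hs, ?_⟩
  rw [mul_smul, ← hη, ← Ext.comp_smul, e', Ext.comp_zero]

end LES

lemma ext0_exists (ξ : EX R N T 0) : ∃ f : N →ₗ[R] T, ξ = Ext.mk₀ (ModuleCat.ofHom f) := by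
  obtain ⟨f, rfl⟩ := (Ext.mk₀_bijective _ _).2 ξ
  exact ⟨f.hom, rfl⟩

lemma mk0_eq_zero (f : N →ₗ[R] T) : (Ext.mk₀ (ModuleCat.ofHom f) : EX R N T 0) = 0 ↔ f = 0 := by
  rw [Ext.mk₀_eq_zero_iff]
  constructor
  · intro h; exact congrArg ModuleCat.Hom.hom h
  · rintro rfl; rfl

lemma mk0_smul (r : R) (f : N →ₗ[R] T) : (Ext.mk₀ (ModuleCat.ofHom (r • f)) : EX R N T 0)
    = r • Ext.mk₀ (ModuleCat.ofHom f) := by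
  rw [← Ext.mk₀_smul]; rfl

lemma LV0_iff {S : Submonoid R} : LV S N T 0 ↔ ∀ f : N →ₗ[R] T, ∃ s ∈ S, s • f = 0 := by
  constructor
  · intro h f
    obtain ⟨s, hs, e⟩ := h (Ext.mk₀ (ModuleCat.ofHom f))
    exact ⟨s, hs, by rwa [← mk0_smul, mk0_eq_zero] at e⟩
  · intro h ξ
    obtain ⟨f, rfl⟩ := ext0_exists ξ
    obtain ⟨s, hs, e⟩ := h f
    exact ⟨s, hs, by rwa [← mk0_smul, mk0_eq_zero]⟩

lemma V0_iff : V R N T 0 ↔ ∀ f : N →ₗ[R] T, f = 0 := by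
  refine LV0_iff.trans ?_
  simp [Submonoid.mem_bot]

lemma LV_congr_left {S : Submonoid R} {i : ℕ} (e : A ≃ₗ[R] B) (h : LV S A T i) : LV S B T i := by
  intro ξ
  obtain ⟨s, hs, h⟩ := h ((Ext.mk₀ (ModuleCat.ofHom e.toLinearMap)).comp ξ (zero_add i))
  refine ⟨s, hs, ?_⟩
  have := congrArg (fun η => (Ext.mk₀ (ModuleCat.ofHom e.symm.toLinearMap)).comp η (zero_add i)) h
  simp only [← Ext.comp_smul, Ext.mk₀_comp_mk₀_assoc, Ext.comp_zero] at this
  rw [← ModuleCat.ofHom_comp, LinearEquiv.comp_symm, ModuleCat.ofHom_id, Ext.mk₀_id_comp] at this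
  exact this

lemma LV_congr_right {S : Submonoid R} {i : ℕ} (e : A ≃ₗ[R] B) (h : LV S T A i) : LV S T B i := by
  intro ξ
  obtain ⟨s, hs, h⟩ := h (ξ.comp (Ext.mk₀ (ModuleCat.ofHom e.symm.toLinearMap)) (add_zero i))
  refine ⟨s, hs, ?_⟩
  have := congrArg (fun η => η.comp (Ext.mk₀ (ModuleCat.ofHom e.toLinearMap)) (add_zero i)) h
  simp only [← Ext.smul_comp, Ext.zero_comp, Ext.comp_assoc_of_third_deg_zero,
    Ext.mk₀_comp_mk₀] at this
  rw [← ModuleCat.ofHom_comp, LinearEquiv.comp_symm, ModuleCat.ofHom_id, Ext.comp_mk₀_id] at this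
  exact this

lemma V_proj [Module.Projective R N] (i : ℕ) : V R N T (i + 1) := by
  rw [V_iff]; intro ξ
  have : Projective (ModuleCat.of R N) := (IsProjective.iff_projective _).1 inferInstance
  exact Ext.eq_zero_of_projective ξ

lemma V_inj (hT : Module.Injective R T) (i : ℕ) : V R N T (i + 1) := by
  rw [V_iff]; intro ξ
  have : Injective (ModuleCat.of R T) := Module.injective_object_of_injective_module R T
  exact Ext.eq_zero_of_injective ξ

lemma V_sub_right [Subsingleton T] (i : ℕ) : V R N T i := by
  rw [V_iff]; intro ξ
  have : 𝟙 (ModuleCat.of R T) = 0 := by ext x; exact Subsingleton.elim (α := T) _ _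
  rw [← Ext.comp_mk₀_id ξ, this, Ext.mk₀_zero, Ext.comp_zero]

lemma V_sub_left [Subsingleton N] (i : ℕ) : V R N T i := by
  rw [V_iff]; intro ξ
  have : 𝟙 (ModuleCat.of R N) = 0 := by ext x; exact Subsingleton.elim (α := N) _ _
  rw [← Ext.mk₀_id_comp ξ, this, Ext.mk₀_zero, Ext.zero_comp]

lemma cov1_zero {S : Submonoid R} {f : A →ₗ[R] B} (hf : Function.Injective f)
    (h : LV S N B 0) : LV S N A 0 := by
  rw [LV0_iff] at h ⊢
  intro φ
  obtain ⟨s, hs, e⟩ := h (f.comp φ)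
  refine ⟨s, hs, ?_⟩
  ext x
  apply hf
  simpa using LinearMap.congr_fun e x

lemma smul_left_eq (r : R) {i : ℕ} (ξ : EX R N T i) :
    r • ξ = (Ext.mk₀ (ModuleCat.ofHom (r • LinearMap.id : N →ₗ[R] N))).comp ξ (zero_add i) := by
  rw [mk0_smul, Ext.smul_comp]
  congr 1
  exact (Ext.mk₀_id_comp ξ).symm

lemma smul_right_eq (r : R) {i : ℕ} (ξ : EX R N T i) :
    r • ξ = ξ.comp (Ext.mk₀ (ModuleCat.ofHom (r • LinearMap.id : T →ₗ[R] T))) (add_zero i) := by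
  rw [mk0_smul, Ext.comp_smul]
  congr 1
  exact (Ext.comp_mk₀_id ξ).symm

lemma smul_zero_left (r : R) {i : ℕ} (hr : ∀ x : N, r • x = 0) (ξ : EX R N T i) : r • ξ = 0 := by
  rw [smul_left_eq]
  have : (r • LinearMap.id : N →ₗ[R] N) = 0 := by ext x; simpa using hr x
  rw [this, (mk0_eq_zero _).2 rfl, Ext.zero_comp]

lemma smul_inj_right (r : R) {i : ℕ} (hr : Function.Bijective (fun x : T => r • x))
    (ξ : EX R N T i) (h : r • ξ = 0) : ξ = 0 := by
  let e : T ≃ₗ[R] T := LinearEquiv.ofBijective (r • LinearMap.id : T →ₗ[R] T) hr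
  rw [smul_right_eq] at h
  have := congrArg (fun η => η.comp (Ext.mk₀ (ModuleCat.ofHom e.symm.toLinearMap)) (add_zero i)) h
  simp only [Ext.zero_comp, Ext.comp_assoc_of_third_deg_zero, Ext.mk₀_comp_mk₀] at this
  rw [← ModuleCat.ofHom_comp] at this
  have e2 : e.symm.toLinearMap ∘ₗ (r • LinearMap.id : T →ₗ[R] T) = LinearMap.id := by
    ext x; exact e.symm_apply_apply x
  rw [e2, ModuleCat.ofHom_id, Ext.comp_mk₀_id] at this
  exact this

lemma E0 (r : R) (hr : Function.Bijective (fun x : T => r • x)) (hN : ∀ x : N, r • x = 0)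
    (i : ℕ) : V R N T i :=
  V_iff.2 fun ξ => smul_inj_right r hr ξ (smul_zero_left r hN ξ)

lemma LV_of_ann {S : Submonoid R} (r : R) (hrS : r ∈ S) (hN : ∀ x : N, r • x = 0)
    (i : ℕ) : LV S N T i := fun ξ => ⟨r, hrS, smul_zero_left r hN ξ⟩

end toolbox
end GGP

namespace GGP
open CategoryTheory CategoryTheory.Abelian

section toolbox2
variable {R : Type u} [CommRing R]
variable {A B C N T T' : Type u} [AddCommGroup A] [Module R A] [AddCommGroup B] [Module R B]
  [AddCommGroup C] [Module R C] [AddCommGroup N] [Module R N] [AddCommGroup T] [Module R T]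
  [AddCommGroup T'] [Module R T']

lemma dim_shift (f : A →ₗ[R] B) (g : B →ₗ[R] C) (hf : Function.Injective f)
    (hg : Function.Surjective g) (h : Function.Exact f g) [Module.Projective R B] {i : ℕ}
    (ξ : EX R C T (i + 1)) :
    ∃ (δ : EX R C A 1) (η : EX R A T i), δ.comp η (add_comm _ _) = ξ := by
  have se := scOf_se f g hf hg h
  obtain ⟨η, hη⟩ := Ext.contravariant_sequence_exact₃ se (ModuleCat.of R T) ξ
    (V_iff.1 (V_proj (N := B) (T := T) i) _) (add_comm _ _)
  exact ⟨_, η, hη⟩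

lemma ext_ind [IsNoetherianRing R]
    (P : ∀ (N : ModuleCat.{u} R) (i : ℕ) (_ : Ext N (ModuleCat.of R T) i), Prop)
    (h0 : ∀ (N : ModuleCat.{u} R) [Module.Finite R N] (f : N →ₗ[R] T),
      P N 0 (Ext.mk₀ (ModuleCat.ofHom f)))
    (hs : ∀ (N N' : ModuleCat.{u} R) [Module.Finite R N] [Module.Finite R N'] (δ : Ext N N' 1)
      (i : ℕ) (η : Ext N' (ModuleCat.of R T) i), P N' i η → P N (i + 1) (δ.comp η (add_comm _ _)))
    (i : ℕ) : ∀ (N : ModuleCat.{u} R) [Module.Finite R N] (ξ : Ext N (ModuleCat.of R T) i),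
      P N i ξ := by
  induction i with
  | zero =>
    intro N _ ξ
    obtain ⟨f, hf⟩ := ext0_exists (N := N) ξ
    rw [hf]; exact h0 N f
  | succ i ih =>
    intro N _ ξ
    obtain ⟨n, g, hg⟩ := Module.Finite.exists_fin' R N
    obtain ⟨δ, η, h⟩ := dim_shift (LinearMap.ker g).subtype g (Submodule.injective_subtype _) hg
      (LinearMap.exact_subtype_ker_map g) (i := i) (T := T) ξ
    rw [← h]
    exact hs N _ δ i η (ih _ η)

/-- E2 -/
lemma LV_of_torsion [IsNoetherianRing R] [Module.Finite R N] (S : Submonoid R)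
    (hT : ∀ t : T, ∃ s ∈ S, s • t = 0) (i : ℕ) : LV S N T i := by
  classical
  intro ξ
  refine ext_ind (T := T) (fun N i ξ => ∃ s ∈ S, s • ξ = 0) ?_ ?_ i (ModuleCat.of R N) ξ
  · intro N _ f
    obtain ⟨s, hs⟩ := Module.Finite.fg_top (R := R) (M := N)
    choose a haS ha using hT
    refine ⟨∏ x ∈ s, a (f x), S.prod_mem fun x _ => haS _, ?_⟩
    have : (∏ x ∈ s, a (f x)) • f = 0 := by
      apply LinearMap.ext_on (s := (s : Set N)) hs
      intro x hx
      rw [← Finset.prod_erase_mul s _ hx, mul_smul]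
      simp [ha]
    exact (mk0_smul (N := N) _ f).symm.trans ((mk0_eq_zero (N := N) _).2 this)
  · rintro N N' _ _ δ i η ⟨s, hs, e⟩
    exact ⟨s, hs, by rw [← Ext.comp_smul, e, Ext.comp_zero]⟩

lemma ext_comp_finset_sum {X Y Z : ModuleCat.{u} R} {p q n : ℕ} (α : Ext X Y p) {ι : Type*}
    (s : Finset ι) (β : ι → Ext Y Z q) (h : p + q = n) :
    α.comp (∑ i ∈ s, β i) h = ∑ i ∈ s, α.comp (β i) h := by
  classical
  induction s using Finset.induction_on with
  | empty => simp
  | insert a s ha ih => rw [Finset.sum_insert ha, Finset.sum_insert ha, Ext.comp_add, ih]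

/-- E1 -/
lemma V_sum [IsNoetherianRing R] [Module.Finite R N] {ι : Type*} (Tp : ι → Type u)
    [∀ p, AddCommGroup (Tp p)] [∀ p, Module R (Tp p)] (π : ∀ p, T →ₗ[R] Tp p)
    (j : ∀ p, Tp p →ₗ[R] T)
    (hsum : ∀ x : T, ∃ s : Finset ι, ∀ s', s ⊆ s' → x = ∑ p ∈ s', j p (π p x))
    (i : ℕ) (hV : ∀ p, V R N (Tp p) i) : V R N T i := by
  classical
  rw [V_iff]
  intro ξ
  have key : ∃ s : Finset ι, ξ = ∑ p ∈ s,
      ξ.comp (Ext.mk₀ (ModuleCat.ofHom ((j p).comp (π p)))) (add_zero i) := by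
    refine ext_ind (T := T) (fun N i ξ => ∃ s : Finset ι, ξ = ∑ p ∈ s,
      ξ.comp (Ext.mk₀ (ModuleCat.ofHom ((j p).comp (π p)))) (add_zero i)) ?_ ?_ i
        (ModuleCat.of R N) ξ
    · intro N _ f
      obtain ⟨s, hs⟩ := Module.Finite.fg_top (R := R) (M := N)
      choose a ha using hsum
      refine ⟨s.biUnion fun x => a (f x), ?_⟩
      have : f = ∑ p ∈ s.biUnion fun x => a (f x), ((j p).comp (π p)).comp f := by
        apply LinearMap.ext_on (s := (s : Set N)) hs
        intro x hx
        have := ha (f x) (s.biUnion fun x => a (f x))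
          (Finset.subset_biUnion_of_mem (fun x => a (f x)) hx)
        simpa using this
      conv_lhs => rw [this]
      simp only [Ext.mk₀_comp_mk₀, ← ModuleCat.ofHom_comp]
      have h2 : ∀ (t : Finset ι) (g : ι → (N →ₗ[R] T)),
          (Ext.mk₀ (ModuleCat.ofHom (∑ p ∈ t, g p)) : Ext N (ModuleCat.of R T) 0)
          = ∑ p ∈ t, Ext.mk₀ (ModuleCat.ofHom (g p)) := by
        intro t g
        induction t using Finset.induction_on with
        | empty => simp
        | insert a s ha ih =>
          rw [Finset.sum_insert ha, Finset.sum_insert ha, ← ih, ← Ext.mk₀_add]; rfl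
      exact h2 _ _
    · rintro N N' _ _ δ i η ⟨s, e⟩
      refine ⟨s, ?_⟩
      conv_lhs => rw [e]
      rw [ext_comp_finset_sum]
      refine Finset.sum_congr rfl fun p _ => ?_
      rw [Ext.comp_assoc_of_third_deg_zero]
  obtain ⟨s, e⟩ := key
  rw [e]
  refine Finset.sum_eq_zero fun p _ => ?_
  rw [ModuleCat.ofHom_comp, ← Ext.mk₀_comp_mk₀, ← Ext.comp_assoc_of_third_deg_zero,
    V_iff.1 (hV p) (ξ.comp (Ext.mk₀ (ModuleCat.ofHom (π p))) (add_zero i)), Ext.zero_comp]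

/-- E3 -/
lemma V_loc [IsNoetherianRing R] [Module.Finite R N] (S : Submonoid R) (l : T →ₗ[R] T')
    [IsLocalizedModule S l] (i : ℕ) (hV : LV S N T i) : V R N T' i := by
  have key : ∀ ξ : EX R N T' i, ∃ s ∈ S, ∃ η : EX R N T i,
      s • ξ = η.comp (Ext.mk₀ (ModuleCat.ofHom l)) (add_zero i) := by
    intro ξ
    refine ext_ind (T := T') (fun N i ξ => ∃ s ∈ S, ∃ η : Ext N (ModuleCat.of R T) i,
      s • ξ = η.comp (Ext.mk₀ (ModuleCat.ofHom l)) (add_zero i)) ?_ ?_ i (ModuleCat.of R N) ξ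
    · intro N _ f
      have := Module.finitePresentation_of_finite R N
      obtain ⟨g, s, e⟩ := Module.FinitePresentation.exists_lift_of_isLocalizedModule S l f
      refine ⟨s, s.2, Ext.mk₀ (ModuleCat.ofHom g), ?_⟩
      rw [Ext.mk₀_comp_mk₀, ← ModuleCat.ofHom_comp, e]
      exact (mk0_smul (N := N) _ f).symm
    · rintro N N' _ _ δ i η ⟨s, hs, ζ, e⟩
      refine ⟨s, hs, δ.comp ζ (add_comm _ _), ?_⟩
      rw [← Ext.comp_smul, e, Ext.comp_assoc_of_third_deg_zero]
  have bij : ∀ s ∈ S, Function.Bijective (fun x : T' => s • x) := fun s hs =>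
    (Module.End.isUnit_iff _).1 (IsLocalizedModule.map_units (S := S) l ⟨s, hs⟩)
  rw [V_iff]
  intro ξ
  obtain ⟨s, hs, η, e⟩ := key ξ
  obtain ⟨t, ht, e'⟩ := hV η
  refine smul_inj_right (t * s) (bij _ (S.mul_mem ht hs)) ξ ?_
  rw [mul_smul, e, ← Ext.smul_comp, e', Ext.zero_comp]

/-- Nakayama -/
lemma nakayama {X : Type*} [AddCommGroup X] [Module R X] [Module.Finite R X] (q : Ideal R)
    [q.IsPrime] (x : R) (hx : x ∈ q) (h : ∀ ξ : X, ∃ s ∈ q.primeCompl, ∃ η : X, s • ξ = x • η) :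
    ∀ ξ : X, ∃ s ∈ q.primeCompl, s • ξ = 0 := by
  classical
  obtain ⟨g, hg⟩ := Module.Finite.fg_top (R := R) (M := X)
  choose a haS b hab using h
  set s := ∏ y ∈ g, a y with hs
  have hsS : s ∈ q.primeCompl := Submonoid.prod_mem _ fun y _ => haS y
  have hr : LinearMap.range (s • LinearMap.id : Module.End R X) ≤ Ideal.span {x} • ⊤ := by
    rw [LinearMap.range_eq_map, ← hg, Submodule.map_span, Submodule.span_le]
    rintro _ ⟨y, hy, rfl⟩
    have : (s • LinearMap.id : Module.End R X) y = x • ((∏ z ∈ g.erase y, a z) • b y) := by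
      simp only [LinearMap.smul_apply, LinearMap.id_coe, id]
      rw [hs, ← Finset.prod_erase_mul g _ hy, mul_smul, hab, smul_comm]
    rw [this]
    exact Submodule.smul_mem_smul (Ideal.mem_span_singleton_self x) (by rw [hg]; trivial)
  obtain ⟨p, hp, -, hc, he⟩ :=
    LinearMap.exists_monic_and_natDegree_eq_and_coeff_mem_pow_and_aeval_eq_zero R _ _ hr
  intro ξ
  refine ⟨p.eval s, ?_, ?_⟩
  · intro hq
    rw [Polynomial.eval_eq_sum_range, Finset.sum_range_succ] at hq
    have h1 : ∑ k ∈ Finset.range p.natDegree, p.coeff k * s ^ k ∈ q := by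
      refine Ideal.sum_mem _ fun k hk => Ideal.mul_mem_right _ _ ?_
      have h3 := Ideal.pow_le_self (I := Ideal.span {x})
        (n := p.natDegree - k) (by have := Finset.mem_range.1 hk; omega) (hc k)
      exact (Ideal.span_singleton_le_iff_mem _).2 hx h3
    have h2 := (Ideal.add_mem_iff_right _ h1).1 hq
    rw [hp.coeff_natDegree, one_mul] at h2
    exact hsS (Ideal.IsPrime.mem_of_pow_mem inferInstance _ h2)
  · have : Polynomial.aeval (s • LinearMap.id : Module.End R X) p = p.eval s • LinearMap.id := by
      have h3 : (s • LinearMap.id : Module.End R X) = algebraMap R _ s := by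
        rw [Algebra.algebraMap_eq_smul_one]; rfl
      rw [h3, Polynomial.aeval_algebraMap_apply, Polynomial.coe_aeval_eq_eval,
        Algebra.algebraMap_eq_smul_one]; rfl
    rw [this] at he
    simpa using LinearMap.congr_fun he ξ

lemma mul_exact_mk (x : R) : Function.Exact (x • LinearMap.id : N →ₗ[R] N)
    (Submodule.mkQ (LinearMap.range (x • LinearMap.id : N →ₗ[R] N))) := by
  rw [LinearMap.exact_iff, Submodule.ker_mkQ]

instance ext_fin [IsNoetherianRing R] [Module.Finite R N] [Module.Finite R T] (i : ℕ) :
    Module.Finite R (EX R N T i) := ModuleCat.finite_ext R _ _ i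

/-- Nakayama for Ext, contravariant. -/
lemma LV_nak [IsNoetherianRing R] [Module.Finite R N] [Module.Finite R T] (q : Ideal R)
    [q.IsPrime] (x : R) (hx : x ∈ q) {f : N →ₗ[R] N} (hfx : ∀ y, f y = x • y)
    {g : N →ₗ[R] C} (hf : Function.Injective f)
    (hg : Function.Surjective g) (h : Function.Exact f g) {i : ℕ}
    (hV : LV q.primeCompl C T (i + 1)) : LV q.primeCompl N T i := by
  refine nakayama q x hx ?_
  intro ξ
  have se := scOf_se f g hf hg h
  obtain ⟨s, hs, e⟩ := hV (se.extClass.comp ξ (add_comm _ _))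
  obtain ⟨η, hη⟩ := Ext.contravariant_sequence_exact₁ se (ModuleCat.of R T) (s • ξ)
    (add_comm _ _) (by rw [Ext.comp_smul]; exact e)
  refine ⟨s, hs, η, ?_⟩
  rw [← hη, smul_left_eq]
  congr 3
  ext y; simp [hfx]

/-- Nakayama for Ext, covariant : `V N (T/x) i → V N T i` -/
lemma LV_nak_cov [IsNoetherianRing R] [Module.Finite R N] [Module.Finite R T] (q : Ideal R)
    [q.IsPrime] (x : R) (hx : x ∈ q) {f : T →ₗ[R] T} (hfx : ∀ y, f y = x • y)
    {g : T →ₗ[R] C} (hf : Function.Injective f)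
    (hg : Function.Surjective g) (h : Function.Exact f g) {i : ℕ}
    (hV : LV q.primeCompl N C i) : LV q.primeCompl N T i := by
  refine nakayama q x hx ?_
  intro ξ
  have se := scOf_se f g hf hg h
  obtain ⟨s, hs, e⟩ := hV (ξ.comp (Ext.mk₀ (scOf f g h).g) (add_zero i))
  obtain ⟨η, hη⟩ := Ext.covariant_sequence_exact₂ (ModuleCat.of R N) se (s • ξ)
    (by rw [Ext.smul_comp]; exact e)
  refine ⟨s, hs, η, ?_⟩
  rw [← hη, smul_right_eq]
  congr 3
  ext y; simp [hfx]

lemma mem_supp_quot {I : Ideal R} {p : PrimeSpectrum R} :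
    p ∈ Module.support R (R ⧸ I) ↔ I ≤ p.asIdeal := by
  rw [Module.support_eq_zeroLocus, Ideal.annihilator_quotient]
  exact Iff.rfl

/-- prime filtration -/
lemma LV_filt [IsNoetherianRing R] [hN : Module.Finite R N] (S : Submonoid R) (i : ℕ)
    (hV : ∀ p ∈ Module.support R N, LV S (R ⧸ p.asIdeal) T i) : LV S N T i := by
  revert hV
  refine IsNoetherianRing.induction_on_isQuotientEquivQuotientPrime R hN
    (motive := fun N _ _ _ => (∀ p ∈ Module.support R N, LV S (R ⧸ p.asIdeal) T i) → LV S N T i)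
    ?_ ?_ ?_
  · intro N _ _ _ _ _
    exact (V_sub_left i).lv S
  · intro N _ _ _ p e h
    refine LV_congr_left e.symm (h p ?_)
    rw [e.support_eq, mem_supp_quot]
  · intro N₁ _ _ _ N₂ _ _ _ N₃ _ _ _ f g hf hg hfg h1 h3 h
    rw [Module.support_of_exact hfg hf hg] at h
    exact con2 hf hg hfg (h1 fun p hp => h p (Or.inl hp)) (h3 fun p hp => h p (Or.inr hp))

end toolbox2
end GGP

namespace GGP
open CategoryTheory CategoryTheory.Abelian GG

section B1
variable {R : Type u} [CommRing R]
variable {A B C N T T' : Type u} [AddCommGroup A] [Module R A] [AddCommGroup B] [Module R B]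
  [AddCommGroup C] [Module R C] [AddCommGroup N] [Module R N] [AddCommGroup T] [Module R T]
  [AddCommGroup T'] [Module R T']

/-- injective dimension at most `n`, via Ext -/
def IDL (R : Type u) [CommRing R] (T : Type u) [AddCommGroup T] [Module R T] (n : ℕ) : Prop :=
  ∀ (N : ModuleCat.{u} R) (i : ℕ), n < i → V R N T i

lemma exact_ker {G G' : Type u} [AddCommGroup G] [Module R G] [AddCommGroup G'] [Module R G']
    {G'' : Type u} [AddCommGroup G''] [Module R G'']
    (d : G →ₗ[R] G') (d' : G' →ₗ[R] G'') (h : LinearMap.range d = LinearMap.ker d') :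
    ∃ g : G →ₗ[R] LinearMap.ker d', Function.Surjective g ∧
      Function.Exact (LinearMap.ker d).subtype g ∧ ∀ x, (g x : G') = d x := by
  refine ⟨d.codRestrict _ fun x => h ▸ LinearMap.mem_range_self d x, ?_, ?_, fun x => rfl⟩
  · rintro ⟨y, hy⟩
    rw [← h] at hy
    obtain ⟨x, rfl⟩ := hy
    exact ⟨x, rfl⟩
  · rw [LinearMap.exact_iff, LinearMap.ker_codRestrict, Submodule.range_subtype]

lemma IDL_of_idLE {n : ℕ} (h : idLE R T n) : IDL R T n := by
  obtain ⟨G, d, ε, hG, hε, h0, hd, hz⟩ := h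
  intro N
  have key : ∀ j k, k + j = n + 1 → ∀ i, j ≤ i → V R N (LinearMap.ker (d k)) i := by
    intro j
    induction j with
    | zero =>
      intro k hk i _
      have : Subsingleton (LinearMap.ker (d k)) :=
        ⟨fun x y => Subtype.ext ((hz k (by omega) _).trans (hz k (by omega) _).symm)⟩
      exact V_sub_right i
    | succ j ih =>
      intro k hk i hi
      obtain ⟨i, rfl⟩ : ∃ i', i = i' + 1 := ⟨i - 1, by omega⟩
      obtain ⟨g, hg, he, -⟩ := exact_ker (d k) (d (k + 1)) (hd k)
      exact cov1 (Submodule.injective_subtype _) hg he (ih (k + 1) (by omega) i (by omega))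
        (V_inj (hG k) i)
  intro i hi
  have e : T ≃ₗ[R] LinearMap.ker (d 0) :=
    (LinearEquiv.ofInjective ε hε).trans (LinearEquiv.ofEq _ _ h0)
  exact LV_congr_right e.symm (key (n + 1) 0 (by omega) i hi)

section QS
open scoped Pointwise
variable {x : R}

lemma qs_exact (x : R) : Function.Exact (x • LinearMap.id : T →ₗ[R] T)
    (Submodule.mkQ (x • (⊤ : Submodule R T)) : T →ₗ[R] QuotSMulTop x T) := by
  rw [LinearMap.exact_iff, Submodule.ker_mkQ]
  ext y
  simp [Submodule.mem_smul_pointwise_iff_exists]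

lemma qs_inj (hx : IsSMulRegular T x) : Function.Injective (x • LinearMap.id : T →ₗ[R] T) := hx

lemma qs_surj (x : R) : Function.Surjective
    (Submodule.mkQ (x • (⊤ : Submodule R T)) : T →ₗ[R] QuotSMulTop x T) :=
  Submodule.mkQ_surjective _

end QS

variable [IsLocalRing R]

lemma LV_max {i : ℕ} (h : LV (IsLocalRing.maximalIdeal R).primeCompl N T i) : V R N T i := by
  rw [V_iff]
  intro ξ
  obtain ⟨s, hs, e⟩ := h ξ
  have hu : IsUnit s := by
    by_contra hn
    exact hs ((IsLocalRing.mem_maximalIdeal s).2 hn)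
  exact hu.smul_eq_zero.1 e

/-- the residue field as a quotient -/
abbrev kk (R : Type u) [CommRing R] [IsLocalRing R] := R ⧸ IsLocalRing.maximalIdeal R

lemma kk_smul {x : R} (hx : x ∈ IsLocalRing.maximalIdeal R) (y : kk R) : x • y = 0 := by
  obtain ⟨y, rfl⟩ := Submodule.Quotient.mk_surjective _ y
  rw [← Submodule.Quotient.mk_smul, Submodule.Quotient.mk_eq_zero]
  exact Ideal.mul_mem_right _ _ hx

lemma regQ [IsNoetherianRing R] (rs : List R) : ∀ (T : Type u) [AddCommGroup T] [Module R T]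
    [Module.Finite R T], RingTheory.Sequence.IsWeaklyRegular T rs →
    (∀ r ∈ rs, r ∈ IsLocalRing.maximalIdeal R) →
    ∃ Q : ModuleCat.{u} R, Module.Finite R Q ∧
      (∀ i, V R (kk R) Q i → V R (kk R) T (i + rs.length)) ∧
      (∀ (X : ModuleCat.{u} R) (i0 : ℕ), (∀ i, i0 < i → V R T X i) →
        ∀ i, i0 + rs.length < i → V R Q X i) ∧
      (∀ n, IDL R T n → IDL R Q n) ∧
      (∀ (X : ModuleCat.{u} R) [Module.Finite R X] (i : ℕ), V R Q X (i + rs.length) →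
        V R T X i) := by
  induction rs with
  | nil =>
    intro T _ _ _ _ _
    exact ⟨ModuleCat.of R T, inferInstanceAs (Module.Finite R T), fun i h => h,
      fun X i0 h i hi => h i hi, fun n h => h, fun X _ i h => h⟩
  | cons x rs ih =>
    intro T _ _ _ hr hm
    rw [RingTheory.Sequence.isWeaklyRegular_cons_iff] at hr
    obtain ⟨hx, hr⟩ := hr
    have hxm := hm x (by simp)
    obtain ⟨Q, hQ, a, b, c, e⟩ := ih (QuotSMulTop x T) hr fun r h => hm r (by simp [h])
    have hinj := qs_inj hx
    have hsurj := qs_surj (T := T) x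
    have hex := qs_exact (T := T) x
    refine ⟨Q, hQ, ?_, ?_, ?_, ?_⟩
    · intro i hi
      have := a i hi
      rw [List.length_cons, ← add_assoc, V_iff]
      intro ξ
      have se := scOf_se _ _ hinj hsurj hex
      obtain ⟨η, hη⟩ := Ext.covariant_sequence_exact₁ (ModuleCat.of R (kk R)) se ξ
        (by
          have := smul_right_eq x ξ
          rw [smul_zero_left x (kk_smul hxm)] at this
          exact this.symm) rfl
      rw [← hη, V_iff.1 this η, Ext.zero_comp]
    · intro X i0 h i hi
      refine b X (i0 + 1) ?_ i (by simp at hi; omega)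
      intro i hi
      obtain ⟨i, rfl⟩ : ∃ i', i = i' + 1 := ⟨i - 1, by omega⟩
      exact con3 hinj hsurj hex (h i (by omega)) (h (i + 1) (by omega))
    · intro n h
      refine c n fun N i hi => ?_
      exact cov3 hinj hsurj hex (h N i hi) (h N (i + 1) (by omega))
    · intro X _ i h
      apply LV_max
      refine LV_nak _ x hxm (fun y => rfl) hinj hsurj hex (V.lv ?_ _)
      apply e
      rwa [List.length_cons, show i + (rs.length + 1) = i + 1 + rs.length by omega] at h

end B1
end GGP

namespace GGP
open CategoryTheory CategoryTheory.Abelian GG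

section B2
variable {R : Type u} [CommRing R]
variable {A B C N T T' : Type u} [AddCommGroup A] [Module R A] [AddCommGroup B] [Module R B]
  [AddCommGroup C] [Module R C] [AddCommGroup N] [Module R N] [AddCommGroup T] [Module R T]
  [AddCommGroup T'] [Module R T']

instance qs_fin [Module.Finite R N] (x : R) : Module.Finite R (QuotSMulTop x N) :=
  Module.Finite.of_surjective _ (qs_surj x)

lemma qs_supp (p p' : PrimeSpectrum R) (x : R)
    (h : p' ∈ Module.support R (QuotSMulTop x (R ⧸ p.asIdeal))) :
    p ≤ p' ∧ x ∈ p'.asIdeal := by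
  rw [Module.support_eq_zeroLocus, PrimeSpectrum.mem_zeroLocus] at h
  have h0 : ∀ r : R, (∀ y : R ⧸ p.asIdeal, ∃ z, x • z = r • y) → r ∈ p'.asIdeal := by
    intro r hr
    apply h
    rw [SetLike.mem_coe, Module.mem_annihilator]
    intro m
    obtain ⟨y, rfl⟩ := qs_surj (T := R ⧸ p.asIdeal) x m
    rw [← map_smul]
    obtain ⟨z, hz⟩ := hr y
    rw [← hz]
    exact (qs_exact x _).2 ⟨z, rfl⟩
  constructor
  · intro r hr
    refine h0 r fun y => ⟨0, ?_⟩
    obtain ⟨y, rfl⟩ := Submodule.Quotient.mk_surjective _ y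
    rw [smul_zero, ← Submodule.Quotient.mk_smul, eq_comm, Submodule.Quotient.mk_eq_zero]
    exact Ideal.mul_mem_right _ _ hr
  · exact h0 x fun y => ⟨y, rfl⟩

lemma qp_reg (p : PrimeSpectrum R) {x : R} (hx : x ∉ p.asIdeal) :
    IsSMulRegular (R ⧸ p.asIdeal) x := by
  rw [isSMulRegular_iff_right_eq_zero_of_smul]
  intro y hy
  obtain ⟨y, rfl⟩ := Ideal.Quotient.mk_surjective y
  rw [← Ideal.Quotient.mk_eq_mk, ← Submodule.Quotient.mk_smul, Submodule.Quotient.mk_eq_zero,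
    smul_eq_mul] at hy
  rw [Ideal.Quotient.eq_zero_iff_mem]
  exact (p.2.mem_or_mem hy).resolve_left hx

lemma LV_quot_step [IsNoetherianRing R] [Module.Finite R T] (p : PrimeSpectrum R) (q : Ideal R)
    [q.IsPrime] (x : R) (hxq : x ∈ q) (hxp : x ∉ p.asIdeal) (i : ℕ)
    (h : ∀ p' : PrimeSpectrum R, p ≤ p' → x ∈ p'.asIdeal →
      LV q.primeCompl (R ⧸ p'.asIdeal) T (i + 1)) :
    LV q.primeCompl (R ⧸ p.asIdeal) T i := by
  refine LV_nak q x hxq (fun y => rfl) (qs_inj (qp_reg p hxp)) (qs_surj x) (qs_exact x) ?_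
  refine LV_filt _ _ fun p' hp' => ?_
  obtain ⟨h1, h2⟩ := qs_supp p p' x hp'
  exact h p' h1 h2

/-- `x`-torsion step -/
lemma V_tors_step [IsNoetherianRing R] (p : PrimeSpectrum R) (x : R) (hxp : x ∉ p.asIdeal) (i : ℕ)
    (h : ∀ p' : PrimeSpectrum R, p ≤ p' → x ∈ p'.asIdeal → V R (R ⧸ p'.asIdeal) T i)
    (hT : ∀ t : T, ∃ k : ℕ, x ^ k • t = 0) :
    V R (R ⧸ p.asIdeal) T i := by
  have hC : V R (QuotSMulTop x (R ⧸ p.asIdeal)) T i := by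
    refine LV_filt _ _ fun p' hp' => ?_
    obtain ⟨h1, h2⟩ := qs_supp p p' x hp'
    exact h p' h1 h2
  have inj : ∀ ξ : EX R (R ⧸ p.asIdeal) T i, x • ξ = 0 → ξ = 0 := by
    intro ξ hξ
    have se := scOf_se _ _ (qs_inj (qp_reg p hxp)) (qs_surj x) (qs_exact x)
    obtain ⟨η, hη⟩ := Ext.contravariant_sequence_exact₂ se (ModuleCat.of R T) ξ
      (by rw [smul_left_eq] at hξ; exact hξ)
    rw [← hη, V_iff.1 hC η, Ext.comp_zero]
  rw [V_iff]
  intro ξ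
  obtain ⟨s, ⟨k, rfl⟩, e⟩ := LV_of_torsion (N := R ⧸ p.asIdeal) (T := T) (Submonoid.powers x)
    (fun t => by obtain ⟨k, hk⟩ := hT t; exact ⟨x ^ k, ⟨k, rfl⟩, hk⟩) i ξ
  simp only at e
  induction k with
  | zero => simpa using e
  | succ k ih => rw [pow_succ', mul_smul] at e; exact ih (inj _ e)

lemma LV.mono {S S' : Submonoid R} (hS : S ≤ S') {i : ℕ} (h : LV S N T i) : LV S' N T i := fun ξ =>
  let ⟨s, hs, e⟩ := h ξ; ⟨s, hS hs, e⟩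

/-- The property `Ext^i(R/p,R)_p = 0`. -/
abbrev W (p : PrimeSpectrum R) (i : ℕ) : Prop := LV p.asIdeal.primeCompl (R ⧸ p.asIdeal) R i

lemma W_step [IsNoetherianRing R] {p q : PrimeSpectrum R} (hpq : p ⋖ q) {i : ℕ} (h : W q (i + 1)) :
    W p i := by
  obtain ⟨x, hxq, hxp⟩ := Set.not_subset.1 (show ¬ (q.asIdeal : Set R) ⊆ p.asIdeal from
    fun h => hpq.lt.not_ge h)
  have : LV q.asIdeal.primeCompl (R ⧸ p.asIdeal) R i := by
    refine LV_quot_step p q.asIdeal x hxq hxp i ?_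
    intro p' hpp' hx'
    by_cases hq : p' ≤ q
    · have h1 : p < p' := lt_of_le_of_ne hpp' (by rintro rfl; exact hxp hx')
      have h2 : p' = q := (eq_or_lt_of_le hq).resolve_right (hpq.2 h1)
      rw [h2]; exact h
    · obtain ⟨r, hr, hrq⟩ := Set.not_subset.1 (show ¬ (p'.asIdeal : Set R) ⊆ q.asIdeal from hq)
      refine LV_of_ann r hrq ?_ _
      intro y
      obtain ⟨y, rfl⟩ := Submodule.Quotient.mk_surjective _ y
      rw [← Submodule.Quotient.mk_smul, Submodule.Quotient.mk_eq_zero]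
      exact Ideal.mul_mem_right _ _ hr
  have hle : q.asIdeal.primeCompl ≤ p.asIdeal.primeCompl := fun s hs hp => hs (hpq.le hp)
  exact LV.mono hle this

lemma W_ass [IsNoetherianRing R] {p : PrimeSpectrum R} (h : p.asIdeal ∈ associatedPrimes R R) : ¬ W p 0 := by
  intro hW
  rw [W, LV0_iff] at hW
  obtain ⟨f, hf⟩ := (isAssociatedPrime_iff_exists_injective_linearMap p.asIdeal R).1 h |>.2
  obtain ⟨s, hs, e⟩ := hW f
  apply hs
  have h1 : f (s • 1) = 0 := by
    rw [map_smul]; exact LinearMap.congr_fun e 1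
  have h2 := hf (h1.trans (map_zero f).symm)
  have h3 : (Ideal.Quotient.mk p.asIdeal s) = 0 := by
    rw [← h2, ← Ideal.Quotient.mk_eq_mk, Algebra.smul_def, mul_one]; rfl
  exact Ideal.Quotient.eq_zero_iff_mem.1 h3

instance ps_wfgt [IsNoetherianRing R] : WellFoundedGT (PrimeSpectrum R) :=
  ⟨(InvImage.wf (fun p : PrimeSpectrum R => p.asIdeal)
    (wellFounded_gt (α := Ideal R)) : _)⟩

end B2
end GGP

namespace GGP
open CategoryTheory CategoryTheory.Abelian GG

set_option linter.unusedSectionVars false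
section B3
variable {R : Type u} [CommRing R] [IsNoetherianRing R] [IsLocalRing R]

/-- height as a natural number -/
noncomputable def ht (p : PrimeSpectrum R) : ℕ := (Order.height p).toNat

lemma ht_spec (p : PrimeSpectrum R) : Order.height p = (ht p : ℕ∞) := by
  have : Order.height p ≠ ⊤ := by
    intro h
    have h1 := Order.height_le_krullDim p
    rw [h] at h1
    exact Order.krullDim_ne_top_of_finiteDimensionalOrder (α := PrimeSpectrum R)
      (top_le_iff.1 h1)
  exact (ENat.natCast_toNat this).symm

lemma ht_lt {p q : PrimeSpectrum R} (h : p < q) : ht p < ht q := by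
  have := Order.height_strictMono h (by rw [ht_spec]; exact ENat.natCast_lt_top _)
  rw [ht_spec, ht_spec] at this
  exact_mod_cast this

lemma ht_le {p q : PrimeSpectrum R} (h : p ≤ q) : ht p ≤ ht q := by
  rcases h.eq_or_lt with rfl | h
  · exact le_rfl
  · exact (ht_lt h).le

lemma ht_zero {p : PrimeSpectrum R} (h : ht p = 0) : IsMin p := by
  rw [← Order.height_eq_zero, ht_spec, h]; rfl

lemma ht_zero_of {p : PrimeSpectrum R} (h : IsMin p) : ht p = 0 := by
  rw [← Order.height_eq_zero, ht_spec] at h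
  exact_mod_cast h

lemma ht_succ {p : PrimeSpectrum R} {n : ℕ} (h : ht p = n + 1) : ∃ q, q ⋖ p ∧ ht q = n := by
  have : Order.height p = n + 1 := by rw [ht_spec, h]; rfl
  obtain ⟨-, ⟨y, hy, e⟩, -⟩ := Order.height_eq_coe_add_one_iff.1 this
  rw [ht_spec] at e
  have e' : ht y = n := by exact_mod_cast e
  refine ⟨y, ⟨hy, fun z h1 h2 => ?_⟩, e'⟩
  have := ht_lt h1
  have := ht_lt h2
  omega

/-- the closed point -/
abbrev mm (R : Type u) [CommRing R] [IsLocalRing R] : PrimeSpectrum R := IsLocalRing.closedPoint R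

lemma le_mm (p : PrimeSpectrum R) : p ≤ mm R := IsLocalRing.le_maximalIdeal p.2.ne_top

lemma exists_mem_mm {p : PrimeSpectrum R} (h : p ≠ mm R) :
    ∃ x ∈ IsLocalRing.maximalIdeal R, x ∉ p.asIdeal := by
  by_contra! hc
  exact h (le_antisymm (le_mm p) hc)

/-- numerical facts for Gorenstein rings -/
structure Gor (R : Type u) [CommRing R] [IsLocalRing R] (d : ℕ) : Prop where
  idl : ∀ (N : Type u) [AddCommGroup N] [Module R N] [Module.Finite R N] (i : ℕ), d < i →
    V R N R i
  nv : ¬ V R (kk R) R d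

lemma exists_gor {n : ℕ} (h : IDL R R n) : ∃ d, Gor R d := by
  classical
  have hex : ∃ d, ∀ (N : ModuleCat.{u} R) [Module.Finite R N] (i : ℕ), d < i → V R N R i :=
    ⟨n, fun N _ i hi => h N i hi⟩
  set d := Nat.find hex with hd
  have hs := Nat.find_spec hex
  have idl : ∀ (N : Type u) [AddCommGroup N] [Module R N] [Module.Finite R N] (i : ℕ), d < i →
      V R N R i := fun N _ _ _ i hi => hs (ModuleCat.of R N) i hi
  refine ⟨d, idl, ?_⟩
  intro hk
  have hall : ∀ (N : Type u) [AddCommGroup N] [Module R N] [Module.Finite R N], V R N R d := by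
    intro N _ _ _
    refine LV_filt _ _ fun p _ => ?_
    by_cases hp : p = mm R
    · subst hp; exact hk
    · obtain ⟨x, hx, hxp⟩ := exists_mem_mm hp
      exact LV_max (LV_quot_step p _ x hx hxp d fun p' _ _ => V.lv (idl _ _ (Nat.lt_succ_self d)) _)
  rcases Nat.eq_zero_or_pos d with h0 | h0
  · have := hall R
    rw [h0, V0_iff] at this
    have := LinearMap.congr_fun (this LinearMap.id) 1
    exact one_ne_zero this
  · refine Nat.find_min hex (m := d - 1) (by omega) fun N _ i hi => ?_
    rcases Nat.lt_or_ge d i with h1 | h1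
    · exact idl N i h1
    · have : i = d := by omega
      subst this; exact hall N

lemma smul_top_lt (M : Type u) [AddCommGroup M] [Module R M] [Module.Finite R M]
    [Nontrivial M] : IsLocalRing.maximalIdeal R • (⊤ : Submodule R M) < ⊤ := by
  rw [lt_top_iff_ne_top]
  intro h
  have := Submodule.eq_bot_of_le_smul_of_le_jacobson_bot (IsLocalRing.maximalIdeal R)
    (⊤ : Submodule R M) Module.Finite.fg_top h.ge (IsLocalRing.maximalIdeal_le_jacobson _)
  exact top_ne_bot this

lemma rees (M : Type u) [AddCommGroup M] [Module R M] [Module.Finite R M]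
    [Nontrivial M] (n : ℕ) (h : ∀ i < n, V R (kk R) M i) :
    ∃ rs : List R, rs.length = n ∧ (∀ r ∈ rs, r ∈ IsLocalRing.maximalIdeal R) ∧
      RingTheory.Sequence.IsWeaklyRegular M rs := by
  obtain ⟨rs, h1, h2, h3⟩ := ModuleCat.exists_isRegular_of_exists_subsingleton_ext
    (IsLocalRing.maximalIdeal R) n (ModuleCat.of R M) (smul_top_lt M) (ModuleCat.of R (kk R))
    (by ext p; exact mem_supp_quot) (fun i hi => V_iff_sub.1 (h i hi))
  exact ⟨rs, h1, h2, h3.1⟩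

variable {d : ℕ}

lemma kk_embeds {Q : Type u} [AddCommGroup Q] [Module R Q] (f : kk R →ₗ[R] Q) (hf : f ≠ 0) :
    Function.Injective f := by
  rw [← LinearMap.ker_eq_bot]
  have : IsSimpleModule R (kk R) := isSimpleModule_iff_quot_maximal.2
    ⟨_, IsLocalRing.maximalIdeal.isMaximal R, ⟨LinearEquiv.refl _ _⟩⟩
  exact (eq_bot_or_eq_top (LinearMap.ker f)).resolve_right
    fun h => hf (LinearMap.ker_eq_top.1 h)

lemma Gor.low (hG : Gor R d) {i : ℕ} (hi : i < d) : V R (kk R) R i := by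
  classical
  by_contra hn
  have hex : ∃ t, ¬ V R (kk R) R t := ⟨i, hn⟩
  set t := Nat.find hex with ht
  have ht1 : ¬ V R (kk R) R t := Nat.find_spec hex
  have htd : t < d := lt_of_le_of_lt (Nat.find_min' hex hn) hi
  obtain ⟨rs, h1, h2, h3⟩ := rees R t fun j hj => not_not.1 (Nat.find_min hex hj)
  obtain ⟨Q, hQ, a, b, -, -⟩ := regQ rs R h3 h2
  have hQ0 : ¬ V R (kk R) Q 0 := fun h => ht1 (by simpa [h1] using a 0 h)
  rw [V0_iff] at hQ0
  push Not at hQ0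
  obtain ⟨f, hf⟩ := hQ0
  have hinj := kk_embeds f hf
  have hb : V R Q R d := by
    refine b (ModuleCat.of R R) 0 ?_ d (by omega)
    intro i hi
    obtain ⟨i, rfl⟩ : ∃ i', i = i' + 1 := ⟨i - 1, by omega⟩
    exact V_proj i
  exact hG.nv (con1 hinj (Submodule.mkQ_surjective (LinearMap.range f))
    (LinearMap.exact_map_mkQ_range f) hb (hG.idl _ _ (Nat.lt_succ_self d)))

lemma Gor.exists_reg (hG : Gor R d) : ∃ rs : List R, rs.length = d ∧
    (∀ r ∈ rs, r ∈ IsLocalRing.maximalIdeal R) ∧ RingTheory.Sequence.IsWeaklyRegular R rs :=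
  rees R d fun _ hj => hG.low hj

lemma W_mm {i : ℕ} : W (mm R) i ↔ V R (kk R) R i := ⟨fun h => LV_max h, fun h => h.lv _⟩

lemma Gor.W_mm_iff (hG : Gor R d) {i : ℕ} : ¬ W (mm R) i ↔ i = d := by
  rw [W_mm]
  constructor
  · intro h
    rcases lt_trichotomy i d with h1 | h1 | h1
    · exact absurd (hG.low h1) h
    · exact h1
    · exact absurd (hG.idl _ i h1) h
  · rintro rfl; exact hG.nv

lemma W_climb (p : PrimeSpectrum R) : ∃ h : ℕ, ∀ i, ¬ W p i → ¬ W (mm R) (i + h) := by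
  induction p using WellFoundedGT.induction with
  | ind p ih =>
  by_cases hp : p = mm R
  · subst hp; exact ⟨0, fun i h => h⟩
  · have hlt : p < mm R := lt_of_le_of_ne (le_mm p) hp
    obtain ⟨q, hq, hmin⟩ : ∃ q, p ⋖ q ∧ True := by
      obtain ⟨q, hq⟩ := WellFounded.has_min (measure (fun q : PrimeSpectrum R => ht q)).wf
        {q | p < q} ⟨_, hlt⟩
      exact ⟨q, ⟨hq.1, fun z h1 h2 => hq.2 z h1 (ht_lt h2)⟩, trivial⟩
    obtain ⟨h, hh⟩ := ih q hq.lt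
    refine ⟨h + 1, fun i hi => ?_⟩
    have := hh (i + 1) fun hw => hi (W_step hq hw)
    rwa [show i + (h + 1) = i + 1 + h by omega]

lemma W_ht (p : PrimeSpectrum R) : ¬ W p (ht p) := by
  obtain ⟨n, hn⟩ : ∃ n, ht p = n := ⟨_, rfl⟩
  rw [hn]
  induction n generalizing p with
  | zero =>
    apply W_ass
    have h1 := Module.associatedPrimes.minimalPrimes_annihilator_subset_associatedPrimes R R
    apply h1
    have : Module.annihilator R R = ⊥ := Module.annihilator_eq_bot.2 inferInstance
    rw [this]
    refine ⟨⟨p.2, bot_le⟩, fun J hJ hle => ?_⟩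
    exact ht_zero hn (b := ⟨J, hJ.1⟩) hle
  | succ n ih =>
    obtain ⟨q, hq, hqn⟩ := ht_succ hn
    exact fun h => ih q hqn (W_step hq h)

lemma Gor.W_iff (hG : Gor R d) (p : PrimeSpectrum R) (i : ℕ) : ¬ W p i ↔ i = ht p := by
  constructor
  · intro h
    obtain ⟨k, hk⟩ := W_climb p
    have h1 := hG.W_mm_iff.1 (hk i h)
    have h2 := hG.W_mm_iff.1 (hk _ (W_ht p))
    omega
  · rintro rfl; exact W_ht p

lemma Gor.ht_mm (hG : Gor R d) : ht (mm R) = d := hG.W_mm_iff.1 (W_ht _)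

lemma Gor.ht_cov (hG : Gor R d) {p q : PrimeSpectrum R} (h : p ⋖ q) : ht q = ht p + 1 := by
  have := (hG.W_iff q (ht p + 1)).1 fun hw => W_ht p (W_step h hw)
  exact this.symm

lemma Gor.V_quot (hG : Gor R d) (p : PrimeSpectrum R) : ∀ i, i < ht p → V R (R ⧸ p.asIdeal) R i := by
  induction p using WellFoundedGT.induction with
  | ind p ih =>
  intro i hi
  by_cases hp : p = mm R
  · subst hp; rw [hG.ht_mm] at hi; exact hG.low hi
  · obtain ⟨x, hx, hxp⟩ := exists_mem_mm hp
    refine LV_max (LV_quot_step p _ x hx hxp i fun p' h1 h2 => V.lv ?_ _)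
    have hlt : p < p' := lt_of_le_of_ne h1 (by rintro rfl; exact hxp h2)
    exact ih p' hlt (i + 1) (by have := ht_lt hlt; omega)

lemma Gor.V_supp (hG : Gor R d) {N : Type u} [AddCommGroup N] [Module R N] [Module.Finite R N]
    (m i : ℕ) (hi : i < m) (h : ∀ p ∈ Module.support R N, m ≤ ht p) : V R N R i :=
  LV_filt _ _ fun p hp => hG.V_quot p i (lt_of_lt_of_le hi (h p hp))

end B3
end GGP

namespace GGP
open CategoryTheory CategoryTheory.Abelian GG

set_option linter.unusedSectionVars false
section D1
variable {R : Type u} [CommRing R]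
variable {A B C N T T' : Type u} [AddCommGroup A] [Module R A] [AddCommGroup B] [Module R B]
  [AddCommGroup C] [Module R C] [AddCommGroup N] [Module R N] [AddCommGroup T] [Module R T]
  [AddCommGroup T'] [Module R T']

section
variable {f : A →ₗ[R] B} {g : B →ₗ[R] C} (hf : Function.Injective f)
  (hg : Function.Surjective g) (h : Function.Exact f g)
include hf hg h

lemma ext1_of_extend (hB : V R B T 1) (hex : ∀ φ : A →ₗ[R] T, ∃ ψ : B →ₗ[R] T, ψ.comp f = φ) :
    V R C T 1 := by
  rw [V_iff]
  intro ξ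
  have se := scOf_se f g hf hg h
  obtain ⟨η, hη⟩ := Ext.contravariant_sequence_exact₃ se (ModuleCat.of R T) ξ
    (V_iff.1 hB _) (add_comm _ _)
  obtain ⟨φ, rfl⟩ := ext0_exists η
  obtain ⟨ψ, rfl⟩ := hex φ
  rw [← hη, ModuleCat.ofHom_comp, ← Ext.mk₀_comp_mk₀, ← Ext.comp_assoc_of_third_deg_zero]
  have := se.extClass_comp
  rw [show (Ext.mk₀ (ModuleCat.ofHom f)) = Ext.mk₀ (scOf f g h).f from rfl, this, Ext.zero_comp]

lemma extend_of_ext1 (hC : V R C T 1) (φ : A →ₗ[R] T) : ∃ ψ : B →ₗ[R] T, ψ.comp f = φ := by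
  have se := scOf_se f g hf hg h
  obtain ⟨η, hη⟩ := Ext.contravariant_sequence_exact₁ se (ModuleCat.of R T)
    (Ext.mk₀ (ModuleCat.ofHom φ)) (add_comm _ _) (V_iff.1 hC _)
  obtain ⟨ψ, rfl⟩ := ext0_exists η
  refine ⟨ψ, ?_⟩
  rw [Ext.mk₀_comp_mk₀] at hη
  have := (Ext.mk₀_bijective _ _).1 hη
  exact congrArg ModuleCat.Hom.hom this

lemma lift_of_ext1 (hA : V R N A 1) (φ : N →ₗ[R] C) : ∃ ψ : N →ₗ[R] B, g.comp ψ = φ := by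
  have se := scOf_se f g hf hg h
  obtain ⟨η, hη⟩ := Ext.covariant_sequence_exact₃ (ModuleCat.of R N) se
    (Ext.mk₀ (ModuleCat.ofHom φ)) rfl (V_iff.1 hA _)
  obtain ⟨ψ, rfl⟩ := ext0_exists η
  refine ⟨ψ, ?_⟩
  rw [Ext.mk₀_comp_mk₀] at hη
  have := (Ext.mk₀_bijective _ _).1 hη
  exact congrArg ModuleCat.Hom.hom this

lemma extend_quot (φ : B →ₗ[R] T) (hφ : φ.comp f = 0) : ∃ ψ : C →ₗ[R] T, ψ.comp g = φ := by
  have hk : LinearMap.ker g ≤ LinearMap.ker φ := by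
    intro x hx
    obtain ⟨y, rfl⟩ := (h x).1 hx
    exact LinearMap.congr_fun hφ y
  refine ⟨((LinearMap.ker g).liftQ φ hk).comp (g.quotKerEquivOfSurjective hg).symm.toLinearMap, ?_⟩
  ext x
  have : (g.quotKerEquivOfSurjective hg).symm (g x) = Submodule.Quotient.mk x := by
    rw [LinearEquiv.symm_apply_eq]; rfl
  simp [this]

/-- dual sequence -/
lemma dual_exact (hC : V R C R 1) :
    Function.Injective g.dualMap ∧ Function.Surjective f.dualMap ∧
      Function.Exact g.dualMap f.dualMap := by
  refine ⟨LinearMap.dualMap_injective_of_surjective hg, ?_, ?_⟩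
  · intro φ
    obtain ⟨ψ, hψ⟩ := extend_of_ext1 hf hg h hC φ
    exact ⟨ψ, hψ⟩
  · intro φ
    constructor
    · intro hφ
      obtain ⟨ψ, hψ⟩ := extend_quot hf hg h φ hφ
      exact ⟨ψ, hψ⟩
    · rintro ⟨ψ, rfl⟩
      ext x
      simp [h.apply_apply_eq_zero]

end

/-- total vanishing of positive Ext into R. -/
def GP (R : Type u) [CommRing R] (M : Type u) [AddCommGroup M] [Module R M] : Prop :=
  ∀ i, V R M R (i + 1)

lemma GP_of_gproj (h : IsGorensteinProjective R T) : GP R T := by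
  obtain ⟨X, d, hX, hd, hP, ⟨e⟩⟩ := h
  have h1 : ∀ n, V R (LinearMap.ker (d n)) R 1 := by
    intro n
    obtain ⟨k, rfl⟩ : ∃ k, n = k + 1 + 1 + 1 := ⟨n - 3, by ring⟩
    obtain ⟨g, hg, he, -⟩ := exact_ker (d (k + 1 + 1)) (d (k + 1 + 1 + 1)) (hd _)
    refine ext1_of_extend (Submodule.injective_subtype _) hg he (V_proj 0) ?_
    intro φ
    obtain ⟨g', hg', he', hgd⟩ := exact_ker (d (k + 1)) (d (k + 1 + 1)) (hd _)
    obtain ⟨ψ, hψ⟩ := hP (ModuleCat.of R R) inferInstance k (φ.comp g') (by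
      ext x
      have : g' (d k x) = 0 := by
        apply Subtype.ext
        rw [hgd]
        have : d k x ∈ LinearMap.ker (d (k + 1)) := hd k ▸ LinearMap.mem_range_self _ x
        exact this
      simp [this])
    refine ⟨ψ, ?_⟩
    ext y
    obtain ⟨x, rfl⟩ := hg' y
    have := LinearMap.congr_fun hψ x
    simpa [hgd] using this
  have h2 : ∀ i n, V R (LinearMap.ker (d n)) R (i + 1) := by
    intro i
    induction i with
    | zero => exact h1
    | succ i ih =>
      intro n
      obtain ⟨k, rfl⟩ : ∃ k, n = k + 1 := ⟨n - 1, by ring⟩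
      obtain ⟨g, hg, he, -⟩ := exact_ker (d k) (d (k + 1)) (hd _)
      exact con3 (Submodule.injective_subtype _) hg he (ih k) (V_proj _)
  exact fun i => LV_congr_left e.symm (h2 i 0)

section
variable [IsNoetherianRing R]

instance dual_fin [Module.Finite R C] : Module.Finite R (Module.Dual R C) := by
  obtain ⟨n, g, hg⟩ := Module.Finite.exists_fin' R C
  exact Module.Finite.of_injective g.dualMap (LinearMap.dualMap_injective_of_surjective hg)

/-- one step left -/
lemma GP_left [Module.Finite R C] (hC : GP R C) : ∃ (n : ℕ) (A : ModuleCat.{u} R)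
    (f : A →ₗ[R] (Fin n → R)) (g : (Fin n → R) →ₗ[R] C), Function.Injective f ∧
      Function.Surjective g ∧ Function.Exact f g ∧ Module.Finite R A ∧ GP R A := by
  obtain ⟨n, g, hg⟩ := Module.Finite.exists_fin' R C
  refine ⟨n, ModuleCat.of R (LinearMap.ker g), (LinearMap.ker g).subtype, g,
    Submodule.injective_subtype _, hg, LinearMap.exact_subtype_ker_map g,
    inferInstanceAs (Module.Finite R (LinearMap.ker g)), fun i => ?_⟩
  exact con1 (Submodule.injective_subtype _) hg (LinearMap.exact_subtype_ker_map g) (V_proj i)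
    (hC (i + 1))

variable [IsLocalRing R] {d : ℕ}

lemma Gor.dual_GP (hG : Gor R d) [Module.Finite R C] (hC : GP R C) :
    GP R (Module.Dual R C) := by
  have key : ∀ j : ℕ, ∀ (C : ModuleCat.{u} R) [Module.Finite R C], GP R C →
      ∀ i, d < i + 1 + j → V R (Module.Dual R C) R (i + 1) := by
    intro j
    induction j with
    | zero => intro C _ _ i hi; exact hG.idl (Module.Dual R C) _ (by omega)
    | succ j ih =>
      intro C _ hC i hi
      obtain ⟨n, A, f, g, hf, hg, h, hA, hGA⟩ := GP_left hC
      obtain ⟨h1, h2, h3⟩ := dual_exact hf hg h (hC 0)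
      exact con1 h1 h2 h3 (V_proj i) (ih A hGA (i + 1) (by omega))
  exact fun i => key d (ModuleCat.of R C) hC i (by omega)

lemma Gor.refl_surj (hG : Gor R d) [Module.Finite R C] (hC : GP R C) :
    Function.Surjective (Module.Dual.eval R C) := by
  obtain ⟨n, A, f, g, hf, hg, h, hA, hGA⟩ := GP_left hC
  obtain ⟨h1, h2, h3⟩ := dual_exact hf hg h (hC 0)
  obtain ⟨h1', h2', h3'⟩ := dual_exact h1 h2 h3 (hG.dual_GP hGA 0)
  intro φ
  obtain ⟨ψ, rfl⟩ := h2' φ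
  obtain ⟨y, rfl⟩ := (Module.evalEquiv R (Fin n → R)).surjective ψ
  exact ⟨g y, by ext; simp⟩

lemma Gor.refl (hG : Gor R d) [Module.Finite R C] (hC : GP R C) :
    Function.Bijective (Module.Dual.eval R C) := by
  refine ⟨?_, hG.refl_surj hC⟩
  obtain ⟨n, A, f, g, hf, hg, h, hA, hGA⟩ := GP_left hC
  obtain ⟨h1, h2, h3⟩ := dual_exact hf hg h (hC 0)
  obtain ⟨h1', h2', h3'⟩ := dual_exact h1 h2 h3 (hG.dual_GP hGA 0)
  rw [injective_iff_map_eq_zero]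
  intro x hx
  obtain ⟨y, rfl⟩ := hg x
  have h4 : g.dualMap.dualMap (Module.evalEquiv R (Fin n → R) y) = 0 := by
    rw [← hx]; ext; simp
  obtain ⟨z, hz⟩ := (h3' _).1 h4
  obtain ⟨z, rfl⟩ := hG.refl_surj hGA z
  have : f z = y := by
    apply (Module.evalEquiv R (Fin n → R)).injective
    rw [← hz]; ext; simp
  rw [← this, h.apply_apply_eq_zero]

/-- one step right -/
lemma Gor.GP_right (hG : Gor R d) [Module.Finite R A] (hA : GP R A) : ∃ (n : ℕ)
    (C : ModuleCat.{u} R) (f : A →ₗ[R] (Fin n → R)) (g : (Fin n → R) →ₗ[R] C),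
      Function.Injective f ∧
      Function.Surjective g ∧ Function.Exact f g ∧ Module.Finite R C ∧ GP R C := by
  obtain ⟨n, K, f, g, hf, hg, h, hK, hGK⟩ := GP_left (hG.dual_GP hA)
  obtain ⟨h1, h2, h3⟩ := dual_exact hf hg h (hG.dual_GP hA 0)
  let e : A ≃ₗ[R] Module.Dual R (Module.Dual R A) := LinearEquiv.ofBijective _ (hG.refl hA)
  let e' : Module.Dual R (Fin n → R) ≃ₗ[R] (Fin n → R) :=
    (Pi.basisFun R (Fin n)).dualBasis.equivFun
  refine ⟨n, ModuleCat.of R (Module.Dual R K), e'.toLinearMap ∘ₗ g.dualMap ∘ₗ e.toLinearMap,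
    f.dualMap ∘ₗ e'.symm.toLinearMap, ?_, ?_, ?_, inferInstanceAs (Module.Finite R (Module.Dual R K)),
    hG.dual_GP hGK⟩
  · exact e'.injective.comp (h1.comp e.injective)
  · exact h2.comp e'.symm.surjective
  · intro x
    obtain ⟨x, rfl⟩ := e'.surjective x
    simp only [LinearMap.comp_apply, LinearEquiv.coe_coe, LinearEquiv.symm_apply_apply]
    refine (h3 x).trans ⟨?_, ?_⟩
    · rintro ⟨y, rfl⟩
      obtain ⟨y, rfl⟩ := e.surjective y
      exact ⟨y, rfl⟩
    · rintro ⟨y, hy⟩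
      exact ⟨e y, e'.injective hy⟩

end

lemma int_seq {α : Type*} (r : α → α → Prop) (h1 : ∀ a, ∃ b, r a b) (h2 : ∀ b, ∃ a, r a b)
    (a0 : α) : ∃ Z : ℤ → α, Z 0 = a0 ∧ ∀ n, r (Z n) (Z (n + 1)) := by
  choose f hf using h1
  choose g hg using h2
  refine ⟨fun n => match n with
    | Int.ofNat n => f^[n] a0
    | Int.negSucc n => g^[n + 1] a0, rfl, ?_⟩
  intro n
  match n with
  | Int.ofNat n =>
    change r (f^[n] a0) (f^[n + 1] a0)
    rw [Function.iterate_succ_apply']; exact hf _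
  | Int.negSucc 0 => exact hg _
  | Int.negSucc (n + 1) =>
    change r (g^[n + 2] a0) (g^[n + 1] a0)
    rw [Function.iterate_succ_apply' g (n + 1)]; exact hg _

/-- Complete resolution data. -/
structure CR (R : Type u) [CommRing R] (M : Type u) [AddCommGroup M] [Module R M] where
  /-- syzygies -/
  Z : ℤ → ModuleCat.{u} R
  /-- ranks -/
  r : ℤ → ℕ
  /-- inclusion -/
  i : ∀ n, Z n →ₗ[R] (Fin (r n) → R)
  /-- projection -/
  p : ∀ n, (Fin (r n) → R) →ₗ[R] Z (n + 1)
  inj : ∀ n, Function.Injective (i n)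
  surj : ∀ n, Function.Surjective (p n)
  ex : ∀ n, Function.Exact (i n) (p n)
  fin : ∀ n, Module.Finite R (Z n)
  gp : ∀ n, GP R (Z n)
  /-- zeroth syzygy -/
  e : M ≃ₗ[R] Z 0

lemma Gor.cr [IsNoetherianRing R] [IsLocalRing R] {d : ℕ} (hG : Gor R d) [Module.Finite R T]
    (hT : GP R T) : Nonempty (CR R T) := by
  let α := {M : ModuleCat.{u} R // Module.Finite R M ∧ GP R M}
  obtain ⟨Z, hZ0, hZ⟩ := int_seq (α := α) (fun A C => ∃ (n : ℕ) (f : A.1 →ₗ[R] (Fin n → R))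
    (g : (Fin n → R) →ₗ[R] C.1), Function.Injective f ∧
      Function.Surjective g ∧ Function.Exact f g)
    (by
      rintro ⟨A, hA, hGA⟩
      obtain ⟨n, C, f, g, hf, hg, h, hC, hGC⟩ := hG.GP_right hGA
      exact ⟨⟨C, hC, hGC⟩, n, f, g, hf, hg, h⟩)
    (by
      rintro ⟨C, hC, hGC⟩
      obtain ⟨n, A, f, g, hf, hg, h, hA, hGA⟩ := GP_left hGC
      exact ⟨⟨A, hA, hGA⟩, n, f, g, hf, hg, h⟩)
    ⟨ModuleCat.of R T, inferInstanceAs (Module.Finite R T), hT⟩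
  choose r f g hf hg h using hZ
  refine ⟨⟨fun n => (Z n).1, r, f, g, hf, hg, h, fun n => (Z n).2.1, fun n => (Z n).2.2, ?_⟩⟩
  rw [hZ0]

lemma V_into_proj [IsNoetherianRing R] [Module.Finite R N] [Module.Projective R T] (i : ℕ)
    (h : V R N R i) : V R N T i := by
  classical
  obtain ⟨s, hs⟩ := (Module.projective_def (R := R) (P := T)).1 inferInstance
  refine V_sum (ι := T) (fun _ => R) (fun p => (Finsupp.lapply p).comp s)
    (fun p => LinearMap.toSpanSingleton R T p) ?_ i fun _ => h
  intro x
  refine ⟨(s x).support, fun s' hs' => ?_⟩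
  have h1 := hs x
  rw [Finsupp.linearCombination_apply, Finsupp.sum_of_support_subset _ hs' _ (by simp)] at h1
  simpa using h1.symm

lemma CR.gproj [IsNoetherianRing R] (c : CR R T) : IsGorensteinProjective R T := by
  refine ⟨fun n => ModuleCat.of R (Fin (c.r n) → R), fun n => (c.i (n + 1)).comp (c.p n),
    fun n => inferInstanceAs (Module.Projective R (Fin (c.r n) → R)), ?_, ?_, ?_⟩
  · intro n
    rw [LinearMap.range_comp, LinearMap.range_eq_top.2 (c.surj n), Submodule.map_top,
      LinearMap.ker_comp, LinearMap.ker_eq_bot.2 (c.inj _), ← LinearMap.ker,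
      ← LinearMap.exact_iff.1 (c.ex (n + 1))]
  · intro P _ n φ hφ
    have h1 : φ.comp (c.i (n + 1)) = 0 := by
      ext x
      obtain ⟨y, rfl⟩ := c.surj n x
      exact LinearMap.congr_fun hφ y
    obtain ⟨ψ, hψ⟩ := extend_quot (c.inj _) (c.surj _) (c.ex _) φ h1
    have := c.fin (n + 1 + 1 + 1)
    obtain ⟨χ, hχ⟩ := extend_of_ext1 (c.inj (n + 1 + 1)) (c.surj _) (c.ex _)
      (V_into_proj 1 (c.gp (n + 1 + 1 + 1) 0)) ψ
    refine ⟨χ, ?_⟩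
    rw [← hψ, ← hχ, LinearMap.comp_assoc]
  · refine ⟨c.e.trans ((LinearEquiv.ofInjective _ (c.inj 0)).trans (LinearEquiv.ofEq _ _ ?_))⟩
    rw [LinearMap.ker_comp, LinearMap.ker_eq_bot.2 (c.inj _), ← LinearMap.ker,
      ← LinearMap.exact_iff.1 (c.ex 0)]

end D1
end GGP

namespace GGP
open CategoryTheory CategoryTheory.Abelian GG

set_option linter.unusedSectionVars false
section C1
variable {R : Type u} [CommRing R]

/-- Direct sum decompositions. -/
structure DS {ι : Type u} (D : Type u) [AddCommGroup D] [Module R D] (Dp : ι → Type u)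
    [∀ p, AddCommGroup (Dp p)] [∀ p, Module R (Dp p)] where
  /-- projections -/
  π : ∀ p, D →ₗ[R] Dp p
  /-- injections -/
  j : ∀ p, Dp p →ₗ[R] D
  same : ∀ p z, π p (j p z) = z
  ne : ∀ p q z, p ≠ q → π q (j p z) = 0
  sum : ∀ x : D, ∃ s : Finset ι, ∀ s', s ⊆ s' → x = ∑ p ∈ s', j p (π p x)

section
variable (S : Set (PrimeSpectrum R)) (K : Type u) [AddCommGroup K] [Module R K]

/-- The localization. -/
abbrev Lp (K : Type u) [AddCommGroup K] [Module R K] (p : PrimeSpectrum R) : Type u :=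
  LocalizedModule p.asIdeal.primeCompl K

/-- The localization map. -/
noncomputable abbrev lp (K : Type u) [AddCommGroup K] [Module R K] (p : PrimeSpectrum R) :
    K →ₗ[R] Lp K p := LocalizedModule.mkLinearMap p.asIdeal.primeCompl K

lemma lp_zero {K : Type u} [AddCommGroup K] [Module R K] {p : PrimeSpectrum R} {x : K} :
    lp K p x = 0 ↔ ∃ s, s ∉ p.asIdeal ∧ s • x = 0 := by
  rw [IsLocalizedModule.eq_zero_iff p.asIdeal.primeCompl]
  exact ⟨fun ⟨c, h⟩ => ⟨c.1, c.2, h⟩, fun ⟨s, hs, h⟩ => ⟨⟨s, hs⟩, h⟩⟩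

lemma lp_surj {K : Type u} [AddCommGroup K] [Module R K] {p : PrimeSpectrum R} (z : Lp K p) :
    ∃ (s : R) (k : K), s ∉ p.asIdeal ∧ s • z = lp K p k := by
  obtain ⟨⟨k, s⟩, h⟩ := IsLocalizedModule.surj p.asIdeal.primeCompl (lp K p) z
  exact ⟨s.1, k, s.2, h⟩

lemma lp_bij {K : Type u} [AddCommGroup K] [Module R K] {p : PrimeSpectrum R} {s : R}
    (hs : s ∉ p.asIdeal) : Function.Bijective (fun z : Lp K p => s • z) :=
  (Module.End.isUnit_iff _).1
    (IsLocalizedModule.map_units (S := p.asIdeal.primeCompl) (lp K p) ⟨s, hs⟩)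

/-- `finSupp` is a direct sum. -/
noncomputable def finDS : DS (R := R) (finSupp R S K) (fun p : S => Lp K p.1) := by
  classical
  exact {
    π := fun p => (LinearMap.proj p).comp (finSupp R S K).subtype
    j := fun p => (LinearMap.single R (fun p : S => Lp K p.1) p).codRestrict _ fun z => by
      refine (Set.finite_singleton p).subset ?_
      intro q hq
      by_contra h
      exact hq (Pi.single_eq_of_ne (M := fun p : S => Lp K p.1) h z)
    same := fun p z => by
      exact Pi.single_eq_same (M := fun p : S => Lp K p.1) p z
    ne := fun p q z h => by
      exact Pi.single_eq_of_ne (M := fun p : S => Lp K p.1) (Ne.symm h) z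
    sum := fun x => by
      have hx : {p : S | x.1 p ≠ 0}.Finite := x.2
      refine ⟨hx.toFinset, fun s' hs' => ?_⟩
      apply Subtype.ext
      rw [AddSubmonoidClass.coe_finsetSum]
      funext q
      rw [Finset.sum_apply]
      change x.1 q = ∑ p ∈ s', (Pi.single p (x.1 p) : Π p : S, Lp K p.1) q
      by_cases hq : q ∈ s'
      · rw [Finset.sum_eq_single q]
        · rw [Pi.single_eq_same]
        · intro p _ hp; exact Pi.single_eq_of_ne (Ne.symm hp) _
        · intro h; exact absurd hq h
      · have h0 : x.1 q = 0 := by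
          by_contra h
          exact hq (hs' (hx.mem_toFinset.2 h))
        rw [h0, eq_comm]
        refine Finset.sum_eq_zero fun p hp => ?_
        exact Pi.single_eq_of_ne (by rintro rfl; exact hq hp) _ }

@[simp] lemma finDS_π (p : S) (x : finSupp R S K) : (finDS S K).π p x = x.1 p := rfl

end

section
variable {ι : Type u} {D : Type u} [AddCommGroup D] [Module R D] {Dp : ι → Type u}
    [∀ p, AddCommGroup (Dp p)] [∀ p, Module R (Dp p)]

lemma DS.ext (c : DS (R := R) D Dp) {x y : D} (h : ∀ p, c.π p x = c.π p y) : x = y := by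
  classical
  obtain ⟨s, hs⟩ := c.sum x
  obtain ⟨t, ht⟩ := c.sum y
  rw [hs (s ∪ t) Finset.subset_union_left, ht (s ∪ t) Finset.subset_union_right]
  simp [h]

lemma DS.π_sum (c : DS (R := R) D Dp) [DecidableEq ι] (s : Finset ι) (z : ∀ p, Dp p) (q : ι) :
    c.π q (∑ p ∈ s, c.j p (z p)) = if q ∈ s then z q else 0 := by
  rw [map_sum]
  by_cases hq : q ∈ s
  · rw [Finset.sum_eq_single q, c.same, if_pos hq]
    · intro p _ hp; exact c.ne _ _ _ hp
    · intro h; exact absurd hq h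
  · rw [if_neg hq]
    refine Finset.sum_eq_zero fun p hp => c.ne _ _ _ (by rintro rfl; exact hq hp)

lemma DS.fin (c : DS (R := R) D Dp) (x : D) : {p | c.π p x ≠ 0}.Finite := by
  classical
  obtain ⟨s, hs⟩ := c.sum x
  refine s.finite_toSet.subset fun p hp => ?_
  by_contra h
  apply hp
  rw [hs s subset_rfl, c.π_sum s (fun p => c.π p x), if_neg (fun h' => h (Finset.mem_coe.2 h'))]

lemma DS.exists (c : DS (R := R) D Dp) (z : ∀ p, Dp p) (hz : {p | z p ≠ 0}.Finite) :
    ∃ x, ∀ p, c.π p x = z p := by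
  classical
  refine ⟨∑ p ∈ hz.toFinset, c.j p (z p), fun p => ?_⟩
  rw [c.π_sum]
  split_ifs with h
  · rfl
  · by_contra h'
    exact h (hz.mem_toFinset.2 (Ne.symm h'))

lemma DS.equiv (c : DS (R := R) D Dp) {D' : Type u} [AddCommGroup D'] [Module R D']
    {Dp' : ι → Type u} [∀ p, AddCommGroup (Dp' p)] [∀ p, Module R (Dp' p)]
    (c' : DS (R := R) D' Dp') (ε : ∀ p, Dp p ≃ₗ[R] Dp' p) :
    ∃ E : D ≃ₗ[R] D', ∀ x p, c'.π p (E x) = ε p (c.π p x) := by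
  let a : D →ₗ[R] (Π p, Dp' p) := LinearMap.pi fun p => (ε p).toLinearMap.comp (c.π p)
  let b : D' →ₗ[R] (Π p, Dp' p) := LinearMap.pi c'.π
  have ha : Function.Injective a := fun x y h => c.ext fun p => (ε p).injective (congrFun h p)
  have hb : Function.Injective b := fun x y h => c'.ext fun p => congrFun h p
  have hr : LinearMap.range a = LinearMap.range b := by
    ext z
    constructor
    · rintro ⟨x, rfl⟩
      obtain ⟨y, hy⟩ := c'.exists (a x) ((c.fin x).subset fun p hp h => hp (by simp [a, h]))
      exact ⟨y, funext hy⟩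
    · rintro ⟨x, rfl⟩
      obtain ⟨y, hy⟩ := c.exists (fun p => (ε p).symm (b x p))
        ((c'.fin x).subset fun p hp h => hp (by simp [b, h]))
      exact ⟨y, funext fun p => by simp [a, hy]⟩
  let E := (LinearEquiv.ofInjective a ha).trans
    ((LinearEquiv.ofEq _ _ hr).trans (LinearEquiv.ofInjective b hb).symm)
  refine ⟨E, fun x p => ?_⟩
  have : b (E x) = a x := by
    have h1 : LinearEquiv.ofInjective b hb (E x) =
      (LinearEquiv.ofEq _ _ hr) (LinearEquiv.ofInjective a ha x) := by simp [E]
    exact congrArg Subtype.val h1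
  exact congrFun this p

open TensorProduct in
/-- tensor of a direct sum -/
noncomputable def DS.tensor (c : DS (R := R) D Dp) (M : Type u) [AddCommGroup M] [Module R M] :
    DS (R := R) (M ⊗[R] D) (fun p => M ⊗[R] Dp p) where
  π p := (c.π p).lTensor M
  j p := (c.j p).lTensor M
  same p z := by
    rw [← LinearMap.comp_apply, ← LinearMap.lTensor_comp]
    rw [show c.π p ∘ₗ c.j p = LinearMap.id from LinearMap.ext (c.same p), LinearMap.lTensor_id]; rfl
  ne p q z h := by
    rw [← LinearMap.comp_apply, ← LinearMap.lTensor_comp]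
    rw [show c.π q ∘ₗ c.j p = 0 from LinearMap.ext fun z => c.ne p q z h, LinearMap.lTensor_zero]
    rfl
  sum x := by
    classical
    induction x using TensorProduct.induction_on with
    | zero => exact ⟨∅, fun s' _ => by simp⟩
    | tmul m x =>
      obtain ⟨s, hs⟩ := c.sum x
      refine ⟨s, fun s' hs' => ?_⟩
      conv_lhs => rw [hs s' hs']
      simp [TensorProduct.tmul_sum]
    | add x y hx hy =>
      obtain ⟨s, hs⟩ := hx
      obtain ⟨t, ht⟩ := hy
      refine ⟨s ∪ t, fun s' hs' => ?_⟩
      conv_lhs => rw [hs s' (Finset.union_subset_left hs'), ht s' (Finset.union_subset_right hs')]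
      simp [Finset.sum_add_distrib]

/-- restriction of a direct sum to a subset outside which it is trivial -/
noncomputable def DS.restrict {S S' : Set (PrimeSpectrum R)} {Dp : PrimeSpectrum R → Type u}
    [∀ p, AddCommGroup (Dp p)] [∀ p, Module R (Dp p)]
    (c : DS (R := R) D (fun p : S => Dp p.1)) (hS : S' ⊆ S)
    (h0 : ∀ p ∈ S, p ∉ S' → Subsingleton (Dp p)) : DS (R := R) D (fun p : S' => Dp p.1) where
  π p := c.π ⟨p.1, hS p.2⟩
  j p := c.j ⟨p.1, hS p.2⟩
  same p z := c.same ⟨p.1, hS p.2⟩ z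
  ne p q z h := c.ne ⟨p.1, hS p.2⟩ ⟨q.1, hS q.2⟩ z fun e => h (Subtype.ext (congrArg (·.1) e))
  sum x := by
    classical
    have hx := c.fin x
    let emb : S' ↪ S := ⟨fun p => ⟨p.1, hS p.2⟩, fun a b h => Subtype.ext (congrArg (·.1) h)⟩
    refine ⟨hx.toFinset.preimage emb emb.injective.injOn, fun s' hs' => ?_⟩
    refine c.ext fun q => ?_
    have h1 : ∑ p ∈ s', c.j ⟨p.1, hS p.2⟩ (c.π ⟨p.1, hS p.2⟩ x) =
        ∑ p ∈ s'.map emb, c.j p (c.π p x) := by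
      rw [Finset.sum_map]; rfl
    rw [h1, c.π_sum _ (fun p => c.π p x)]
    split_ifs with h
    · rfl
    · by_contra hne
      by_cases hq : q.1 ∈ S'
      · apply h
        rw [Finset.mem_map]
        exact ⟨⟨q.1, hq⟩, hs' (Finset.mem_preimage.2 (hx.mem_toFinset.2 hne)), rfl⟩
      · have := h0 q.1 q.2 hq
        exact hne (Subsingleton.elim _ _)

end

/-- Convenient filtration properties. -/
structure Filt (F : ℕ → Set (PrimeSpectrum R)) : Prop where
  anti : ∀ n, F (n + 1) ⊆ F n
  up : ∀ n p q, p ∈ F n → p ≤ q → q ∈ F n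
  min : ∀ n p q, p ∈ F n \ F (n + 1) → q ∈ F n → q ≤ p → q = p

section
variable {K : Type u} [AddCommGroup K] [Module R K]

lemma mem_supp_of_ann {q : PrimeSpectrum R} (k : K) (h : ∀ r : R, r • k = 0 → r ∈ q.asIdeal) :
    q ∈ Module.support R K := by
  rw [Module.mem_support_iff']
  exact ⟨k, fun r hr h0 => hr (h r h0)⟩

lemma loc_torsion {U : Set (PrimeSpectrum R)} (hK : Module.support R K ⊆ U) {p : PrimeSpectrum R}
    (hmin : ∀ q ∈ U, q ≤ p → q = p) {x : R} (hx : x ∈ p.asIdeal) (z : Lp K p) :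
    ∃ n : ℕ, x ^ n • z = 0 := by
  obtain ⟨t, k, ht, e⟩ := lp_surj z
  suffices ∃ n : ℕ, ∃ s, s ∉ p.asIdeal ∧ s • x ^ n • k = 0 by
    obtain ⟨n, s, hs, h⟩ := this
    refine ⟨n, (lp_bij ht).1 ?_⟩
    simp only [smul_zero]
    rw [smul_comm, e, ← map_smul, lp_zero]
    exact ⟨s, hs, h⟩
  by_contra! hc
  let I : Ideal R := LinearMap.ker (LinearMap.toSpanSingleton R K k)
  have hI : ∀ r, r ∈ I ↔ r • k = 0 := fun r => by simp [I]
  have hdis : Disjoint (I : Set R) (Submonoid.powers x ⊔ p.asIdeal.primeCompl : Submonoid R) := by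
    rw [Set.disjoint_left]
    intro r hr hr2
    obtain ⟨_, ⟨n, rfl⟩, s, hs, rfl⟩ := Submonoid.mem_sup.1 hr2
    refine hc n s hs ?_
    have := (hI _).1 hr
    rw [smul_smul, mul_comm]; exact this
  obtain ⟨Q, hQ, hIQ, hd⟩ := Ideal.exists_le_prime_disjoint I _ hdis
  rw [Set.disjoint_left] at hd
  let q : PrimeSpectrum R := ⟨Q, hQ⟩
  have hqp : q ≤ p := by
    intro r hr
    by_contra h
    exact hd hr ((le_sup_right : p.asIdeal.primeCompl ≤ _) h)
  have hqK : q ∈ Module.support R K := mem_supp_of_ann k fun r hr => hIQ ((hI r).2 hr)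
  have := hmin q (hK hqK) hqp
  rw [← this] at hx
  exact hd hx ((le_sup_left : Submonoid.powers x ≤ _) ⟨1, by simp⟩)

variable [IsNoetherianRing R] {F : ℕ → Set (PrimeSpectrum R)} (hF : Filt F) (n : ℕ)
include hF

lemma theta_fin (hK : Module.support R K ⊆ F n) :
    LinearMap.range (thetaFull R (F n \ F (n + 1)) K) ≤ finSupp R (F n \ F (n + 1)) K := by
  rintro _ ⟨k, rfl⟩
  let I : Ideal R := LinearMap.ker (LinearMap.toSpanSingleton R K k)
  have hI : ∀ r, r ∈ I ↔ r • k = 0 := fun r => by simp [I]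
  have hfin : I.minimalPrimes.Finite := Ideal.finite_minimalPrimes_of_isNoetherianRing R I
  refine Set.Finite.of_finite_image (f := fun p : ↥(F n \ F (n + 1)) => p.1.asIdeal)
    (hfin.subset ?_) ?_
  · rintro _ ⟨p, hp, rfl⟩
    have hp' : ∀ r, r • k = 0 → r ∈ p.1.asIdeal := by
      intro r hr
      by_contra h
      exact hp (lp_zero.2 ⟨r, h, hr⟩)
    refine ⟨⟨p.1.2, fun r hr => hp' r ((hI r).1 hr)⟩, ?_⟩
    intro J hJ hle
    have h1 : (⟨J, hJ.1⟩ : PrimeSpectrum R) ∈ F n :=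
      hK (mem_supp_of_ann k fun r hr => hJ.2 ((hI r).2 hr))
    have h2 := hF.min n p.1 ⟨J, hJ.1⟩ p.2 h1 hle
    exact (congrArg PrimeSpectrum.asIdeal h2).ge
  · intro p _ q _ h
    exact Subtype.ext (PrimeSpectrum.ext h)

omit [IsNoetherianRing R] in
lemma next_supp (hK : Module.support R K ⊆ F n)
    (hr : LinearMap.range (thetaFull R (F n \ F (n + 1)) K) ≤ finSupp R (F n \ F (n + 1)) K) :
    Module.support R (nextKType R (F n \ F (n + 1)) K) ⊆ F (n + 1) := by
  classical
  intro q hq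
  by_contra hqF
  rw [Module.mem_support_iff'] at hq
  obtain ⟨y, hy⟩ := hq
  obtain ⟨y, rfl⟩ := Submodule.Quotient.mk_surjective _ y
  let S := F n \ F (n + 1)
  let c := finDS S K
  -- kill components away from q
  have kill : ∀ p : S, p.1 ≠ q → ∀ z : Lp K p.1, ∃ s, s ∉ q.asIdeal ∧ s • z = 0 := by
    intro p hp z
    have hnle : ¬ p.1 ≤ q := by
      intro hle
      have hqn : q ∈ F n := hF.up n p.1 q p.2.1 hle
      exact hp (hF.min n q p.1 ⟨hqn, hqF⟩ p.2.1 hle)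
    obtain ⟨x, hx, hxq⟩ := Set.not_subset.1 (show ¬ (p.1.asIdeal : Set R) ⊆ q.asIdeal from hnle)
    obtain ⟨k, hk⟩ := loc_torsion hK (fun q' h1 h2 => hF.min n p.1 q' p.2 h1 h2) hx z
    exact ⟨x ^ k, fun h => hxq (q.2.mem_of_pow_mem _ h), hk⟩
  have kill2 : ∀ w : finSupp R S K, (∀ p : S, p.1 = q → w.1 p = 0) →
      ∃ s, s ∉ q.asIdeal ∧ s • w = 0 := by
    intro w hw
    have hfin : {p : S | w.1 p ≠ 0}.Finite := w.2
    have : ∀ p : S, ∃ s, s ∉ q.asIdeal ∧ s • w.1 p = 0 := by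
      intro p
      by_cases hp : p.1 = q
      · exact ⟨1, fun h => q.2.ne_top ((Ideal.eq_top_iff_one _).2 h), by rw [hw p hp, smul_zero]⟩
      · exact kill p hp _
    choose a ha1 ha2 using this
    refine ⟨∏ p ∈ hfin.toFinset, a p, ?_, ?_⟩
    · exact Submonoid.prod_mem q.asIdeal.primeCompl fun p _ => ha1 p
    · apply Subtype.ext
      funext p
      change (∏ p ∈ hfin.toFinset, a p) • w.1 p = 0
      by_cases hp : w.1 p = 0
      · rw [hp, smul_zero]
      · rw [← Finset.prod_erase_mul _ _ (hfin.mem_toFinset.2 hp), mul_smul, ha2, smul_zero]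
  obtain ⟨t, k, ht, e⟩ : ∃ (t : R) (k : K), t ∉ q.asIdeal ∧
      ∀ p : S, p.1 = q → t • y.1 p = lp K p.1 k := by
    by_cases hqS : q ∈ S
    · obtain ⟨t, k, ht, e⟩ := lp_surj (y.1 ⟨q, hqS⟩)
      refine ⟨t, k, ht, ?_⟩
      rintro ⟨p, hp⟩ rfl
      exact e
    · exact ⟨1, 0, fun h => q.2.ne_top ((Ideal.eq_top_iff_one _).2 h),
        fun p hp => absurd (hp ▸ p.2) hqS⟩
  let th : finSupp R S K := ⟨thetaFull R S K k, hr ⟨k, rfl⟩⟩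
  obtain ⟨s, hs, e2⟩ := kill2 (t • y - th) (by
    intro p hp
    change t • y.1 p - lp K p.1 k = 0
    rw [e p hp, sub_self])
  refine hy (s * t) (fun h => (q.2.mem_or_mem h).elim hs ht) ?_
  rw [← Submodule.Quotient.mk_smul, Submodule.Quotient.mk_eq_zero]
  refine ⟨s • k, ?_⟩
  rw [map_smul]
  rw [smul_sub, sub_eq_zero, smul_smul] at e2
  rw [e2]; rfl

end

lemma V_finSupp [IsNoetherianRing R] {N K : Type u} [AddCommGroup N] [Module R N]
    [Module.Finite R N] [AddCommGroup K] [Module R K] (S : Set (PrimeSpectrum R))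
    (hS : ∀ p ∈ S, p ∉ Module.support R N) (i : ℕ) : V R N (finSupp R S K) i := by
  refine V_sum (ι := S) (fun p => Lp K p.1) (finDS S K).π (finDS S K).j (finDS S K).sum i ?_
  intro p
  have := hS p.1 p.2
  rw [Module.mem_support_iff_of_finite, SetLike.not_le_iff_exists] at this
  obtain ⟨r, hr, hrp⟩ := this
  exact E0 r (lp_bij hrp) (Module.mem_annihilator.1 hr) i

section
variable {S : Set (PrimeSpectrum R)} {K : Type u} [AddCommGroup K] [Module R K]
  (hr : LinearMap.range (thetaFull R S K) ≤ finSupp R S K)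

/-- the map into the direct sum -/
noncomputable def th : K →ₗ[R] finSupp R S K :=
  (thetaFull R S K).codRestrict _ fun x => hr ⟨x, rfl⟩

lemma th_inj (h : Function.Injective (thetaFull R S K)) : Function.Injective (th hr) :=
  fun x y e => h (congrArg Subtype.val e)

lemma th_range : LinearMap.range (th hr) =
    Submodule.comap (finSupp R S K).subtype (LinearMap.range (thetaFull R S K)) := by
  ext y
  constructor
  · rintro ⟨x, rfl⟩; exact ⟨x, rfl⟩
  · rintro ⟨x, hx⟩; exact ⟨x, Subtype.ext hx⟩

/-- quotient map -/
noncomputable abbrev nq (S : Set (PrimeSpectrum R)) (K : Type u) [AddCommGroup K] [Module R K] :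
    finSupp R S K →ₗ[R] nextKType R S K := Submodule.mkQ _

lemma th_exact : Function.Exact (th hr) (nq S K) := by
  rw [LinearMap.exact_iff, th_range, Submodule.ker_mkQ]

lemma nq_surj : Function.Surjective (nq S K) := Submodule.mkQ_surjective _

end

lemma ker_nq_iff (S : Set (PrimeSpectrum R)) (K : Type u) [AddCommGroup K] [Module R K]
    {L : Type u} [AddCommGroup L] [Module R L] (t : nextKType R S K →ₗ[R] L) :
    LinearMap.ker (t.comp (nq S K)) =
      Submodule.comap (finSupp R S K).subtype (LinearMap.range (thetaFull R S K)) ↔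
    Function.Injective t := by
  rw [LinearMap.ker_comp, ← LinearMap.ker_eq_bot]
  constructor
  · intro h
    have h2 := congrArg (Submodule.map (nq S K)) h
    rw [Submodule.map_comap_eq_of_surjective (Submodule.mkQ_surjective _)] at h2
    rw [h2, ← le_bot_iff, Submodule.map_le_iff_le_comap]
    change _ ≤ LinearMap.ker (nq S K)
    rw [Submodule.ker_mkQ]
  · intro h
    rw [h]
    change LinearMap.ker (nq S K) = _
    rw [Submodule.ker_mkQ]

lemma cousin_iff (F : ℕ → Set (PrimeSpectrum R)) (M : ModuleCat.{u} R)
    (P : ModuleCat.{u} R → Prop) : CousinResolves R F M P ↔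
    (∀ n, LinearMap.range (cousinTheta R F M n) ≤ finSupp R (F n \ F (n + 1)) (cousinK R F M n)) ∧
    (∀ n, Function.Injective (cousinTheta R F M n)) ∧
    (∀ n, P (ModuleCat.of R (cousinC R F M n))) := by
  have key : ∀ n, LinearMap.ker (cousinD R F M n) =
      Submodule.comap (finSupp R (F n \ F (n + 1)) (cousinK R F M n)).subtype
      (LinearMap.range (cousinTheta R F M n)) ↔ Function.Injective (cousinTheta R F M (n + 1)) := by
    intro n
    exact ker_nq_iff (F n \ F (n + 1)) (cousinK R F M n) (cousinTheta R F M (n + 1))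
  simp only [CousinResolves, key]
  constructor
  · rintro ⟨h1, h2, h3, h4⟩
    refine ⟨h1, fun n => ?_, h4⟩
    cases n with
    | zero => exact h2
    | succ n => exact h3 n
  · rintro ⟨h1, h2, h4⟩
    exact ⟨h1, h2 0, fun n => h2 (n + 1), h4⟩

end C1
end GGP

namespace GGP
open CategoryTheory CategoryTheory.Abelian GG

set_option linter.unusedSectionVars false
section C2
variable {R : Type u} [CommRing R] [IsNoetherianRing R] [IsLocalRing R]
variable {M : Type u} [AddCommGroup M] [Module R M]

lemma htM_eq {p : PrimeSpectrum R} (h : p ∈ Module.support R M) :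
    htM R M p = Order.height (⟨p, h⟩ : ↥(Module.support R M)) := by
  rw [htM, iSup_pos h]

lemma htM_le {p : PrimeSpectrum R} (h : p ∈ Module.support R M) : htM R M p ≤ (ht p : ℕ∞) := by
  rw [htM_eq h, ← ht_spec]
  exact Order.height_le_height_apply_of_strictMono (Subtype.val : Module.support R M → _)
    (fun _ _ h => h) _

lemma htM_mono {p q : PrimeSpectrum R} (h : p ∈ Module.support R M) (hpq : p ≤ q) :
    htM R M p ≤ htM R M q := by
  rw [htM_eq h, htM_eq (Module.mem_support_mono hpq h)]
  exact Order.height_mono hpq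

lemma htM_lt {p q : PrimeSpectrum R} (h : p ∈ Module.support R M) (hpq : p < q) :
    htM R M p + 1 ≤ htM R M q := by
  have h1 : htM R M p < ⊤ := lt_of_le_of_lt (htM_le h) (ENat.natCast_lt_top _)
  rw [ENat.add_one_le_iff h1.ne]
  rw [htM_eq h] at h1 ⊢
  rw [htM_eq (Module.mem_support_mono hpq.le h)]
  exact Order.height_strictMono hpq h1

lemma hF_mem {p : PrimeSpectrum R} {n : ℕ} : p ∈ heightFiltration R M n ↔
    p ∈ Module.support R M ∧ (n : ℕ∞) ≤ htM R M p := Iff.rfl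

lemma hF_diff {p : PrimeSpectrum R} {n : ℕ}
    (h : p ∈ heightFiltration R M n \ heightFiltration R M (n + 1)) :
    p ∈ Module.support R M ∧ htM R M p = n := by
  refine ⟨h.1.1, le_antisymm ?_ h.1.2⟩
  have h2 : ¬ ((n + 1 : ℕ) : ℕ∞) ≤ htM R M p := fun h3 => h.2 ⟨h.1.1, h3⟩
  rw [not_le] at h2
  exact ENat.lt_natCast_add_one_iff.1 h2

lemma hF_filt : Filt (heightFiltration R M) where
  anti n p hp := ⟨hp.1, le_trans (by exact_mod_cast Nat.le_succ n) hp.2⟩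
  up n p q hp hpq := ⟨Module.mem_support_mono hpq hp.1, hp.2.trans (htM_mono hp.1 hpq)⟩
  min n p q hp hq hqp := by
    by_contra hne
    have h1 := htM_lt hq.1 (lt_of_le_of_ne hqp hne)
    rw [(hF_diff hp).2] at h1
    have h2 : ((n + 1 : ℕ) : ℕ∞) ≤ n := le_trans (by push_cast; gcongr; exact hq.2) h1
    have : n + 1 ≤ n := by exact_mod_cast h2
    omega

lemma hF_supp : Module.support R M ⊆ heightFiltration R M 0 := fun p hp => ⟨hp, by simp⟩

lemma htM_gp {d : ℕ} (hG : Gor R d) [Module.Finite R M] {r : ℕ} {f : M →ₗ[R] (Fin r → R)}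
    (hf : Function.Injective f) {p : PrimeSpectrum R} (hp : p ∈ Module.support R M) :
    htM R M p = ht p := by
  refine le_antisymm (htM_le hp) ?_
  obtain ⟨p0, ⟨hp0, hle⟩, hmin⟩ := WellFounded.has_min
    (measure (fun q : PrimeSpectrum R => ht q)).wf {q | q ∈ Module.support R M ∧ q ≤ p} ⟨p, hp, le_rfl⟩
  have h0 : ht p0 = 0 := by
    by_contra hne
    have hV : V R (R ⧸ p0.asIdeal) M 0 :=
      cov1_zero hf (V_into_proj 0 (hG.V_quot p0 0 (Nat.pos_of_ne_zero hne)))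
    have hass : p0.asIdeal ∈ associatedPrimes R M := by
      apply Module.associatedPrimes.minimalPrimes_annihilator_subset_associatedPrimes R M
      refine ⟨⟨p0.2, Module.mem_support_iff_of_finite.1 hp0⟩, fun J hJ hJle => ?_⟩
      by_contra hc
      have hlt : (⟨J, hJ.1⟩ : PrimeSpectrum R) < p0 := lt_of_le_not_ge hJle hc
      exact hmin ⟨J, hJ.1⟩ ⟨Module.mem_support_iff_of_finite.2 hJ.2, hlt.le.trans hle⟩ (ht_lt hlt)
    obtain ⟨f, hf⟩ := (isAssociatedPrime_iff_exists_injective_linearMap p0.asIdeal M).1 hass |>.2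
    have hnt : Nontrivial (R ⧸ p0.asIdeal) := Ideal.Quotient.nontrivial_iff.2 p0.2.ne_top
    rw [V0_iff] at hV
    obtain ⟨a, ha⟩ := exists_ne (0 : R ⧸ p0.asIdeal)
    exact ha (hf (by rw [hV f]; simp))
  obtain ⟨n, hn⟩ : ∃ n, ht p = n := ⟨_, rfl⟩
  have key : ∀ n (q : PrimeSpectrum R), p0 ≤ q → ht q = n → (n : ℕ∞) ≤ htM R M q := by
    intro n
    induction n with
    | zero => intro q _ _; simp
    | succ n ih =>
      intro q hq hqn
      have hlt : p0 < q := lt_of_le_of_ne hq (by rintro rfl; omega)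
      obtain ⟨q', hq', hmax⟩ := WellFounded.has_min (wellFounded_gt (α := PrimeSpectrum R))
        {a : PrimeSpectrum R | p0 ≤ a ∧ a < q}
        ⟨p0, le_rfl, hlt⟩
      have hcov : q' ⋖ q := ⟨hq'.2, fun z h1 h2 => hmax z ⟨hq'.1.trans h1.le, h2⟩ h1⟩
      have h1 := hG.ht_cov hcov
      have h2 := ih q' hq'.1 (by omega)
      refine le_trans ?_ (htM_lt (Module.mem_support_mono hq'.1 hp0) hq'.2)
      push_cast
      gcongr
  rw [hn]
  exact key n p hle hn

/-- For modules embedding in a free module the boundary consists of height n primes -/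
lemma hF_gp {d : ℕ} (hG : Gor R d) [Module.Finite R M] {r : ℕ} {f : M →ₗ[R] (Fin r → R)}
    (hf : Function.Injective f) (n : ℕ) :
    heightFiltration R M n = {p | p ∈ Module.support R M ∧ n ≤ ht p} := by
  ext p
  constructor
  · rintro ⟨h1, h2⟩
    rw [htM_gp hG hf h1] at h2
    exact ⟨h1, by exact_mod_cast h2⟩
  · rintro ⟨h1, h2⟩
    refine ⟨h1, ?_⟩
    rw [htM_gp hG hf h1]
    exact_mod_cast h2

end C2
end GGP

namespace GGP
open CategoryTheory CategoryTheory.Abelian GG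

set_option linter.unusedSectionVars false
section E1
variable {R : Type u} [CommRing R]

lemma ext1_of_lift {A B C N : Type u} [AddCommGroup A] [Module R A] [AddCommGroup B] [Module R B]
    [AddCommGroup C] [Module R C] [AddCommGroup N] [Module R N]
    {f : A →ₗ[R] B} {g : B →ₗ[R] C} (hf : Function.Injective f)
    (hg : Function.Surjective g) (h : Function.Exact f g) (hB : V R N B 1)
    (hex : ∀ φ : N →ₗ[R] C, ∃ ψ : N →ₗ[R] B, g.comp ψ = φ) : V R N A 1 := by
  rw [V_iff]
  intro ξ
  have se := scOf_se f g hf hg h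
  obtain ⟨η, hη⟩ := Ext.covariant_sequence_exact₁ (ModuleCat.of R N) se ξ
    (V_iff.1 hB _) (zero_add 1)
  obtain ⟨φ, rfl⟩ := ext0_exists η
  obtain ⟨ψ, rfl⟩ := hex φ
  rw [← hη, ModuleCat.ofHom_comp, ← Ext.mk₀_comp_mk₀, Ext.comp_assoc_of_second_deg_zero]
  have := se.comp_extClass
  rw [show (Ext.mk₀ (ModuleCat.ofHom g)) = Ext.mk₀ (scOf f g h).g from rfl, this, Ext.comp_zero]

lemma ginj_V {N : Type u} [AddCommGroup N] [Module R N] (h : IsGorensteinInjective R N)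
    {I : Type u} [AddCommGroup I] [Module R I] (hI : Module.Injective R I) (i : ℕ) :
    V R I N (i + 1) := by
  obtain ⟨X, d, hX, hd, hP, ⟨e⟩⟩ := h
  have h2 : ∀ i n, V R I (LinearMap.ker (d n)) (i + 1) := by
    intro i
    induction i with
    | zero =>
      intro n
      obtain ⟨g, hg, he, hgd⟩ := exact_ker (d n) (d (n + 1)) (hd _)
      refine ext1_of_lift (Submodule.injective_subtype _) hg he (V_inj (hX n) 0) fun φ => ?_
      obtain ⟨ψ, hψ⟩ := hP (ModuleCat.of R I) hI n ((Submodule.subtype _).comp φ) (by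
        ext x; exact (φ x).2)
      refine ⟨ψ, ?_⟩
      ext x
      have := LinearMap.congr_fun hψ x
      rw [LinearMap.comp_apply, hgd]; exact this
    | succ i ih =>
      intro n
      obtain ⟨g, hg, he, -⟩ := exact_ker (d n) (d (n + 1)) (hd _)
      exact cov1 (Submodule.injective_subtype _) hg he (ih (n + 1)) (V_inj (hX n) _)
  exact LV_congr_right e.symm (h2 i 0)

lemma inj_of_V {T : Type u} [AddCommGroup T] [Module R T]
    (h : ∀ N : ModuleCat.{u} R, V R N T 1) : Module.Injective R T := by
  constructor
  intro X Y _ _ _ _ f hf g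
  obtain ⟨ψ, hψ⟩ := extend_of_ext1 hf (Submodule.mkQ_surjective (LinearMap.range f))
    (LinearMap.exact_map_mkQ_range f) (h (ModuleCat.of R (Y ⧸ LinearMap.range f))) g
  exact ⟨ψ, fun x => LinearMap.congr_fun hψ x⟩

lemma embed_inj (T : Type u) [AddCommGroup T] [Module R T] : ∃ (I C : ModuleCat.{u} R)
    (f : T →ₗ[R] I) (g : I →ₗ[R] C), Module.Injective R I ∧ Function.Injective f ∧
      Function.Surjective g ∧ Function.Exact f g := by
  let I := Injective.under (ModuleCat.of R T)
  let f : T →ₗ[R] I := (Injective.ι (ModuleCat.of R T)).hom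
  have hI : Module.Injective R I :=
    (Module.injective_iff_injective_object R I).2 (inferInstanceAs (Injective I))
  exact ⟨I, ModuleCat.of R (I ⧸ LinearMap.range f), f, Submodule.mkQ _, hI,
    (ModuleCat.mono_iff_injective _).1 (inferInstanceAs (Mono (Injective.ι (ModuleCat.of R T)))),
    Submodule.mkQ_surjective _, LinearMap.exact_map_mkQ_range f⟩

lemma V_idl {M : Type u} [AddCommGroup M] [Module R M] {s : ℕ}
    (h : ∀ I : ModuleCat.{u} R, Module.Injective R I → ∀ i, s < i → V R I M i) (n : ℕ) :
    ∀ T : ModuleCat.{u} R, IDL R T n → ∀ i, s < i → V R T M i := by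
  induction n with
  | zero => exact fun T hT => h T (inj_of_V fun N => hT N 1 Nat.zero_lt_one)
  | succ n ih =>
    intro T hT i hi
    obtain ⟨I, C, f, g, hI, hf, hg, he⟩ := embed_inj (R := R) T
    refine con1 hf hg he (h I hI i hi) (ih C ?_ (i + 1) (by omega))
    intro N j hj
    obtain ⟨j, rfl⟩ : ∃ j', j = j' + 1 := ⟨j - 1, by omega⟩
    exact cov3 hf hg he (V_inj hI j) (hT N _ (by omega))

lemma cousin_ses {F : ℕ → Set (PrimeSpectrum R)} {M : ModuleCat.{u} R} (n : ℕ)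
    (hr : LinearMap.range (cousinTheta R F M n) ≤ finSupp R (F n \ F (n + 1)) (cousinK R F M n))
    (hi : Function.Injective (cousinTheta R F M n)) :
    ∃ (f : cousinK R F M n →ₗ[R] cousinC R F M n) (g : cousinC R F M n →ₗ[R] cousinK R F M (n + 1)),
      Function.Injective f ∧ Function.Surjective g ∧ Function.Exact f g :=
  ⟨th hr, nq _ _, th_inj hr hi, nq_surj, th_exact hr⟩

lemma gg_gproj [IsLocalRing R] (hR : IsGorensteinLocalRing R) (M : ModuleCat.{u} R)
    (h : IsGGorenstein R M) : IsGorensteinProjective R M := by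
  obtain ⟨hN, n0, hid⟩ := hR
  have hIDL := IDL_of_idLE hid
  obtain ⟨d, hG⟩ := exists_gor hIDL
  obtain ⟨⟨x, hx⟩, hfin, hC⟩ := h
  have hnt : Nontrivial M := ⟨x, 0, hx⟩
  rw [cousin_iff] at hC
  obtain ⟨h1, h2, h3⟩ := hC
  set F := heightFiltration R M with hF
  have hm : mm R ∈ Module.support R M := by
    obtain ⟨p, hp⟩ := Module.nonempty_support_of_nontrivial (R := R) (M := M)
    exact Module.mem_support_mono (le_mm p) hp
  obtain ⟨s, hs⟩ : ∃ s : ℕ, htM R M (mm R) = s := by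
    have : htM R M (mm R) ≠ ⊤ := (lt_of_le_of_lt (htM_le hm) (ENat.natCast_lt_top _)).ne
    exact ⟨_, (ENat.natCast_toNat this).symm⟩
  have hbig : ∀ n, s < n → ∀ p, p ∉ F n \ F (n + 1) := by
    intro n hn p hp
    obtain ⟨a, b⟩ := hF_diff hp
    have := htM_mono a (le_mm p)
    rw [b, hs] at this
    have : n ≤ s := by exact_mod_cast this
    omega
  have hsmall : ∀ n, n < s → ∀ p ∈ F n \ F (n + 1), p ∉ Module.support R (kk R) := by
    intro n hn p hp hp2
    replace hp2 := mem_supp_quot.1 hp2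
    have e : p = mm R := le_antisymm (le_mm p) hp2
    subst e
    have := (hF_diff hp).2
    rw [hs] at this
    have : s = n := by exact_mod_cast this
    omega
  have hI : ∀ I : ModuleCat.{u} R, Module.Injective R I → ∀ i, s < i → V R I M i := by
    intro I hI
    have key : ∀ k n, n + k = s + 1 → ∀ i, s < i + n → V R I (cousinK R F M n) i := by
      intro k
      induction k with
      | zero =>
        intro n hn i _
        have : Subsingleton (cousinK R F M n) := by
          refine ⟨fun a b => h2 n ?_⟩
          funext p
          exact absurd p.2 (hbig n (by omega) p.1)
        exact V_sub_right i
      | succ k ih =>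
        intro n hn i hi
        obtain ⟨i, rfl⟩ : ∃ i', i = i' + 1 := ⟨i - 1, by omega⟩
        obtain ⟨f, g, hf, hg, he⟩ := cousin_ses n (h1 n) (h2 n)
        exact cov1 hf hg he (ih (n + 1) (by omega) i (by omega)) (ginj_V (h3 n) hI i)
    exact fun i hi => key (s + 1) 0 (by omega) i hi
  have hk : ∀ i n, i + n < s → V R (kk R) (cousinK R F M n) i := by
    intro i
    induction i with
    | zero =>
      intro n hn
      obtain ⟨f, g, hf, hg, he⟩ := cousin_ses n (h1 n) (h2 n)
      exact cov1_zero hf (V_finSupp _ (hsmall n (by omega)) 0)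
    | succ i ih =>
      intro n hn
      obtain ⟨f, g, hf, hg, he⟩ := cousin_ses n (h1 n) (h2 n)
      exact cov1 hf hg he (ih (n + 1) (by omega)) (V_finSupp _ (hsmall n (by omega)) _)
  obtain ⟨rs, hl, hm1, hreg⟩ := hG.exists_reg
  obtain ⟨Q, hQ, -, -, hQi, hQv⟩ := regQ rs R hreg hm1
  have hds : d ≤ s := by
    by_contra hlt
    have h4 := V_idl hI n0 Q (hQi n0 hIDL) (0 + rs.length) (by omega)
    have h5 := hQv M 0 h4
    rw [V0_iff] at h5
    apply hx
    simpa using LinearMap.congr_fun (h5 (LinearMap.toSpanSingleton R M x)) 1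
  have hk0 : ∀ i < d, V R (kk R) M i := fun i hi => hk i 0 (by omega)
  obtain ⟨rs', hl', hm', hreg'⟩ := @rees R _ _ _ M M.isAddCommGroup M.isModule hfin hnt d hk0
  obtain ⟨Q', hQ', -, -, -, hQv'⟩ := @regQ R _ _ _ rs' M M.isAddCommGroup M.isModule hfin hreg' hm'
  have hgp : GP R M := fun i => hQv' (ModuleCat.of R R) (i + 1) (hG.idl _ _ (by omega))
  obtain ⟨c⟩ := hG.cr hgp
  exact c.gproj

end E1
end GGP

namespace GGP
open CategoryTheory CategoryTheory.Abelian GG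

set_option linter.unusedSectionVars false
section F1
variable {R : Type u} [CommRing R] [IsNoetherianRing R] [IsLocalRing R] {d : ℕ}

lemma CR.V_supp (hG : Gor R d) {M : Type u} [AddCommGroup M] [Module R M] (c : CR R M)
    {N : Type u} [AddCommGroup N] [Module R N] [Module.Finite R N] (m : ℕ)
    (h : ∀ p ∈ Module.support R N, m ≤ ht p) (i : ℕ) : ∀ j, i < m → V R N (c.Z j) i := by
  induction i with
  | zero =>
    intro j hi
    exact cov1_zero (c.inj j) (V_into_proj 0 (hG.V_supp m 0 hi h))
  | succ i ih =>
    intro j hi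
    exact cov1 (c.inj j) (c.surj j) (c.ex j) (ih (j + 1) (by omega))
      (V_into_proj _ (hG.V_supp m _ hi h))

lemma theta_inj {F : ℕ → Set (PrimeSpectrum R)} (n : ℕ)
    (h1 : ∀ p ∈ F (n + 1), n + 1 ≤ ht p)
    {K : Type u} [AddCommGroup K] [Module R K] (hK : Module.support R K ⊆ F n)
    (hV : ∀ (N : ModuleCat.{u} R) [Module.Finite R N] (m i : ℕ),
      (∀ p ∈ Module.support R N, m ≤ ht p) → i + n < m → V R N K i) :
    Function.Injective (thetaFull R (F n \ F (n + 1)) K) := by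
  rw [injective_iff_map_eq_zero]
  intro x hx
  let N := Submodule.span R {x}
  have hN : Module.Finite R (ModuleCat.of R N) := inferInstanceAs (Module.Finite R (R ∙ x))
  have key : V R N K 0 := by
    refine hV (ModuleCat.of R N) (n + 1) 0 ?_ (by omega)
    intro p hp
    rw [Module.mem_support_iff'] at hp
    obtain ⟨⟨y, hy⟩, hyp⟩ := hp
    obtain ⟨a, rfl⟩ := Submodule.mem_span_singleton.1 hy
    have hxp : ∀ r, r ∉ p.asIdeal → r • x ≠ 0 := by
      intro r hr h0
      refine hyp r hr (Subtype.ext ?_)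
      change r • a • x = 0
      rw [smul_comm, h0, smul_zero]
    have hpn : p ∈ F n := hK (Module.mem_support_iff'.2 ⟨x, hxp⟩)
    apply h1
    by_contra hpn1
    have := congrFun hx ⟨p, hpn, hpn1⟩
    obtain ⟨s, hs, e⟩ := lp_zero.1 this
    exact hxp s hs e
  rw [V0_iff] at key
  exact LinearMap.congr_fun (key N.subtype) ⟨x, Submodule.mem_span_singleton_self x⟩

lemma cousin_exact {F : ℕ → Set (PrimeSpectrum R)} (hF : Filt F)
    (h1 : ∀ n, ∀ p ∈ F n, n ≤ ht p) (h2 : ∀ n, ∀ p ∈ F n \ F (n + 1), ht p = n)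
    (M : ModuleCat.{u} R) (hM : Module.support R M ⊆ F 0)
    (hV : ∀ (N : ModuleCat.{u} R) [Module.Finite R N] (m i : ℕ),
      (∀ p ∈ Module.support R N, m ≤ ht p) → i < m → V R N M i) (n : ℕ) :
    LinearMap.range (cousinTheta R F M n) ≤ finSupp R (F n \ F (n + 1)) (cousinK R F M n) ∧
    Function.Injective (cousinTheta R F M n) ∧
    Module.support R (cousinK R F M n) ⊆ F n := by
  have key : ∀ n, Module.support R (cousinK R F M n) ⊆ F n ∧
      (∀ (N : ModuleCat.{u} R) [Module.Finite R N] (m i : ℕ),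
      (∀ p ∈ Module.support R N, m ≤ ht p) → i + n < m → V R N (cousinK R F M n) i) := by
    intro n
    induction n with
    | zero => exact ⟨hM, hV⟩
    | succ n ih =>
      obtain ⟨hK, hv⟩ := ih
      have hr := theta_fin hF n hK
      refine ⟨next_supp hF n hK hr, ?_⟩
      intro N _ m i hm hi
      obtain ⟨f, g, hf, hg, he⟩ := cousin_ses n hr (theta_inj n (h1 (n + 1)) hK hv)
      refine cov3 hf hg he (V_finSupp _ ?_ i) (hv N m (i + 1) hm (by omega))
      intro p hp hpN
      have := h2 n p hp
      have := hm p hpN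
      omega
  obtain ⟨hK, hv⟩ := key n
  exact ⟨theta_fin hF n hK, theta_inj n (h1 (n + 1)) hK hv, hK⟩

/-- height filtration of the ring -/
def HF (R : Type u) [CommRing R] [IsNoetherianRing R] [IsLocalRing R] (n : ℕ) :
    Set (PrimeSpectrum R) := {p | n ≤ ht p}

lemma HF_diff {n : ℕ} {p : PrimeSpectrum R} : p ∈ HF R n \ HF R (n + 1) ↔ ht p = n := by
  simp only [HF, Set.mem_sdiff, Set.mem_ofPred_eq]; omega

lemma HF_filt : Filt (HF R) where
  anti n p hp := by simp only [HF, Set.mem_ofPred_eq] at *; omega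
  up n p q hp hpq := le_trans (show n ≤ ht p from hp) (ht_le hpq)
  min n p q hp hq hqp := by
    rw [HF_diff] at hp
    by_contra hne
    have h1 := ht_lt (lt_of_le_of_ne hqp hne)
    have h2 : n ≤ ht q := hq
    omega

/-- the ring as an object -/
abbrev RR (R : Type u) [CommRing R] : ModuleCat.{u} R := ModuleCat.of R R

lemma HF_exact (hG : Gor R d) (n : ℕ) :
    LinearMap.range (cousinTheta R (HF R) (RR R) n) ≤
      finSupp R (HF R n \ HF R (n + 1)) (cousinK R (HF R) (RR R) n) ∧
    Function.Injective (cousinTheta R (HF R) (RR R) n) ∧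
    Module.support R (cousinK R (HF R) (RR R) n) ⊆ HF R n :=
  cousin_exact HF_filt (fun _ _ h => h) (fun _ _ h => HF_diff.1 h) (RR R)
    (fun p _ => Nat.zero_le (ht p)) (fun _ _ m i hm hi => hG.V_supp m i hi hm) n

lemma HF_loc (hG : Gor R d) (p : PrimeSpectrum R) : ∀ j, j ≤ ht p → ∀ i, ht p < i + j →
    LV p.asIdeal.primeCompl (R ⧸ p.asIdeal) (cousinK R (HF R) (RR R) j) i := by
  intro j
  induction j with
  | zero =>
    intro _ i hi
    by_contra h
    have := (hG.W_iff p i).1 h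
    omega
  | succ j ih =>
    intro hj i hi
    obtain ⟨hr, hinj, hs⟩ := HF_exact hG j
    obtain ⟨f, g, hf, hg, he⟩ := cousin_ses j hr hinj
    refine cov3 hf hg he (V.lv (V_finSupp _ ?_ i) _) (ih (by omega) (i + 1) (by omega))
    intro p' hp' hp'2
    have h1 := HF_diff.1 hp'
    have h2 := ht_le (mem_supp_quot.1 hp'2 : p ≤ p')
    omega

lemma HF_Vloc (hG : Gor R d) (p q : PrimeSpectrum R) :
    V R (R ⧸ q.asIdeal) (Lp (cousinK R (HF R) (RR R) (ht p)) p) 1 := by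
  induction q using WellFoundedGT.induction with
  | ind q ih =>
  by_cases hle : q ≤ p
  · rcases hle.eq_or_lt with rfl | hlt
    · exact V_loc q.asIdeal.primeCompl (lp _ q) 1 (HF_loc hG q _ le_rfl 1 (by omega))
    · obtain ⟨x, hxp, hxq⟩ := Set.not_subset.1
        (show ¬ (p.asIdeal : Set R) ⊆ q.asIdeal from fun h => hlt.not_ge h)
      refine V_tors_step q x hxq 1 (fun p' h1 h2 => ih p' (lt_of_le_of_ne h1 ?_)) ?_
      · rintro rfl; exact hxq h2
      · intro t
        refine loc_torsion (HF_exact hG (ht p)).2.2 (fun q' h1 h2 => ?_) hxp t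
        exact HF_filt.min (ht p) p q' (HF_diff.2 rfl) h1 h2
  · obtain ⟨x, hxq, hxp⟩ := Set.not_subset.1
        (show ¬ (q.asIdeal : Set R) ⊆ p.asIdeal from hle)
    refine E0 x (lp_bij hxp) ?_ 1
    intro y
    obtain ⟨y, rfl⟩ := Ideal.Quotient.mk_surjective y
    rw [← Ideal.Quotient.mk_eq_mk, ← Submodule.Quotient.mk_smul, Submodule.Quotient.mk_eq_zero]
    exact Ideal.mul_mem_right _ _ hxq

lemma HF_inj (hG : Gor R d) (n : ℕ) : Module.Injective R (cousinC R (HF R) (RR R) n) := by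
  apply Module.Baer.injective
  intro I g
  have hV : V R (R ⧸ I) (cousinC R (HF R) (RR R) n) 1 := by
    refine V_sum (ι := ↥(HF R n \ HF R (n + 1))) (fun p => Lp _ p.1) (finDS _ _).π (finDS _ _).j
      (finDS _ _).sum 1 ?_
    rintro ⟨p, hp⟩
    have hp' := HF_diff.1 hp
    subst hp'
    exact LV_filt _ _ fun q _ => HF_Vloc hG p q
  obtain ⟨ψ, hψ⟩ := extend_of_ext1 (f := I.subtype) (g := I.mkQ) (Submodule.injective_subtype _)
    (Submodule.mkQ_surjective _) (LinearMap.exact_subtype_mkQ I) hV g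
  exact ⟨ψ, fun x hx => LinearMap.congr_fun hψ ⟨x, hx⟩⟩

end F1
end GGP

namespace GGP
open CategoryTheory CategoryTheory.Abelian GG TensorProduct

set_option linter.unusedSectionVars false
section F2
variable {R : Type u} [CommRing R]

lemma coker_equiv {A B C A' B' C' : Type u} [AddCommGroup A] [Module R A] [AddCommGroup B]
    [Module R B] [AddCommGroup C] [Module R C] [AddCommGroup A'] [Module R A'] [AddCommGroup B']
    [Module R B'] [AddCommGroup C'] [Module R C']
    {f : A →ₗ[R] B} {g : B →ₗ[R] C} (hg : Function.Surjective g) (h : Function.Exact f g)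
    {f' : A' →ₗ[R] B'} {g' : B' →ₗ[R] C'} (hg' : Function.Surjective g') (h' : Function.Exact f' g')
    (a : A ≃ₗ[R] A') (b : B ≃ₗ[R] B') (hab : ∀ x, b (f x) = f' (a x)) : Nonempty (C ≃ₗ[R] C') := by
  refine ⟨(h.linearEquivOfSurjective hg).symm.trans
    ((Submodule.Quotient.equiv _ _ b ?_).trans (h'.linearEquivOfSurjective hg'))⟩
  ext y
  constructor
  · rintro ⟨_, ⟨x, rfl⟩, rfl⟩
    exact ⟨a x, (hab x).symm⟩
  · rintro ⟨x, rfl⟩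
    exact ⟨f (a.symm x), ⟨_, rfl⟩, by
      change b (f (a.symm x)) = _
      rw [hab]; simp⟩

lemma loc_lTensor (S : Submonoid R) {K K' : Type u} (M : Type u) [AddCommGroup K] [Module R K]
    [AddCommGroup K'] [Module R K'] [AddCommGroup M] [Module R M] (g : K →ₗ[R] K')
    [IsLocalizedModule S g] : IsLocalizedModule S (g.lTensor M) := by
  have h1 : IsLocalizedModule S (AlgebraTensorModule.rTensor R M g) := inferInstance
  have h2 : g.lTensor M = ((TensorProduct.comm R K' M).toLinearMap ∘ₗ
      (AlgebraTensorModule.rTensor R M g)) ∘ₗ (TensorProduct.comm R M K).toLinearMap := by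
    ext; simp
  rw [h2]
  infer_instance

lemma loc_equiv {M K L : Type u} [AddCommGroup M] [Module R M] [AddCommGroup K] [Module R K]
    [AddCommGroup L] [Module R L] (e : M ⊗[R] K ≃ₗ[R] L) (p : PrimeSpectrum R) :
    ∃ ε : M ⊗[R] Lp K p ≃ₗ[R] Lp L p, ∀ t, ε ((lp K p).lTensor M t) = lp L p (e t) := by
  have := loc_lTensor p.asIdeal.primeCompl M (lp K p)
  exact ⟨IsLocalizedModule.linearEquiv p.asIdeal.primeCompl ((lp K p).lTensor M)
    ((lp L p) ∘ₗ e.toLinearMap), fun t => IsLocalizedModule.linearEquiv_apply _ _ _ t⟩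

lemma tensor_step {M K L : Type u} [AddCommGroup M] [Module R M] [AddCommGroup K] [Module R K]
    [AddCommGroup L] [Module R L] (e : M ⊗[R] K ≃ₗ[R] L) {S S' : Set (PrimeSpectrum R)}
    (hS : S' ⊆ S) (h0 : ∀ p ∈ S, p ∉ S' → p ∉ Module.support R L)
    (hr : LinearMap.range (thetaFull R S K) ≤ finSupp R S K)
    (hr' : LinearMap.range (thetaFull R S' L) ≤ finSupp R S' L) :
    Nonempty (M ⊗[R] finSupp R S K ≃ₗ[R] finSupp R S' L) ∧
      Nonempty (M ⊗[R] nextKType R S K ≃ₗ[R] nextKType R S' L) := by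
  choose ε hε using loc_equiv e
  let c1 := ((finDS S K).tensor M).restrict (Dp := fun p => M ⊗[R] Lp K p) hS (by
    intro p hp hp'
    have := Module.notMem_support_iff.1 (h0 p hp hp')
    exact (ε p).injective.subsingleton)
  let c2 := finDS S' L
  obtain ⟨E, hE⟩ := c1.equiv c2 fun p => ε p.1
  refine ⟨⟨E⟩, ?_⟩
  refine coker_equiv (LinearMap.lTensor_surjective M nq_surj)
    (lTensor_exact M (th_exact hr) nq_surj) nq_surj (th_exact hr') e E ?_
  intro t
  refine c2.ext fun p => ?_
  rw [hE]
  change ε p.1 (((finDS S K).π ⟨p.1, hS p.2⟩).lTensor M ((th hr).lTensor M t)) = lp L p.1 (e t)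
  rw [← hε, ← LinearMap.comp_apply (LinearMap.lTensor M _), ← LinearMap.lTensor_comp]
  rfl

variable [IsNoetherianRing R] [IsLocalRing R] {d : ℕ}

lemma cousin_tensor (hG : Gor R d) {F : ℕ → Set (PrimeSpectrum R)} (M : ModuleCat.{u} R)
    (hF : ∀ n, F n = {p | p ∈ Module.support R M ∧ n ≤ ht p})
    (hr : ∀ n, LinearMap.range (cousinTheta R F M n) ≤
      finSupp R (F n \ F (n + 1)) (cousinK R F M n))
    (hs : ∀ n, Module.support R (cousinK R F M n) ⊆ F n) (n : ℕ) :
    Nonempty (M ⊗[R] cousinC R (HF R) (RR R) n ≃ₗ[R] cousinC R F M n) := by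
  have hS : ∀ n, F n \ F (n + 1) ⊆ HF R n \ HF R (n + 1) := by
    intro n p hp
    rw [hF, hF] at hp
    exact ⟨hp.1.2, fun h => hp.2 ⟨hp.1.1, h⟩⟩
  have h0 : ∀ n, ∀ p ∈ HF R n \ HF R (n + 1), p ∉ F n \ F (n + 1) →
      p ∉ Module.support R (cousinK R F M n) := by
    intro n p hp hp' hps
    have h1 := hs n hps
    refine hp' ⟨h1, fun h2 => hp.2 ?_⟩
    rw [hF] at h2
    exact h2.2
  have key : ∀ n, Nonempty (M ⊗[R] cousinK R (HF R) (RR R) n ≃ₗ[R] cousinK R F M n) := by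
    intro n
    induction n with
    | zero => exact ⟨TensorProduct.rid R M⟩
    | succ n ih =>
      obtain ⟨e⟩ := ih
      exact (tensor_step e (hS n) (h0 n) (HF_exact hG n).1 (hr n)).2
  obtain ⟨e⟩ := key n
  exact (tensor_step e (hS n) (h0 n) (HF_exact hG n).1 (hr n)).1

end F2
end GGP

namespace GGP
open CategoryTheory CategoryTheory.Abelian GG TensorProduct

set_option linter.unusedSectionVars false
section F3
variable {R : Type u} [CommRing R]

lemma ginj_congr {N N' : Type u} [AddCommGroup N] [Module R N] [AddCommGroup N'] [Module R N']
    (e : N ≃ₗ[R] N') (h : IsGorensteinInjective R N) : IsGorensteinInjective R N' := by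
  obtain ⟨X, d, h1, h2, h3, ⟨e'⟩⟩ := h
  exact ⟨X, d, h1, h2, h3, ⟨e.symm.trans e'⟩⟩

lemma inj_hom {P J : Type u} [AddCommGroup P] [Module R P] [AddCommGroup J] [Module R J]
    [Module.Flat R P] (hJ : Module.Injective R J) : Module.Injective R (P →ₗ[R] J) := by
  refine ⟨fun X Y _ _ _ _ f hf g => ?_⟩
  obtain ⟨h, hh⟩ := hJ.out (f.rTensor P) (Module.Flat.rTensor_preserves_injective_linearMap f hf)
    (TensorProduct.lift g)
  refine ⟨TensorProduct.curry h, fun x => ?_⟩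
  ext y
  exact hh (x ⊗ₜ y)

lemma inj_exact {A B C J : Type u} [AddCommGroup A] [Module R A] [AddCommGroup B] [Module R B]
    [AddCommGroup C] [Module R C] [AddCommGroup J] [Module R J] (hJ : Module.Injective R J)
    {f : A →ₗ[R] B} {g : B →ₗ[R] C} (h : Function.Exact f g) (φ : B →ₗ[R] J)
    (hφ : φ.comp f = 0) : ∃ ψ : C →ₗ[R] J, ψ.comp g = φ := by
  have hk : LinearMap.ker g ≤ LinearMap.ker φ := by
    intro x hx
    obtain ⟨y, rfl⟩ := (h x).1 hx
    exact LinearMap.congr_fun hφ y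
  obtain ⟨ψ, hψ⟩ := hJ.out ((LinearMap.ker g).liftQ g le_rfl)
    (LinearMap.ker_eq_bot.1 (Submodule.ker_liftQ_eq_bot _ _ _ le_rfl))
    ((LinearMap.ker g).liftQ φ hk)
  refine ⟨ψ, ?_⟩
  ext x
  exact hψ (Submodule.Quotient.mk x)

section
variable {M : Type u} [AddCommGroup M] [Module R M] (c : CR R M)

/-- differential -/
abbrev CR.d (n : ℤ) : (Fin (c.r n) → R) →ₗ[R] (Fin (c.r (n + 1)) → R) :=
  (c.i (n + 1)).comp (c.p n)

lemma CR.dd (n : ℤ) (x) : c.d (n + 1) (c.d n x) = 0 := by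
  simp [CR.d, (c.ex (n + 1)).apply_apply_eq_zero]

lemma CR.dual_ext {T : Type u} [AddCommGroup T] [Module R T] (hT : ∀ n, V R (c.Z n) T 1)
    (n : ℤ) (φ : (Fin (c.r (n + 1)) → R) →ₗ[R] T) (hφ : φ.comp (c.d n) = 0) :
    ∃ χ : (Fin (c.r (n + 1 + 1)) → R) →ₗ[R] T, χ.comp (c.d (n + 1)) = φ := by
  have h1 : φ.comp (c.i (n + 1)) = 0 := by
    ext x
    obtain ⟨y, rfl⟩ := c.surj n x
    exact LinearMap.congr_fun hφ y
  obtain ⟨ψ, hψ⟩ := extend_quot (c.inj _) (c.surj _) (c.ex _) φ h1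
  obtain ⟨χ, hχ⟩ := extend_of_ext1 (c.inj (n + 1 + 1)) (c.surj _) (c.ex _)
    (hT (n + 1 + 1 + 1)) ψ
  refine ⟨χ, ?_⟩
  rw [← hψ, ← hχ, LinearMap.comp_assoc]

lemma CR.dual_ex (n : ℤ) : Function.Exact (c.d (n + 1)).dualMap (c.d n).dualMap := by
  intro φ
  constructor
  · intro hφ
    exact c.dual_ext (fun n => c.gp n 0) n φ hφ
  · rintro ⟨ψ, rfl⟩
    refine LinearMap.ext fun x => ?_
    change ψ (c.d (n + 1) (c.d n x)) = 0
    rw [c.dd, map_zero]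

lemma dth_nat {F G I : Type u} [AddCommGroup F] [Module R F] [AddCommGroup G] [Module R G]
    [AddCommGroup I] [Module R I] (f : F →ₗ[R] G) (t : Module.Dual R G ⊗[R] I) :
    dualTensorHom R F I (f.dualMap.rTensor I t) = (dualTensorHom R G I t).comp f := by
  induction t with
  | zero => simp
  | add x y hx hy => rw [map_add, map_add, hx, hy, map_add, LinearMap.add_comp]
  | tmul a b => ext; simp [dualTensorHom_apply]

lemma dth_bij {F I : Type u} [AddCommGroup F] [Module R F] [Module.Free R F] [Module.Finite R F]
    [AddCommGroup I] [Module R I] : Function.Bijective (dualTensorHom R F I) := by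
  have := (dualTensorHomEquiv R F I).bijective
  convert this using 1
  ext1 t
  simp

lemma CR.tensor_ex {I : Type u} [AddCommGroup I] [Module R I] (hI : Module.Injective R I) (n : ℤ) :
    Function.Exact ((c.d (n + 1)).dualMap.rTensor I) ((c.d n).dualMap.rTensor I) := by
  intro t
  constructor
  · intro ht
    have h1 := dth_nat (I := I) (c.d n) t
    rw [ht, map_zero] at h1
    obtain ⟨χ, hχ⟩ := c.dual_ext (T := I) (fun n => V_inj hI 0) n _ h1.symm
    obtain ⟨s, rfl⟩ := dth_bij.2 χ
    refine ⟨s, dth_bij.1 ?_⟩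
    rw [dth_nat, hχ]
  · rintro ⟨s, rfl⟩
    rw [← LinearMap.comp_apply, ← LinearMap.rTensor_comp]
    have : (c.d n).dualMap ∘ₗ (c.d (n + 1)).dualMap = 0 := by
      ext1 φ
      exact (c.dual_ex n).apply_apply_eq_zero φ
    rw [this, LinearMap.rTensor_zero, LinearMap.zero_apply]

variable (J : Type u) [AddCommGroup J] [Module R J]

/-- dual differential -/
abbrev CR.δ (n : ℤ) : (Module.Dual R (Fin (c.r n) → R) →ₗ[R] J) →ₗ[R]
    (Module.Dual R (Fin (c.r (n + 1)) → R) →ₗ[R] J) :=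
  LinearMap.lcomp R J (c.d n).dualMap

variable {J}

lemma CR.δ_ex (hJ : Module.Injective R J) (n : ℤ) :
    Function.Exact (c.δ J n) (c.δ J (n + 1)) := by
  intro φ
  constructor
  · intro h
    exact inj_exact hJ (c.dual_ex n) φ h
  · rintro ⟨ψ, rfl⟩
    ext1 x
    change ψ ((c.d n).dualMap ((c.d (n + 1)).dualMap x)) = 0
    rw [(c.dual_ex n).apply_apply_eq_zero, map_zero]

/-- evaluation iso -/
noncomputable def eta (F J : Type u) [AddCommGroup F] [Module R F] [Module.Free R F]
    [Module.Finite R F] [AddCommGroup J] [Module R J] :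
    F ⊗[R] J ≃ₗ[R] (Module.Dual R F →ₗ[R] J) :=
  (TensorProduct.congr (Module.evalEquiv R F) (LinearEquiv.refl R J)).trans
    (LinearEquiv.ofBijective _ (dth_bij (F := Module.Dual R F) (I := J)))

lemma eta_nat {F G : Type u} [AddCommGroup F] [Module R F] [Module.Free R F]
    [Module.Finite R F] [AddCommGroup G] [Module R G] [Module.Free R G]
    [Module.Finite R G] (f : F →ₗ[R] G) (t : F ⊗[R] J) :
    eta G J (f.rTensor J t) = (eta F J t).comp f.dualMap := by
  induction t with
  | zero => simp
  | add x y hx hy => rw [map_add, map_add, hx, hy, map_add, LinearMap.add_comp]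
  | tmul a b => ext; simp [eta, dualTensorHom_apply]

lemma CR.tensor_ker (hJ : Module.Injective R J) (m : ℤ) :
    Nonempty (c.Z m ⊗[R] J ≃ₗ[R] LinearMap.ker (c.δ J m)) := by
  obtain ⟨k, rfl⟩ : ∃ k, m = k + 1 + 1 := ⟨m - 2, by ring⟩
  obtain ⟨g, hg, -, hgd⟩ := exact_ker (c.δ J (k + 1)) (c.δ J (k + 1 + 1))
    (LinearMap.exact_iff.1 (c.δ_ex hJ (k + 1))).symm
  have hex : Function.Exact (c.d k) (c.p (k + 1)) := by
    intro x
    rw [c.ex (k + 1) x]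
    constructor
    · rintro ⟨y, rfl⟩
      obtain ⟨z, rfl⟩ := c.surj k y
      exact ⟨z, rfl⟩
    · rintro ⟨z, rfl⟩
      exact ⟨_, rfl⟩
  have hex' : Function.Exact (c.δ J k) g := by
    intro x
    rw [← c.δ_ex hJ k x, ← hgd, Submodule.coe_eq_zero]
  exact coker_equiv (LinearMap.rTensor_surjective J (c.surj (k + 1)))
    (rTensor_exact J hex (c.surj (k + 1))) hg hex' (eta _ J) (eta _ J) fun t => eta_nat _ t

lemma CR.ginj (c : CR R M) (hJ : Module.Injective R J) : IsGorensteinInjective R (M ⊗[R] J) := by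
  obtain ⟨E⟩ := c.tensor_ker hJ 0
  refine ⟨fun n => ModuleCat.of R (Module.Dual R (Fin (c.r n) → R) →ₗ[R] J), fun n => c.δ J n,
    fun n => inj_hom hJ, fun n => (LinearMap.exact_iff.1 (c.δ_ex hJ n)).symm, ?_,
    ⟨(TensorProduct.congr c.e (LinearEquiv.refl R J)).trans E⟩⟩
  intro I hI n φ hφ
  let φ1 : I →ₗ[R] (Module.Dual R (Fin (c.r (n + 1)) → R) →ₗ[R] J) := φ
  have h0 : (TensorProduct.lift φ1.flip).comp ((c.d (n + 1)).dualMap.rTensor I) = 0 := by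
    apply TensorProduct.ext'
    intro a x
    exact LinearMap.congr_fun (LinearMap.congr_fun hφ x) a
  obtain ⟨ψ, hψ⟩ := inj_exact (A := Module.Dual R (Fin (c.r (n + 1 + 1)) → R) ⊗[R] I)
    (B := Module.Dual R (Fin (c.r (n + 1)) → R) ⊗[R] I)
    (C := Module.Dual R (Fin (c.r n) → R) ⊗[R] I) hJ
    (f := (c.d (n + 1)).dualMap.rTensor I) (g := (c.d n).dualMap.rTensor I)
    (c.tensor_ex hI n) (TensorProduct.lift φ1.flip) h0
  refine ⟨(TensorProduct.curry ψ).flip, ?_⟩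
  ext x : 1
  refine LinearMap.ext fun a => ?_
  exact LinearMap.congr_fun hψ (a ⊗ₜ x)
end

lemma gproj_gg [IsLocalRing R] (hR : IsGorensteinLocalRing R) (M : ModuleCat.{u} R)
    (h0 : ∃ x : M, x ≠ 0) (hf : Module.Finite R M) (h : IsGorensteinProjective R M) :
    IsGGorenstein R M := by
  obtain ⟨hN, n0, hid⟩ := hR
  obtain ⟨d, hG⟩ := exists_gor (IDL_of_idLE hid)
  obtain ⟨c⟩ := hG.cr (GP_of_gproj h)
  have hinj : Function.Injective ((c.i 0).comp c.e.toLinearMap) := (c.inj 0).comp c.e.injective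
  have hF := hF_gp hG hinj
  have key := cousin_exact (F := heightFiltration R M) hF_filt
    (fun n p hp => by rw [hF] at hp; exact hp.2)
    (fun n p hp => by
      have h1 := hF_diff hp
      rw [htM_gp hG hinj h1.1] at h1
      exact_mod_cast h1.2) M hF_supp
    (fun N _ m i hm hi => LV_congr_right c.e.symm (c.V_supp hG m hm i 0 hi))
  refine ⟨h0, hf, (cousin_iff _ _ _).2 ⟨fun n => (key n).1, fun n => (key n).2.1, fun n => ?_⟩⟩
  obtain ⟨E⟩ := cousin_tensor hG M hF (fun n => (key n).1) (fun n => (key n).2.2) n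
  exact ginj_congr E (c.ginj (HF_inj hG n))

end F3
end GGP

open GG in
/-- Over a Gorenstein local ring, a nonzero finitely generated module is G–Gorenstein iff
it is Gorenstein projective. -/
theorem stmt7 (R : Type u) [CommRing R] [IsLocalRing R] (hR : IsGorensteinLocalRing R)
    (M : ModuleCat.{u} R) (hM0 : ∃ x : M, x ≠ 0) (hMf : Module.Finite R M) :
    IsGGorenstein R M ↔ IsGorensteinProjective R M :=
  ⟨GGP.gg_gproj hR M, GGP.gproj_gg hR M hM0 hMf⟩
end

section
/- Let R be a Cohen–Macaulay Noetherian local ring admitting a dualizing complex. If every maximal Cohen–Macaulay R-module has finite injective dimension, then R is regular. -/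
universe u

namespace Aux
open CategoryTheory Abelian IsLocalRing Module TensorProduct

/-- minimal free cover -/
lemma exists_minimal_cover (R : Type u) [CommRing R] [IsLocalRing R]
    (M : Type u) [AddCommGroup M] [Module R M] [Module.Finite R M] :
    ∃ (n : ℕ) (f : (Fin n → R) →ₗ[R] M), Function.Surjective f ∧
      ∀ v, f v = 0 → ∀ i, v i ∈ maximalIdeal R := by
  let k := ResidueField R
  let w := Module.finBasis k (k ⊗[R] M)
  obtain ⟨v, eq⟩ := (TensorProduct.mk_surjective R M k Ideal.Quotient.mk_surjective).comp_left w
  refine ⟨_, Fintype.linearCombination R v, ?_, ?_⟩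
  · rw [← LinearMap.range_eq_top, Fintype.range_linearCombination]
    exact span_eq_top_of_tmul_eq_basis v w (fun i => congrFun eq i)
  · intro c hc i
    have h1 : (TensorProduct.mk R k M 1) (Fintype.linearCombination R v c) = 0 := by
      rw [hc, map_zero]
    rw [Fintype.linearCombination_apply, map_sum] at h1
    have h2 : ∑ i, (residue R (c i)) • w i = 0 := by
      rw [← h1]
      refine Finset.sum_congr rfl fun j _ => ?_
      rw [← eq, map_smul]
      exact algebraMap_smul k (c j) ((TensorProduct.mk R k M 1) (v j))
    have h3 := Fintype.linearIndependent_iff.1 w.linearIndependent _ h2 i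
    exact (residue_eq_zero_iff _).1 h3

variable {R : Type u} [CommRing R] [IsLocalRing R]

lemma map_to_k_zero {n : ℕ} (g : (Fin n → R) →ₗ[R] ResidueField R) (v : Fin n → R)
    (hv : ∀ i, v i ∈ maximalIdeal R) : g v = 0 := by
  rw [pi_eq_sum_univ v, map_sum]
  refine Finset.sum_eq_zero fun i _ => ?_
  rw [map_smul, Algebra.smul_def]
  have : algebraMap R (ResidueField R) (v i) = 0 := (residue_eq_zero_iff _).2 (hv i)
  rw [this, zero_mul]

lemma subsingleton_of_hom_zero (M : Type u) [AddCommGroup M] [Module R M] [Module.Finite R M]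
    (h : ∀ g : M →ₗ[R] ResidueField R, g = 0) : Subsingleton M := by
  rw [← IsLocalRing.subsingleton_tensorProduct (R := R)]
  by_contra hc
  rw [not_subsingleton_iff_nontrivial] at hc
  obtain ⟨y, hy⟩ := exists_ne (0 : ResidueField R ⊗[R] M)
  obtain ⟨m, rfl⟩ := TensorProduct.mk_surjective R M (ResidueField R) Ideal.Quotient.mk_surjective y
  obtain ⟨φ, hφ⟩ := (Module.forall_dual_apply_eq_zero_iff (ResidueField R) _).not.2 hy |> not_forall.1
  have := h ((φ.restrictScalars R).comp (TensorProduct.mk R (ResidueField R) M 1))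
  exact hφ (LinearMap.congr_fun this m)

lemma pd_of_ext_k [IsNoetherianRing R] (n : ℕ) (M : ModuleCat.{u} R) [Module.Finite R M]
    (h : Subsingleton (Ext M (ModuleCat.of R (ResidueField R)) n)) :
    HasProjectiveDimensionLT M n := by
  induction n generalizing M with
  | zero =>
    have : Subsingleton (M ⟶ ModuleCat.of R (ResidueField R)) :=
      Ext.homEquiv₀.subsingleton_congr.mp h
    have : Subsingleton M := subsingleton_of_hom_zero (R := R) M fun g => by
      have := Subsingleton.elim (ModuleCat.ofHom g) 0
      simpa using congrArg ModuleCat.Hom.hom this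
    exact (ModuleCat.isZero_of_subsingleton M).hasProjectiveDimensionLT_zero
  | succ n hn =>
    obtain ⟨r, f, surjf, hf⟩ := exists_minimal_cover R M
    let S : ShortComplex (ModuleCat.{u} R) := f.shortComplexKer
    have hS : S.ShortExact := LinearMap.shortExact_shortComplexKer surjf
    match n with
    | 0 =>
      have hs : Subsingleton S.X₁ := subsingleton_of_hom_zero (R := R) S.X₁ fun g => by
        obtain ⟨x, hx⟩ := Ext.contravariant_sequence_exact₁ hS _ (Ext.mk₀ (ModuleCat.ofHom g))
          (add_zero 1) (h.elim _ _)
        obtain ⟨g', rfl⟩ := (Ext.mk₀_bijective _ _).2 x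
        rw [Ext.mk₀_comp_mk₀, (Ext.mk₀_bijective _ _).1.eq_iff] at hx
        have := congrArg ModuleCat.Hom.hom hx
        ext v
        have h2 := LinearMap.congr_fun this v
        simp only [ModuleCat.hom_ofHom] at h2
        rw [← h2]
        exact map_to_k_zero g'.hom _ (hf _ v.2)
      have hb : Function.Injective f := by
        rw [← LinearMap.ker_eq_bot, ← Submodule.subsingleton_iff_eq_bot]
        exact hs
      have : Module.Projective R M :=
        Module.Projective.of_equiv (LinearEquiv.ofBijective f ⟨hb, surjf⟩)
      have : Projective M := (IsProjective.iff_projective M).1 this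
      infer_instance
    | n + 1 =>
      rw [hS.hasProjectiveDimensionLT_X₃_iff n inferInstance]
      apply hn S.X₁
      let L := (ModuleCat.of R (ResidueField R))
      have (m : ℕ) : Subsingleton (Ext S.X₂ L (m + 1)) := Ext.subsingleton_of_projective S.X₂ L m
      refine ⟨fun a b => ?_⟩
      have key : ∀ a : Ext S.X₁ L (n+1), a = 0 := fun a => by
        obtain ⟨x, hx⟩ := Ext.contravariant_sequence_exact₁ hS _ a (add_comm 1 _) (h.elim _ _)
        rw [← hx, (this n).elim x 0, Ext.comp_zero]
      rw [key a, key b]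


/-- depth zero: finite projective dimension implies free -/
lemma free_of_socle [IsNoetherianRing R] (a : R) (ha : a ≠ 0)
    (ham : ∀ x ∈ maximalIdeal R, a * x = 0) (n : ℕ) (M : ModuleCat.{u} R) [Module.Finite R M]
    (h : HasProjectiveDimensionLT M n) : Module.Free R M := by
  induction n generalizing M with
  | zero =>
    have : Subsingleton M :=
      ModuleCat.isZero_iff_subsingleton.1 (isZero_of_hasProjectiveDimensionLT_zero M)
    infer_instance
  | succ n hn =>
    obtain ⟨r, f, surjf, hf⟩ := exists_minimal_cover R M
    let S : ShortComplex (ModuleCat.{u} R) := f.shortComplexKer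
    have hS : S.ShortExact := LinearMap.shortExact_shortComplexKer surjf
    match n with
    | 0 =>
      have h1 : Projective M := projective_iff_hasProjectiveDimensionLT_one.2 h
      have : Module.Projective R M := (IsProjective.iff_projective M).2 h1
      exact Module.free_of_flat_of_isLocalRing
    | n + 1 =>
      have h1 : HasProjectiveDimensionLT S.X₁ (n + 1) :=
        (hS.hasProjectiveDimensionLT_X₃_iff n inferInstance).1 h
      have hfree : Module.Free R S.X₁ := hn S.X₁ h1
      have hz : ∀ v : S.X₁, a • v = 0 := fun v => by
        apply Subtype.ext
        funext i
        exact ham _ (hf _ v.2 i)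
      have hs : Subsingleton S.X₁ := by
        by_contra hc
        rw [not_subsingleton_iff_nontrivial] at hc
        have h3 : a ∈ Module.annihilator R S.X₁ := Module.mem_annihilator.2 hz
        rw [annihilator_eq_bot.mpr inferInstance] at h3
        exact ha h3
      have hb : Function.Injective f := by
        rw [← LinearMap.ker_eq_bot, ← Submodule.subsingleton_iff_eq_bot]
        exact hs
      exact Module.Free.of_equiv (LinearEquiv.ofBijective f ⟨hb, surjf⟩)

lemma maximalIdeal_eq_bot_of_socle [IsNoetherianRing R] (a : R) (ha : a ≠ 0)
    (ham : ∀ x ∈ maximalIdeal R, a * x = 0) (n : ℕ)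
    (h : HasProjectiveDimensionLT (ModuleCat.of R (ResidueField R)) n) :
    maximalIdeal R = ⊥ := by
  have : Module.Free R (ResidueField R) :=
    free_of_socle a ha ham n (ModuleCat.of R (ResidueField R)) h
  have h1 : Module.annihilator R (ResidueField R) = ⊥ := annihilator_eq_bot.mpr inferInstance
  rw [← h1]
  exact (Ideal.annihilator_quotient).symm

/-- choice of the element -/
lemma socle_or_exists [IsNoetherianRing R] (hm : maximalIdeal R ≠ ⊥) :
    (∃ a : R, a ≠ 0 ∧ ∀ x ∈ maximalIdeal R, a * x = 0) ∨
    ∃ x ∈ maximalIdeal R, x ∉ maximalIdeal R ^ 2 ∧ IsSMulRegular R x := by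
  by_cases hA : maximalIdeal R ∈ associatedPrimes R R
  · left
    obtain ⟨hp, a, ha⟩ := isAssociatedPrime_iff.1 hA
    refine ⟨a, ?_, ?_⟩
    · rintro rfl
      apply hp.ne_top
      rw [ha]; ext; simp
    · intro x hx
      rw [ha] at hx
      simpa [mul_comm, Submodule.mem_colon_singleton] using hx
  · right
    have hfin := associatedPrimes.finite R R
    let s := insert (maximalIdeal R ^ 2) hfin.toFinset
    have key : ¬ ((maximalIdeal R : Set R) ⊆ ⋃ i ∈ (s : Set (Ideal R)), (i : Set R)) := by
      intro hc
      rw [Ideal.subset_union_prime (maximalIdeal R ^ 2) (maximalIdeal R ^ 2)] at hc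
      · obtain ⟨i, hi, hle⟩ := hc
        rcases Finset.mem_insert.1 hi with rfl | hi
        · have : maximalIdeal R ^ 2 < maximalIdeal R :=
            (maximalIdeal_sq_lt_maximalIdeal R).2 (fun hF => hm (isField_iff_maximalIdeal_eq.1 hF))
          exact absurd hle (not_le_of_gt this)
        · have hi : i ∈ associatedPrimes R R := by simpa using hi
          have hip : i.IsPrime := hi.1
          exact hA ((maximalIdeal.isMaximal R).eq_of_le hip.ne_top hle ▸ hi)
      · intro i hi h1 _
        rcases Finset.mem_insert.1 hi with rfl | hi
        · exact absurd rfl h1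
        · have hi : i ∈ associatedPrimes R R := by simpa using hi
          exact hi.1
    rw [Set.not_subset] at key
    obtain ⟨x, hx, hn⟩ := key
    simp only [Set.mem_iUnion, not_exists] at hn
    refine ⟨x, hx, fun h => hn _ (by simp [s]) h, ?_⟩
    by_contra hreg
    have : x ∈ (⋃ p ∈ associatedPrimes R R, p : Set R) := by
      rw [biUnion_associatedPrimes_eq_compl_regular]
      exact hreg
    simp only [Set.mem_iUnion] at this
    obtain ⟨p, hp, hxp⟩ := this
    exact hn p (by simp [s, hp]) hxp


lemma quotSMulTop_map_injective {R : Type u} [CommRing R] (x : R)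
    {A B C : Type u} [AddCommGroup A] [Module R A]
    [AddCommGroup B] [Module R B] [AddCommGroup C] [Module R C]
    (i : A →ₗ[R] B) (p : B →ₗ[R] C) (hi : Function.Injective i) (hex : Function.Exact i p)
    (hx : IsSMulRegular C x) : Function.Injective (QuotSMulTop.map x i) := by
  rw [injective_iff_map_eq_zero]
  intro a ha
  obtain ⟨a, rfl⟩ := Submodule.Quotient.mk_surjective _ a
  rw [QuotSMulTop.map_apply_mk, Submodule.Quotient.mk_eq_zero] at ha
  rw [Submodule.Quotient.mk_eq_zero]
  obtain ⟨b, -, hb⟩ := (Submodule.mem_smul_pointwise_iff_exists _ _ _).1 ha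
  have h1 : x • p b = 0 := by rw [← map_smul, hb]; exact hex.apply_apply_eq_zero a
  have h2 : p b = 0 := hx (by simpa using h1)
  obtain ⟨c, rfl⟩ := (hex b).1 h2
  have : x • c = a := hi (by rw [map_smul, hb])
  rw [← this]
  exact Submodule.smul_mem_pointwise_smul _ _ _ trivial

lemma pd_baseChange [IsNoetherianRing R] (x : R) (hxR : IsSMulRegular R x)
    (n : ℕ) (M : ModuleCat.{u} R) [Module.Finite R M] (hxM : IsSMulRegular M x)
    (h : HasProjectiveDimensionLT M n) :
    HasProjectiveDimensionLT (ModuleCat.of (R ⧸ Ideal.span {x}) ((R ⧸ Ideal.span {x}) ⊗[R] M)) n := by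
  induction n generalizing M with
  | zero =>
    have : Subsingleton M :=
      ModuleCat.isZero_iff_subsingleton.1 (isZero_of_hasProjectiveDimensionLT_zero M)
    have : Subsingleton ((R ⧸ Ideal.span {x}) ⊗[R] M) := inferInstance
    exact (ModuleCat.isZero_iff_subsingleton.2 this).hasProjectiveDimensionLT_zero
  | succ n hn =>
    obtain ⟨r, f, surjf⟩ := Module.Finite.exists_fin' R M
    let S : ShortComplex (ModuleCat.{u} R) := f.shortComplexKer
    have hS : S.ShortExact := LinearMap.shortExact_shortComplexKer surjf
    match n with
    | 0 =>
      have h1 : Projective M := projective_iff_hasProjectiveDimensionLT_one.2 h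
      have : Module.Projective R M := (IsProjective.iff_projective M).2 h1
      have h2 : Projective (ModuleCat.of (R ⧸ Ideal.span {x}) ((R ⧸ Ideal.span {x}) ⊗[R] M)) :=
        (IsProjective.iff_projective _).1 inferInstance
      exact projective_iff_hasProjectiveDimensionLT_one.1 h2
    | n + 1 =>
      have h1 : HasProjectiveDimensionLT S.X₁ (n + 1) :=
        (hS.hasProjectiveDimensionLT_X₃_iff n inferInstance).1 h
      have hreg : IsSMulRegular S.X₁ x := by
        intro a b hab
        apply Subtype.ext
        funext i
        exact hxR (congrFun (congrArg Subtype.val hab) i)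
      have h2 := hn S.X₁ hreg h1
      let Q := R ⧸ Ideal.span {x}
      let i : LinearMap.ker f →ₗ[R] (Fin r → R) := (LinearMap.ker f).subtype
      have hex : Function.Exact i f := LinearMap.exact_subtype_ker_map f
      have hexQ : Function.Exact (i.baseChange Q) (f.baseChange Q) :=
        lTensor_exact Q hex surjf
      have hsurj : Function.Surjective (f.baseChange Q) := LinearMap.lTensor_surjective Q surjf
      have hinj : Function.Injective (i.baseChange Q) := by
        have hq := quotSMulTop_map_injective x i f (Submodule.subtype_injective _) hex hxM
        have hnat := QuotSMulTop.equivQuotTensor_naturality x i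
        intro a b hab
        obtain ⟨a, rfl⟩ := (QuotSMulTop.equivQuotTensor x _).surjective a
        obtain ⟨b, rfl⟩ := (QuotSMulTop.equivQuotTensor x _).surjective b
        congr 1
        apply hq
        apply (QuotSMulTop.equivQuotTensor x _).injective
        have ha := LinearMap.congr_fun hnat a
        have hb := LinearMap.congr_fun hnat b
        exact ha.trans (hab.trans hb.symm)
      let T : ShortComplex (ModuleCat.{u} Q) :=
        ShortComplex.mk (X₁ := ModuleCat.of Q (Q ⊗[R] LinearMap.ker f))
          (X₂ := ModuleCat.of Q (Q ⊗[R] (Fin r → R))) (X₃ := ModuleCat.of Q (Q ⊗[R] M))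
          (ModuleCat.ofHom (i.baseChange Q)) (ModuleCat.ofHom (f.baseChange Q))
          (by ext1; exact hexQ.linearMap_comp_eq_zero)
      have hT : T.ShortExact :=
        { exact := (ShortComplex.ShortExact.moduleCat_exact_iff_function_exact T).2 hexQ
          mono_f := (ModuleCat.mono_iff_injective _).2 hinj
          epi_g := (ModuleCat.epi_iff_surjective _).2 hsurj }
      have hP : Projective T.X₂ := (IsProjective.iff_projective (R := Q) (Q ⊗[R] (Fin r → R))).1 inferInstance
      exact (hT.hasProjectiveDimensionLT_X₃_iff n hP).2 h2


lemma exists_functional (x : R) (hx : x ∈ maximalIdeal R) [IsNoetherianRing R]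
    (hx2 : x ∉ maximalIdeal R ^ 2) :
    ∃ φ : maximalIdeal R →ₗ[R] ResidueField R, φ ⟨x, hx⟩ = 1 := by
  let c : CotangentSpace R := (maximalIdeal R).toCotangent ⟨x, hx⟩
  have hc : c ≠ 0 := by
    intro h
    exact hx2 (((maximalIdeal R).toCotangent_eq_zero ⟨x, hx⟩).1 h)
  obtain ⟨g, hg⟩ := (Module.forall_dual_apply_eq_zero_iff (ResidueField R) c).not.2 hc
    |> not_forall.1
  refine ⟨(((g c)⁻¹ • g).restrictScalars R).comp (maximalIdeal R).toCotangent, ?_⟩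
  exact inv_mul_cancel₀ hg

lemma pd_residueField_quotient [IsNoetherianRing R] (x : R) (hx : x ∈ maximalIdeal R)
    (hx2 : x ∉ maximalIdeal R ^ 2) [IsLocalRing (R ⧸ Ideal.span {x})]
    (n : ℕ)
    (h : HasProjectiveDimensionLT (ModuleCat.of (R ⧸ Ideal.span {x})
      ((R ⧸ Ideal.span {x}) ⊗[R] maximalIdeal R)) n) :
    HasProjectiveDimensionLT (ModuleCat.of (R ⧸ Ideal.span {x})
      (ResidueField (R ⧸ Ideal.span {x}))) n := by
  let Q := R ⧸ Ideal.span {x}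
  obtain ⟨φ, hφ⟩ := exists_functional x hx hx2
  have hsurj : Function.Surjective (algebraMap R Q) := Ideal.Quotient.mk_surjective
  have hloc : IsLocalHom (algebraMap R Q) := IsLocalHom.of_surjective _ hsurj
  let ρ : ResidueField R →ₗ[R] ResidueField Q :=
    { toFun := ResidueField.map (algebraMap R Q)
      map_add' := map_add _
      map_smul' := fun r a => by
        obtain ⟨a, rfl⟩ := residue_surjective a
        simp only [Algebra.smul_def, map_mul, RingHom.id_apply]
        rfl }
  have hρ : ρ 1 = 1 := map_one (ResidueField.map (algebraMap R Q))
  let π : Q ⊗[R] maximalIdeal R →ₗ[Q] ResidueField Q := LinearMap.liftBaseChange Q (ρ ∘ₗ φ)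
  let e : Q ⊗[R] maximalIdeal R := 1 ⊗ₜ ⟨x, hx⟩
  have hπ : π e = 1 := by
    simp [π, e, hφ, hρ]
  have hker : maximalIdeal Q ≤ LinearMap.ker (LinearMap.toSpanSingleton Q _ e) := by
    intro q hq
    obtain ⟨y, rfl⟩ := hsurj q
    have hy : y ∈ maximalIdeal R := by
      rw [mem_maximalIdeal, mem_nonunits_iff] at hq ⊢
      exact fun hu => hq (hu.map _)
    rw [LinearMap.mem_ker, LinearMap.toSpanSingleton_apply, algebraMap_smul]
    have h1 : y • (⟨x, hx⟩ : maximalIdeal R) = x • ⟨y, hy⟩ := Subtype.ext (mul_comm _ _)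
    simp only [e]
    rw [← TensorProduct.tmul_smul, h1, TensorProduct.tmul_smul, TensorProduct.smul_tmul']
    have h2 : x • (1 : Q) = 0 := by
      rw [Algebra.smul_def, mul_one]
      exact Ideal.Quotient.eq_zero_iff_mem.2 (Ideal.mem_span_singleton_self x)
    rw [h2, TensorProduct.zero_tmul]
  let ι : ResidueField Q →ₗ[Q] Q ⊗[R] maximalIdeal R :=
    Submodule.liftQ (maximalIdeal Q) (LinearMap.toSpanSingleton Q _ e) hker
  have hcomp : π ∘ₗ ι = LinearMap.id := by
    ext a
    obtain ⟨a, rfl⟩ := residue_surjective a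
    have h1 : ι (residue Q a) = a • e := rfl
    rw [LinearMap.comp_apply, h1, map_smul, hπ, Algebra.smul_def, mul_one]
    rfl
  have ret : Retract (ModuleCat.of Q (ResidueField Q)) (ModuleCat.of Q (Q ⊗[R] maximalIdeal R)) :=
    { i := ModuleCat.ofHom ι
      r := ModuleCat.ofHom π
      retract := by
        rw [← ModuleCat.ofHom_comp, hcomp]; rfl }
  exact ret.hasProjectiveDimensionLT n

lemma regular_of_quotient [IsNoetherianRing R] (x : R) (hx : x ∈ maximalIdeal R)
    (hreg : IsSMulRegular R x) (h : IsRegularLocalRing (R ⧸ Ideal.span {x})) :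
    IsRegularLocalRing R := by
  let Q := R ⧸ Ideal.span {x}
  have hsurj : Function.Surjective (algebraMap R Q) := Ideal.Quotient.mk_surjective
  apply IsRegularLocalRing.of_spanFinrank_maximalIdeal_le
  rw [← ringKrullDim_quotient_span_singleton_succ_eq_ringKrullDim hreg hx,
    ← h.spanFinrank_maximalIdeal]
  have hfg : (maximalIdeal Q).FG := IsNoetherian.noetherian _
  have hgen := Submodule.FG.generators_ncard hfg
  have hfin := Submodule.FG.finite_generators hfg
  have hspan := Submodule.span_generators (maximalIdeal Q)
  let s := (maximalIdeal Q).generators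
  let t : Set R := insert x (Set.image (Function.surjInv hsurj) s)
  have ht : Ideal.span t = maximalIdeal R := by
    apply le_antisymm
    · rw [Ideal.span_le]
      rintro y (rfl | ⟨q, hq, rfl⟩)
      · exact hx
      · have hq' : q ∈ maximalIdeal Q := by rw [← hspan]; exact Submodule.subset_span hq
        rw [← Function.surjInv_eq hsurj q] at hq'
        rw [SetLike.mem_coe, mem_maximalIdeal, mem_nonunits_iff]
        rw [mem_maximalIdeal, mem_nonunits_iff] at hq'
        exact fun hu => hq' (hu.map _)
    · intro y hy
      have hy' : algebraMap R Q y ∈ maximalIdeal Q := by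
        have hloc : IsLocalHom (algebraMap R Q) := IsLocalHom.of_surjective _ hsurj
        rw [mem_maximalIdeal, mem_nonunits_iff] at hy ⊢
        exact fun hu => hy (isUnit_of_map_unit _ _ hu)
      have hmap : (Ideal.span (Set.image (Function.surjInv hsurj) s)).map (algebraMap R Q)
          = maximalIdeal Q := by
        rw [Ideal.map_span, ← Set.image_comp, Function.RightInverse.id
          (Function.rightInverse_surjInv hsurj), Set.image_id]
        exact hspan
      rw [← hmap, Ideal.mem_map_iff_of_surjective _ hsurj] at hy'
      obtain ⟨z, hz, hzy⟩ := hy'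
      have h1 : y - z ∈ Ideal.span {x} := by
        rw [← Ideal.Quotient.eq]; exact hzy.symm
      have h2 : y = (y - z) + z := by ring
      rw [h2]
      exact Ideal.add_mem _ (Ideal.span_mono (by simp [t]) h1)
        (Ideal.span_mono (Set.subset_insert _ _) hz)
  have hcard : (maximalIdeal R).spanFinrank ≤ (maximalIdeal Q).spanFinrank + 1 := by
    rw [← ht]
    refine (Submodule.spanFinrank_span_le_ncard_of_finite ((hfin.image _).insert _)).trans ?_
    refine (Set.ncard_insert_le _ _).trans ?_
    rw [← hgen]
    exact Nat.add_le_add_right (Set.ncard_image_le hfin) 1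
  exact_mod_cast hcard

theorem regular_of_pd (d : ℕ) : ∀ (R : Type u) [CommRing R] [IsLocalRing R] [IsNoetherianRing R]
    (_ : ringKrullDim R ≤ d) (n : ℕ)
    (_ : HasProjectiveDimensionLT (ModuleCat.of R (ResidueField R)) n),
    IsRegularLocalRing R := by
  induction d with
  | zero =>
    intro R _ _ _ hd n h
    by_cases hm : maximalIdeal R = ⊥
    · exact IsRegularLocalRing.of_spanFinrank_maximalIdeal_le R (by
        rw [hm]; simpa using ringKrullDim_nonneg_of_nontrivial)
    rcases socle_or_exists hm with ⟨a, ha, ham⟩ | ⟨x, hx, hx2, hreg⟩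
    · exact absurd (maximalIdeal_eq_bot_of_socle a ha ham n h) hm
    · exfalso
      have := ringKrullDim_quotient_span_singleton_succ_eq_ringKrullDim hreg hx
      have hnt : Nontrivial (R ⧸ Ideal.span {x}) := Ideal.Quotient.nontrivial_iff.2
        (fun h => (mem_maximalIdeal x).1 hx (Ideal.span_singleton_eq_top.1 h))
      have h0 : 0 ≤ ringKrullDim (R ⧸ Ideal.span {x}) := ringKrullDim_nonneg_of_nontrivial
      rw [← this] at hd
      have h1 : (0 : WithBot ℕ∞) + 1 ≤ 0 := (add_le_add_left h0 1).trans hd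
      exact absurd h1 (by decide)
  | succ d ih =>
    intro R _ _ _ hd n h
    by_cases hm : maximalIdeal R = ⊥
    · exact IsRegularLocalRing.of_spanFinrank_maximalIdeal_le R (by
        rw [hm]; simpa using ringKrullDim_nonneg_of_nontrivial)
    rcases socle_or_exists hm with ⟨a, ha, ham⟩ | ⟨x, hx, hx2, hreg⟩
    · exact absurd (maximalIdeal_eq_bot_of_socle a ha ham n h) hm
    · have hdim := ringKrullDim_quotient_span_singleton_succ_eq_ringKrullDim hreg hx
      have hnt : Nontrivial (R ⧸ Ideal.span {x}) := Ideal.Quotient.nontrivial_iff.2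
        (fun h => (mem_maximalIdeal x).1 hx (Ideal.span_singleton_eq_top.1 h))
      have hloc : IsLocalRing (R ⧸ Ideal.span {x}) :=
        IsLocalRing.of_surjective' _ Ideal.Quotient.mk_surjective
      apply regular_of_quotient x hx hreg
      -- pd of the maximal ideal
      let f : R →ₗ[R] ResidueField R := (maximalIdeal R).mkQ
      let S : ShortComplex (ModuleCat.{u} R) := f.shortComplexKer
      have hS : S.ShortExact :=
        LinearMap.shortExact_shortComplexKer (Submodule.mkQ_surjective (maximalIdeal R))
      have h1 : HasProjectiveDimensionLT S.X₁ (n + 1) :=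
        (hS.hasProjectiveDimensionLT_X₃_iff n
          (inferInstanceAs (Projective (ModuleCat.of R R)))).1
          (hasProjectiveDimensionLT_of_ge (ModuleCat.of R (ResidueField R)) n _ (by omega))
      have hk : LinearMap.ker f = maximalIdeal R := Submodule.ker_mkQ _
      have h2 : HasProjectiveDimensionLT (ModuleCat.of R (maximalIdeal R)) (n + 1) :=
        hasProjectiveDimensionLT_of_iso (X := S.X₁) (LinearEquiv.ofEq _ _ hk).toModuleIso (n + 1)
      have hreg' : IsSMulRegular (maximalIdeal R) x := by
        intro a b hab
        exact Subtype.ext (hreg (congrArg Subtype.val hab))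
      have h3 := pd_baseChange x hreg (n + 1) (ModuleCat.of R (maximalIdeal R)) hreg' h2
      have h4 := pd_residueField_quotient x hx hx2 (n + 1) h3
      refine ih _ ?_ _ h4
      rw [← hdim] at hd
      push_cast at hd
      exact (ENat.WithBot.add_le_add_one_right_iff).1 hd


lemma isZero_of_subsingleton_module {R : Type u} [CommRing R] (M : Type u) [AddCommGroup M]
    [Module R M] (h : Subsingleton M) : Limits.IsZero (ModuleCat.of R M) := by
  have : Subsingleton (ModuleCat.of R M) := h
  exact ModuleCat.isZero_of_subsingleton _

lemma hasInjDim_of_idLE {R : Type u} [CommRing R] (M : Type u) [AddCommGroup M] [Module R M]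
    (n : ℕ) (h : GG.idLE R M n) : HasInjectiveDimensionLT (ModuleCat.of R M) (n + 1) := by
  obtain ⟨G, d, ε, hG, hε, hex0, hex, hz⟩ := h
  have key : ∀ j i : ℕ, i + j = n + 1 →
      HasInjectiveDimensionLT (ModuleCat.of R (LinearMap.ker (d i))) j := by
    intro j
    induction j with
    | zero =>
      intro i hi
      apply Limits.IsZero.hasInjectiveDimensionLT_zero
      apply isZero_of_subsingleton_module
      refine ⟨fun a b => Subtype.ext ?_⟩
      rw [hz i (by omega) a.1, hz i (by omega) b.1]
    | succ j ih =>
      intro i hi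
      have h3 := ih (i + 1) (by omega)
      rw [← hex i] at h3
      have hG' : Module.Injective R (G i) := hG i
      have : CategoryTheory.Injective (ModuleCat.of R (G i)) :=
        (Module.injective_iff_injective_object R (G i)).mp hG'
      have h2 : HasInjectiveDimensionLT (ModuleCat.of R (G i)) (j + 1) :=
        hasInjectiveDimensionLT_of_ge _ 1 _ (by omega)
      have hs := LinearMap.shortExact_shortComplexKer (LinearMap.surjective_rangeRestrict (d i))
      have h1 := hs.hasInjectiveDimensionLT_X₁ j h3 h2
      have e := LinearMap.ker_rangeRestrict (d i)
      have h1' : HasInjectiveDimensionLT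
        (ModuleCat.of R (LinearMap.ker (d i).rangeRestrict)) (j + 1) := h1
      rw [e] at h1'
      exact h1'
  have h0 := key (n + 1) 0 (by omega)
  rw [← hex0] at h0
  exact hasInjectiveDimensionLT_of_iso (LinearEquiv.ofInjective ε hε).symm.toModuleIso (n + 1)

open RingTheory.Sequence in
lemma weaklyRegular_kernel {R : Type u} [CommRing R] (ys : List R) (y : R) :
    ∀ {A B C : Type u} [AddCommGroup A] [Module R A]
    [AddCommGroup B] [Module R B] [AddCommGroup C] [Module R C]
    (i : A →ₗ[R] B) (p : B →ₗ[R] C), Function.Injective i → Function.Exact i p →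
    Function.Surjective p → IsWeaklyRegular C ys → IsWeaklyRegular B (ys ++ [y]) →
    IsWeaklyRegular A (ys ++ [y]) := by
  induction ys with
  | nil =>
    intro A B C _ _ _ _ _ _ i p hi _ _ _ hB
    simp only [List.nil_append, isWeaklyRegular_singleton_iff] at hB ⊢
    exact hB.of_injective i hi
  | cons x xs ih =>
    intro A B C _ _ _ _ _ _ i p hi hex hp hC hB
    rw [List.cons_append, isWeaklyRegular_cons_iff] at hB ⊢
    rw [isWeaklyRegular_cons_iff] at hC
    refine ⟨hB.1.of_injective i hi, ?_⟩
    exact ih (QuotSMulTop.map x i) (QuotSMulTop.map x p)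
      (quotSMulTop_map_injective x i p hi hex hC.1)
      (QuotSMulTop.map_exact x hex hp) (QuotSMulTop.map_surjective x hp) hC.2 hB.2

open RingTheory.Sequence in
lemma isMaximalCM_of {R : Type u} [CommRing R] [IsLocalRing R] [IsNoetherianRing R]
    (rs : List R) (hmem : ∀ r ∈ rs, r ∈ maximalIdeal R)
    (hlen : (rs.length : WithBot ℕ∞) = ringKrullDim R)
    (M : Type u) [AddCommGroup M] [Module R M] [Module.Finite R M] [Nontrivial M]
    (hM : IsWeaklyRegular M rs) : GG.IsMaximalCM R M := by
  have hle : ∀ ss : List R, IsRegular M ss →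
      (ss.length : WithBot ℕ∞) ≤ Module.supportDim R M := by
    intro ss hss
    rw [← Module.supportDim_add_length_eq_supportDim_of_isRegular ss hss]
    have := hss.quot_ofList_smul_nontrivial ⊤
    have hb := Module.supportDim_ne_bot_of_nontrivial R (M ⧸ Ideal.ofList ss • (⊤ : Submodule R M))
    obtain ⟨c, hc⟩ := WithBot.ne_bot_iff_exists.mp hb
    rw [← hc]
    have : ((ss.length : ℕ∞) : WithBot ℕ∞) ≤ ((c + (ss.length : ℕ∞) : ℕ∞) : WithBot ℕ∞) :=
      WithBot.coe_le_coe.mpr le_add_self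
    simpa using this
  have hreg := IsRegular.of_isWeaklyRegular_of_mem_maximalIdeal M hmem hM
  have hdim : Module.supportDim R M = ringKrullDim R :=
    le_antisymm (Module.supportDim_le_ringKrullDim R M) (hlen ▸ hle rs hreg)
  have hdep : GG.mdepth R M = rs.length := by
    apply le_antisymm
    · apply sSup_le
      rintro c ⟨ss, rfl, -, hss⟩
      have := hle ss hss
      rw [hdim, ← hlen] at this
      exact_mod_cast this
    · exact le_sSup ⟨rs, rfl, hmem, hreg⟩
  refine ⟨?_, hdim⟩
  change (GG.mdepth R M : WithBot ℕ∞) = Module.supportDim R M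
  rw [hdep, hdim, ← hlen]
  rfl

open RingTheory.Sequence in
lemma exists_regular_of_isCM {R : Type u} [CommRing R] [IsLocalRing R] [IsNoetherianRing R]
    (hCM : GG.IsCMLocalRing R) : ∃ rs : List R, (∀ r ∈ rs, r ∈ maximalIdeal R) ∧
      (rs.length : WithBot ℕ∞) = ringKrullDim R ∧ IsWeaklyRegular R rs := by
  unfold GG.IsCMLocalRing at hCM
  have hfin : GG.mdepth R R ≠ ⊤ := by
    intro h
    rw [h] at hCM
    exact absurd hCM (ringKrullDim_lt_top (R := R)).ne'
  have hne : {c : ℕ∞ | ∃ rs : List R, c = rs.length ∧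
    (∀ r ∈ rs, r ∈ IsLocalRing.maximalIdeal R) ∧ IsRegular R rs}.Nonempty :=
    ⟨0, [], by simp, by simp, IsRegular.nil R R⟩
  have hmem := haveI := hne.to_subtype; ENat.sSup_mem_of_nonempty_of_lt_top (lt_top_iff_ne_top.mpr hfin)
  obtain ⟨rs, h1, h2, h3⟩ := hmem
  refine ⟨rs, h2, ?_, h3.toIsWeaklyRegular⟩
  rw [← hCM]
  unfold GG.mdepth
  rw [h1]
  rfl

open RingTheory.Sequence in
lemma weaklyRegular_pi {R : Type u} [CommRing R] (r : ℕ) (rs : List R)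
    (h : IsWeaklyRegular R rs) : IsWeaklyRegular (Fin r → R) rs :=
  ((TensorProduct.rid R (Fin r → R)).isWeaklyRegular_congr rs).mp
    (h.isWeaklyRegular_lTensor (M₂ := Fin r → R))

open RingTheory.Sequence in
lemma finite_id {R : Type u} [CommRing R] [IsNoetherianRing R]
    (rs : List R) (hR : IsWeaklyRegular R rs)
    (h : ∀ (M : Type u) [AddCommGroup M] [Module R M] [Module.Finite R M],
      IsWeaklyRegular M rs → ∃ n, HasInjectiveDimensionLT (ModuleCat.of R M) n)
    (zs : List R) : ∀ (ys : List R), rs = ys ++ zs →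
    ∀ (M : Type u) [AddCommGroup M] [Module R M] [Module.Finite R M],
      IsWeaklyRegular M ys → ∃ n, HasInjectiveDimensionLT (ModuleCat.of R M) n := by
  induction zs with
  | nil =>
    intro ys hys M _ _ _ hM
    simp only [List.append_nil] at hys
    subst hys
    exact h M hM
  | cons z zs ih =>
    intro ys hys M _ _ _ hM
    have hys' : rs = (ys ++ [z]) ++ zs := by simp [hys]
    obtain ⟨r, f, hf⟩ := Module.Finite.exists_fin' R M
    have hF := weaklyRegular_pi r rs hR
    have hF' : IsWeaklyRegular (Fin r → R) (ys ++ [z]) := by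
      rw [hys', isWeaklyRegular_append_iff] at hF
      exact hF.1
    have hK : IsWeaklyRegular (LinearMap.ker f) (ys ++ [z]) :=
      weaklyRegular_kernel ys z (LinearMap.ker f).subtype f (Submodule.subtype_injective _)
        (LinearMap.exact_subtype_ker_map f) hf hM hF'
    obtain ⟨a, ha⟩ := ih (ys ++ [z]) hys' (LinearMap.ker f) hK
    obtain ⟨b, hb⟩ := h (Fin r → R) hF
    refine ⟨a + b, ?_⟩
    have hs := LinearMap.shortExact_shortComplexKer hf
    exact hs.hasInjectiveDimensionLT_X₃ (a + b)
      (hasInjectiveDimensionLT_of_ge (ModuleCat.of R (Fin r → R)) b _ (by omega))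
      (hasInjectiveDimensionLT_of_ge (ModuleCat.of R (LinearMap.ker f)) a _ (by omega))

lemma isRegularLocal_of {R : Type u} [CommRing R] [IsRegularLocalRing R] :
    GG.IsRegularLocal R := by
  refine ⟨inferInstance, ?_⟩
  have hfg : (maximalIdeal R).FG := (isNoetherianRing_iff_ideal_fg R).mp inferInstance _
  have hfin := Submodule.FG.finite_generators hfg
  refine ⟨hfin.toFinset, ?_, ?_⟩
  · rw [Set.Finite.coe_toFinset]
    exact Submodule.span_generators _
  · rw [← Set.ncard_eq_toFinset_card _ hfin, Submodule.FG.generators_ncard hfg]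
    exact IsRegularLocalRing.spanFinrank_maximalIdeal

open RingTheory.Sequence in
theorem main_result (R : Type u) [CommRing R] [IsLocalRing R] [IsNoetherianRing R]
    (hCM : GG.IsCMLocalRing R)
    (h : ∀ M : ModuleCat.{u} R, Module.Finite R M → GG.IsMaximalCM R M → ∃ n, GG.idLE R M n) :
    GG.IsRegularLocal R := by
  obtain ⟨rs, hmem, hlen, hreg⟩ := exists_regular_of_isCM hCM
  have hid : ∀ (M : Type u) [AddCommGroup M] [Module R M] [Module.Finite R M],
      IsWeaklyRegular M rs → ∃ n, HasInjectiveDimensionLT (ModuleCat.of R M) n := by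
    intro M _ _ hfin hM
    rcases subsingleton_or_nontrivial M with hs | hn
    · exact ⟨0, (isZero_of_subsingleton_module M hs).hasInjectiveDimensionLT_zero⟩
    · obtain ⟨n, hn⟩ := h (ModuleCat.of R M) hfin (isMaximalCM_of rs hmem hlen M hM)
      exact ⟨n + 1, hasInjDim_of_idLE M n hn⟩
  obtain ⟨n, hn⟩ := finite_id rs hreg hid rs [] rfl (ResidueField R) (IsWeaklyRegular.nil R _)
  have hpd := pd_of_ext_k n (ModuleCat.of R (ResidueField R))
    (HasInjectiveDimensionLT.subsingleton (ModuleCat.of R (ResidueField R)) n n le_rfl _)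
  have := regular_of_pd rs.length R hlen.symm.le n hpd
  exact isRegularLocal_of

end Aux


open GG in
/-- If every maximal Cohen–Macaulay module over a Cohen–Macaulay local ring with a
dualizing complex has finite injective dimension, then the ring is regular. -/
theorem stmt8 (R : Type u) [CommRing R] [IsLocalRing R] [IsNoetherianRing R]
    (hCM : IsCMLocalRing R) (hR : HasDualizingComplex R)
    (h : ∀ M : ModuleCat.{u} R, Module.Finite R M → IsMaximalCM R M → ∃ n, idLE R M n) :
    IsRegularLocal R := by
  exact Aux.main_result R hCM h
end
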